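/- There exist a sequence of finite connected simple graphs G_n = (V_n, E_n) with |V_n| → ∞ and uniformly bounded degrees (i.e. sup_n max_{v∈V_n} deg(v) < ∞), a sequence of symmetric edge weights W_n = (w_n(e) : e ∈ E_n), and a sequence of positive reals δ_n → 0, such that 1 ≤ w_n(e) ≤ 1 + δ_n for every e ∈ E_n and mix(G_n) ≤ δ_n · min_{x ∈ V_n} mix(G_n, W_n, x). In particular, increasing some edge weights from 1 to at most 1 + δ_n makes the total variation mixing time from the best starting point of the perturbed walk of strictly larger order than the worst-case mixing time of the unperturbed walk. -/

import Mathlib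

open Finset Filter
open scoped Classical

/-- Transition matrix of the lazy weighted random walk on a graph:
`P(x,x) = 1/2` and `P(x,y) = w(x,y)/(2 ∑_{z ∼ x} w(x,z))` for `y` adjacent to `x`. -/
noncomputable def lazyGraphP {V : Type*} [Fintype V] (G : SimpleGraph V) (w : V → V → ℝ) :
    Matrix V V ℝ :=
  fun x y => if y = x then 1 / 2
    else if G.Adj x y then w x y / (2 * ∑ z, if G.Adj x z then w x z else 0) else 0

/-- Stationary distribution of the weighted walk:
`π(x) = (∑_{z ∼ x} w(x,z)) / (∑_v ∑_{z ∼ v} w(v,z))`. -/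
noncomputable def graphPi {V : Type*} [Fintype V] (G : SimpleGraph V) (w : V → V → ℝ) :
    V → ℝ :=
  fun x => (∑ z, if G.Adj x z then w x z else 0) /
    (∑ v, ∑ z, if G.Adj v z then w v z else 0)

/-- Total variation mixing time of the lazy weighted walk on `(G,w)` started from `x`. -/
noncomputable def graphMixFrom {V : Type*} [Fintype V] [DecidableEq V] (G : SimpleGraph V)
    (w : V → V → ℝ) (x : V) : ℕ :=
  sInf {t : ℕ | (∑ y, |((lazyGraphP G w) ^ t) x y - graphPi G w y|) / 2 ≤ 1 / 4}

/-- Worst-case total variation mixing time of the lazy weighted walk on `(G,w)`. -/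
noncomputable def graphMix {V : Type*} [Fintype V] [DecidableEq V] (G : SimpleGraph V)
    (w : V → V → ℝ) : ℕ :=
  sSup {k : ℕ | ∃ x : V, k = graphMixFrom G w x}

set_option linter.unusedSectionVars false

namespace MBS

/-- The tent-like function `j (q - j)` on the cycle. -/
noncomputable def phi (q : ℕ) (j : ZMod q) : ℝ := (j.val : ℝ) * ((q : ℝ) - j.val)

lemma val_sub_one {q : ℕ} [NeZero q] {j : ZMod q} (hj : j ≠ 0) : (j - 1).val + 1 = j.val := by
  have h1 : 0 < j.val := ZMod.val_pos.2 hj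
  have h2 : j.val < q := ZMod.val_lt j
  have : (j - 1) = ((j.val - 1 : ℕ) : ZMod q) := by
    rw [Nat.cast_sub (by omega)]
    simp
  rw [this, ZMod.val_natCast, Nat.mod_eq_of_lt (by omega)]
  omega

lemma add_one_ne_zero {q : ℕ} [NeZero q] {j : ZMod q} (hj : j ≠ -1) : j + 1 ≠ 0 := by
  intro h
  exact hj (eq_neg_of_add_eq_zero_left h)

lemma val_add_one {q : ℕ} [NeZero q] {j : ZMod q} (hj : j ≠ -1) : (j + 1).val = j.val + 1 := by
  have := val_sub_one (add_one_ne_zero hj)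
  simp at this
  omega

lemma val_neg_one' {q : ℕ} [NeZero q] : ((-1 : ZMod q)).val + 1 = q := by
  obtain ⟨n, rfl⟩ : ∃ n, q = n + 1 := ⟨q - 1, by have := NeZero.pos q; omega⟩
  rw [ZMod.val_neg_one]

lemma phi_zero {q : ℕ} : phi q 0 = 0 := by simp [phi]

lemma val_le_real {q : ℕ} [NeZero q] (j : ZMod q) : (j.val : ℝ) ≤ q := by
  exact_mod_cast (ZMod.val_lt j).le

lemma phi_nonneg {q : ℕ} [NeZero q] (j : ZMod q) : 0 ≤ phi q j := by
  have := val_le_real j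
  unfold phi
  apply mul_nonneg <;> [positivity; linarith]

lemma phi_le {q : ℕ} [NeZero q] (j : ZMod q) : phi q j ≤ (q : ℝ) ^ 2 / 4 := by
  unfold phi
  nlinarith [sq_nonneg ((q : ℝ) - 2 * j.val)]

lemma phi_second_ne {q : ℕ} [NeZero q] {j : ZMod q} (hj : j ≠ 0) :
    phi q (j + 1) + phi q (j - 1) = 2 * phi q j - 2 := by
  have h1 : ((j - 1).val : ℝ) = j.val - 1 := by
    have := val_sub_one hj
    rw [← this]; push_cast; ring
  by_cases h : j = -1
  · have h3 : phi q (j + 1) = 0 := by rw [h]; simp [phi]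
    have h2 : (j.val : ℝ) = q - 1 := by
      have := val_neg_one' (q := q)
      rw [h]
      have : (((-1 : ZMod q).val + 1 : ℕ) : ℝ) = q := by rw [this]
      push_cast at this; linarith
    rw [h3]; unfold phi; rw [h1, h2]; ring
  · have h2 : ((j + 1).val : ℝ) = j.val + 1 := by rw [val_add_one h]; push_cast; ring
    unfold phi; rw [h1, h2]; ring

lemma phi_one {q : ℕ} [NeZero q] (hq : 2 ≤ q) : phi q 1 = q - 1 := by
  have : (1 : ZMod q).val = 1 := ZMod.val_one'' (by omega)
  simp [phi, this]

lemma phi_neg_one {q : ℕ} [NeZero q] : phi q (-1) = q - 1 := by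
  have := val_neg_one' (q := q)
  have h : (((-1 : ZMod q).val + 1 : ℕ) : ℝ) = q := by rw [this]
  push_cast at h
  have h2 : ((-1 : ZMod q).val : ℝ) = q - 1 := by linarith
  unfold phi; rw [h2]; ring

/-- Green function of the cycle. -/
noncomputable def green (q : ℕ) (f : ZMod q → ℝ) [NeZero q] (e : ZMod q) : ℝ :=
  - ∑ e', f e' * (phi q (e - e') / (2 * q))

lemma green_laplace {q : ℕ} [NeZero q] (hq : 2 ≤ q) (f : ZMod q → ℝ) (e : ZMod q) :
    green q f (e + 1) + green q f (e - 1) - 2 * green q f e = - f e + (∑ e', f e') / q := by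
  have hq0 : (0 : ℝ) < q := by exact_mod_cast (by omega : 0 < q)
  have key : ∀ j : ZMod q, phi q (j + 1) + phi q (j - 1) - 2 * phi q j
      = (if j = 0 then 2 * (q : ℝ) else 0) - 2 := by
    intro j
    by_cases hj : j = 0
    · subst hj
      simp [phi_one hq, phi_neg_one, phi_zero]; ring
    · rw [phi_second_ne hj]; simp [hj]
  unfold green
  have : ∀ e', f e' * (phi q (e + 1 - e') / (2 * q)) + f e' * (phi q (e - 1 - e') / (2 * q))
      - 2 * (f e' * (phi q (e - e') / (2 * q))) = (if e' = e then f e' else 0) - f e' / q := by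
    intro e'
    have h := key (e - e')
    have h1 : e - e' + 1 = e + 1 - e' := by ring
    have h2 : e - e' - 1 = e - 1 - e' := by ring
    rw [h1, h2] at h
    have h3 : f e' * (phi q (e + 1 - e') / (2 * q)) + f e' * (phi q (e - 1 - e') / (2 * q))
      - 2 * (f e' * (phi q (e - e') / (2 * q))) = f e' / (2 * q) *
       (phi q (e + 1 - e') + phi q (e - 1 - e') - 2 * phi q (e - e')) := by
      field_simp
    rw [h3, h]
    by_cases he : e' = e
    · simp [he]; field_simp
    · have : e - e' ≠ 0 := fun h => he (sub_eq_zero.1 h).symm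
      simp [he, this]; field_simp
  have h4 := Finset.sum_congr (rfl : (univ : Finset (ZMod q)) = univ) (fun e' _ => this e')
  rw [Finset.sum_sub_distrib, Finset.sum_add_distrib, Finset.sum_sub_distrib, ← Finset.mul_sum,
    ← Finset.sum_div] at h4
  simp at h4
  linarith

lemma green_bound {q : ℕ} [NeZero q] (f : ZMod q → ℝ) (C : ℝ) (hf : ∀ e, |f e| ≤ C)
    (e : ZMod q) : |green q f e| ≤ q ^ 2 * C := by
  have hq0 : (0 : ℝ) < q := by exact_mod_cast NeZero.pos q
  have hC : 0 ≤ C := (abs_nonneg _).trans (hf e)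
  unfold green
  rw [abs_neg]
  refine (Finset.abs_sum_le_sum_abs _ _).trans ?_
  have : ∀ e' ∈ (univ : Finset (ZMod q)), |f e' * (phi q (e - e') / (2 * q))| ≤ C * q := by
    intro e' _
    rw [abs_mul]
    have h1 : |phi q (e - e') / (2 * q)| ≤ q := by
      rw [abs_of_nonneg (div_nonneg (phi_nonneg _) (by positivity)), div_le_iff₀ (by positivity)]
      have := phi_le (e - e')
      nlinarith
    exact mul_le_mul (hf e') h1 (abs_nonneg _) hC
  refine (Finset.sum_le_sum this).trans ?_
  simp [ZMod.card]
  nlinarith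

lemma green_sub {q : ℕ} [NeZero q] (f f' : ZMod q → ℝ) (e : ZMod q) :
    green q f e - green q f' e = green q (fun e => f e - f' e) e := by
  unfold green
  simp only [sub_mul, Finset.sum_sub_distrib]; ring

end MBS

namespace MBS

section Homog

variable {X : Type} {q : ℕ} [NeZero q]

/-- Interior supersolution condition. -/
def IntCond {ℓ : ℕ} (g : ZMod q → Equiv.Perm X) (Φ Φ' : ZMod q → ZMod ℓ → X → ℝ) : Prop :=
  ∀ e k x, k ≠ 0 → (1/2) * Φ e k x + (1/4) * (Φ e (k-1) x +
    Φ e (k+1) (if k = -1 then g e x else x)) ≤ Φ' e k x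

/-- One step of the tagged chain at a site. -/
noncomputable def siteExpr {ℓ : ℕ} (g : ZMod q → Equiv.Perm X) (w : ZMod q → ℝ)
    (Φ : ZMod q → ZMod ℓ → X → ℝ) (e : ZMod q) (x : X) : ℝ :=
  (1/2) * Φ e 0 x + (w e * Φ e 1 x + w e * Φ e (-1) ((g e).symm x) + Φ (e+1) 0 x
    + Φ (e-1) 0 x + Φ e 0 x) / (2 * (3 + 2 * w e))

/-- The data of the homogenization lemma. -/
structure HData (X : Type) (q : ℕ) [NeZero q] where
  g : ZMod q → Equiv.Perm X
  w : ZMod q → ℝ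
  κ : ZMod q → X → ℝ
  U : ℝ → X → ℝ
  d : ℝ → ZMod q → X → ℝ
  C : ℝ
  K : ℝ
  η : ℝ
  S : ℝ

namespace HData

variable (H : HData X q)

/-- source term -/
noncomputable def f (s : ℝ) (e : ZMod q) (x : X) : ℝ :=
  H.w e * (H.U s (H.g e x) + H.U s ((H.g e).symm x) - 2 * H.U s x)
    - H.w e * (H.d s e x + H.d s e ((H.g e).symm x)) / (2 * q) - H.C * H.κ e x

/-- corrector -/
noncomputable def xi (s : ℝ) (e : ZMod q) (x : X) : ℝ := green q (fun e' => H.f s e' x) e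

/-- corrected site value -/
noncomputable def Un (ℓ : ℕ) (s : ℝ) (e : ZMod q) (x : X) : ℝ := H.U s x + H.xi s e x / ℓ

/-- time step -/
noncomputable def eps (q ℓ : ℕ) : ℝ := 1 / (4 * q * (ℓ : ℝ) ^ 2)

/-- The supersolution. -/
noncomputable def Phi (ℓ : ℕ) (s : ℝ) (e : ZMod q) (k : ZMod ℓ) (x : X) : ℝ :=
  (1 - (k.val : ℝ) / ℓ) * H.Un ℓ s e x + ((k.val : ℝ) / ℓ) * H.Un ℓ s e (H.g e x)
    - 2 * eps q ℓ * H.d s e x * phi ℓ k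

/-- The hypotheses. -/
structure Good : Prop where
  w1 : ∀ e, 1 ≤ H.w e
  w2 : ∀ e, H.w e ≤ 2
  κ0 : ∀ e x, H.κ e x = 0 ∨ H.κ e x = 1
  C0 : 0 ≤ H.C
  K1 : 0 ≤ H.K
  η0 : 0 < H.η
  q2 : 2 ≤ q
  Kq : H.K ≤ H.η * q
  Ub : ∀ s x, 0 ≤ s → s ≤ H.S → |H.U s x| ≤ H.K
  db : ∀ s e x, 0 ≤ s → s ≤ H.S → |H.d s e x| ≤ H.K
  UL : ∀ s t x, 0 ≤ s → s ≤ t → t ≤ H.S → |H.U t x - H.U s x| ≤ H.K * (t - s)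
  dL : ∀ s t e x, 0 ≤ s → s ≤ t → t ≤ H.S → |H.d t e x - H.d s e x| ≤ H.K * (t - s)
  inc1 : ∀ s t e x, 0 ≤ s → s ≤ t → t ≤ H.S → (t - s) * (H.d s e x + H.η) ≤ H.U t x - H.U s x
  inc2 : ∀ s t e x, 0 ≤ s → s ≤ t → t ≤ H.S →
    (t - s) * (H.d s e x + H.η) ≤ H.U t (H.g e x) - H.U s (H.g e x)
  mean : ∀ s x, 0 ≤ s → s ≤ H.S → ∑ e, H.f s e x ≤ - H.η
  κU : ∀ s e x, 0 ≤ s → s ≤ H.S → H.κ e x = 1 → H.η ≤ H.U s x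

/-- bound on the corrector -/
noncomputable def Kx : ℝ := q ^ 2 * (12 * H.K + H.C)

variable {H}

lemma qpos : (0 : ℝ) < q := by exact_mod_cast NeZero.pos q

lemma Good.xi_bound (h : H.Good) (s : ℝ) (e : ZMod q) (x : X) (h0 : 0 ≤ s) (h1 : s ≤ H.S) :
    |H.xi s e x| ≤ H.Kx := by
  apply green_bound
  intro e
  have hq := qpos (q := q)
  have hq2 : (2 : ℝ) ≤ q := by exact_mod_cast h.q2
  have a1 := abs_le.1 (h.Ub s (H.g e x) h0 h1)
  have a2 := abs_le.1 (h.Ub s ((H.g e).symm x) h0 h1)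
  have a3 := abs_le.1 (h.Ub s x h0 h1)
  have a4 := abs_le.1 (h.db s e x h0 h1)
  have a5 := abs_le.1 (h.db s e ((H.g e).symm x) h0 h1)
  have w1 := h.w1 e
  have w2 := h.w2 e
  have K1 := h.K1
  have C0 := h.C0
  have b1 : |H.w e * (H.U s (H.g e x) + H.U s ((H.g e).symm x) - 2 * H.U s x)| ≤ 8 * H.K := by
    rw [abs_mul, abs_of_nonneg (by linarith)]
    have : |(H.U s (H.g e x) + H.U s ((H.g e).symm x) - 2 * H.U s x)| ≤ 4 * H.K := by
      rw [abs_le]; constructor <;> linarith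
    nlinarith [abs_nonneg (H.U s (H.g e x) + H.U s ((H.g e).symm x) - 2 * H.U s x)]
  have b2 : |H.w e * (H.d s e x + H.d s e ((H.g e).symm x)) / (2 * q)| ≤ 4 * H.K := by
    rw [abs_div, abs_mul, abs_of_nonneg (by linarith : 0 ≤ H.w e),
      abs_of_pos (by linarith : (0:ℝ) < 2 * q), div_le_iff₀ (by linarith)]
    have : |(H.d s e x + H.d s e ((H.g e).symm x))| ≤ 2 * H.K := by
      rw [abs_le]; constructor <;> linarith
    nlinarith [abs_nonneg (H.d s e x + H.d s e ((H.g e).symm x)), mul_nonneg K1 (by linarith : 0 ≤ (q:ℝ) - 2)]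
  have b3 : |H.C * H.κ e x| ≤ H.C := by
    rcases h.κ0 e x with h | h <;> rw [h] <;> simp [C0, abs_of_nonneg]
  rw [abs_le] at *
  unfold f
  constructor <;> linarith

lemma Good.xi_lip (h : H.Good) (s t : ℝ) (e : ZMod q) (x : X) (h0 : 0 ≤ s) (hst : s ≤ t)
    (h1 : t ≤ H.S) : |H.xi t e x - H.xi s e x| ≤ H.Kx * (t - s) := by
  unfold xi
  rw [green_sub]
  have : H.Kx * (t - s) ≥ q ^ 2 * (12 * H.K * (t - s)) := by
    unfold Kx
    have hq := qpos (q := q)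
    have C0 := h.C0
    have : 0 ≤ (q:ℝ)^2 * (H.C * (t-s)) := by
      have : 0 ≤ t - s := by linarith
      positivity
    nlinarith
  refine le_trans ?_ this
  apply green_bound
  intro e
  have hq := qpos (q := q)
  have hq2 : (2 : ℝ) ≤ q := by exact_mod_cast h.q2
  have a1 := abs_le.1 (h.UL s t (H.g e x) h0 hst h1)
  have a2 := abs_le.1 (h.UL s t ((H.g e).symm x) h0 hst h1)
  have a3 := abs_le.1 (h.UL s t x h0 hst h1)
  have a4 := abs_le.1 (h.dL s t e x h0 hst h1)
  have a5 := abs_le.1 (h.dL s t e ((H.g e).symm x) h0 hst h1)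
  have w1 := h.w1 e
  have w2 := h.w2 e
  have K1 := h.K1
  have C0 := h.C0
  set L := H.K * (t - s) with hL
  have L0 : 0 ≤ L := mul_nonneg K1 (by linarith)
  set A := (H.U t (H.g e x) - H.U s (H.g e x)) + (H.U t ((H.g e).symm x) - H.U s ((H.g e).symm x))
    - 2 * (H.U t x - H.U s x) with hA
  set B := (H.d t e x - H.d s e x) + (H.d t e ((H.g e).symm x) - H.d s e ((H.g e).symm x)) with hB
  have b1 : |H.w e * A| ≤ 8 * L := by
    rw [abs_mul, abs_of_nonneg (by linarith)]
    have : |A| ≤ 4 * L := by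
      rw [abs_le]; constructor <;> linarith
    nlinarith [abs_nonneg A]
  have b2 : |H.w e * B / (2 * q)| ≤ 4 * L := by
    rw [abs_div, abs_mul, abs_of_nonneg (by linarith : 0 ≤ H.w e),
      abs_of_pos (by linarith : (0:ℝ) < 2 * q), div_le_iff₀ (by linarith)]
    have : |B| ≤ 2 * L := by
      rw [abs_le]; constructor <;> linarith
    nlinarith [abs_nonneg B, mul_nonneg L0 (by linarith : 0 ≤ (q:ℝ) - 2)]
  have e1 : H.f t e x - H.f s e x = H.w e * A - H.w e * B / (2 * q) := by
    unfold f; rw [hA, hB]; ring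
  rw [e1]
  have : 12 * H.K * (t - s) = 12 * L := by rw [hL]; ring
  rw [this]
  rw [abs_le] at *
  constructor <;> linarith

lemma eps_pos {ℓ : ℕ} (hℓ : 0 < ℓ) : 0 < eps q ℓ := by
  have hq := qpos (q := q)
  have : (0:ℝ) < ℓ := by exact_mod_cast hℓ
  unfold eps; positivity

lemma eps_mul {ℓ : ℕ} (hℓ : 0 < ℓ) : eps q ℓ * (ℓ : ℝ) ^ 2 = 1 / (4 * q) := by
  have hq := qpos (q := q)
  have : (0:ℝ) < ℓ := by exact_mod_cast hℓ
  unfold eps; field_simp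

lemma Good.Kx_nonneg (h : H.Good) : 0 ≤ H.Kx := by
  have := h.K1; have := h.C0
  unfold Kx; positivity

lemma Good.K_le_Kx (h : H.Good) : H.K ≤ H.Kx ∧ H.C ≤ H.Kx := by
  have h1 := h.K1; have h2 := h.C0
  have hq2 : (2 : ℝ) ≤ q := by exact_mod_cast h.q2
  unfold Kx
  have : (1:ℝ) ≤ (q:ℝ)^2 := by nlinarith
  constructor <;> nlinarith

set_option maxHeartbeats 1000000 in
lemma Good.interior (h : H.Good) {ℓ : ℕ} [NeZero ℓ] (hℓ : 17 * H.Kx * q ≤ H.η * ℓ)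
    (s : ℝ) (h0 : 0 ≤ s) (h1 : s + eps q ℓ ≤ H.S) :
    IntCond H.g (H.Phi ℓ s) (H.Phi ℓ (s + eps q ℓ)) := by
  intro e k x hk
  have hL : (0:ℝ) < ℓ := qpos
  have hq := qpos (q := q)
  have hq2 : (2 : ℝ) ≤ q := by exact_mod_cast h.q2
  have hε : 0 < eps q ℓ := eps_pos (NeZero.pos ℓ)
  set ε := eps q ℓ with hεd
  have hkm : ((k - 1).val : ℝ) = k.val - 1 := by
    have := val_sub_one hk
    rw [← this]; push_cast; ring
  set ρ := (k.val : ℝ) / ℓ with hρ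
  have hρ0 : 0 ≤ ρ := by positivity
  have hρ1 : ρ ≤ 1 := by rw [hρ, div_le_one hL]; exact val_le_real k
  have e1 : H.Phi ℓ s e (k-1) x = (1 - ρ) * H.Un ℓ s e x + ρ * H.Un ℓ s e (H.g e x)
      + (H.Un ℓ s e x - H.Un ℓ s e (H.g e x)) / ℓ - 2 * ε * H.d s e x * phi ℓ (k-1) := by
    unfold Phi; rw [hkm, ← hεd, hρ]; field_simp; ring
  have e2 : H.Phi ℓ s e (k+1) (if k = -1 then H.g e x else x) =
      (1 - ρ) * H.Un ℓ s e x + ρ * H.Un ℓ s e (H.g e x)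
      - (H.Un ℓ s e x - H.Un ℓ s e (H.g e x)) / ℓ - 2 * ε * H.d s e x * phi ℓ (k+1) := by
    by_cases hk1 : k = -1
    · have hv : (k.val : ℝ) = ℓ - 1 := by
        have := val_neg_one' (q := ℓ)
        rw [hk1]
        have : (((-1 : ZMod ℓ).val + 1 : ℕ) : ℝ) = ℓ := by rw [this]
        push_cast at this; linarith
      have : k + 1 = 0 := by rw [hk1]; ring
      rw [if_pos hk1, this, phi_zero]
      unfold Phi
      rw [hρ, hv]; simp [phi_zero]; field_simp; ring
    · rw [if_neg hk1]
      have hkp : ((k + 1).val : ℝ) = k.val + 1 := by rw [val_add_one hk1]; push_cast; ring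
      unfold Phi; rw [hkp, ← hεd, hρ]; field_simp; ring
  have e3 : H.Phi ℓ s e k x = (1 - ρ) * H.Un ℓ s e x + ρ * H.Un ℓ s e (H.g e x)
      - 2 * ε * H.d s e x * phi ℓ k := by
    unfold Phi; rw [← hεd, hρ]
  have e4 : H.Phi ℓ (s+ε) e k x = (1 - ρ) * H.Un ℓ (s+ε) e x + ρ * H.Un ℓ (s+ε) e (H.g e x)
      - 2 * ε * H.d (s+ε) e x * phi ℓ k := by
    unfold Phi; rw [← hεd, hρ]
  have ep := phi_second_ne hk
  have ep' : phi ℓ (k+1) = 2 * phi ℓ k - 2 - phi ℓ (k-1) := by linarith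
  rw [e1, e2, e3, e4, ep']
  have xl : ∀ x, -(ε * H.η / 4) ≤ (H.xi (s+ε) e x - H.xi s e x) / ℓ := by
    intro x
    have := abs_le.1 (h.xi_lip s (s+ε) e x h0 (by linarith) h1)
    rw [le_div_iff₀ hL]
    have h3 := h.Kx_nonneg
    have : 4 * H.Kx ≤ H.η * ℓ := by nlinarith
    nlinarith
  have u1 : ε * (H.d s e x + H.η) - ε * H.η / 4 ≤ H.Un ℓ (s+ε) e x - H.Un ℓ s e x := by
    have a := h.inc1 s (s+ε) e x h0 (by linarith) h1
    have b := xl x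
    have : H.Un ℓ (s+ε) e x - H.Un ℓ s e x = H.U (s+ε) x - H.U s x + (H.xi (s+ε) e x - H.xi s e x) / ℓ := by
      unfold Un; ring
    rw [this]
    have : s + ε - s = ε := by ring
    rw [this] at a
    linarith
  have u2 : ε * (H.d s e x + H.η) - ε * H.η / 4 ≤ H.Un ℓ (s+ε) e (H.g e x) - H.Un ℓ s e (H.g e x) := by
    have a := h.inc2 s (s+ε) e x h0 (by linarith) h1
    have b := xl (H.g e x)
    have : H.Un ℓ (s+ε) e (H.g e x) - H.Un ℓ s e (H.g e x) = H.U (s+ε) (H.g e x) - H.U s (H.g e x) + (H.xi (s+ε) e (H.g e x) - H.xi s e (H.g e x)) / ℓ := by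
      unfold Un; ring
    rw [this]
    have : s + ε - s = ε := by ring
    rw [this] at a
    linarith
  have u3 : 2 * ε * (H.d (s+ε) e x - H.d s e x) * phi ℓ k ≤ ε * H.η / 8 := by
    have a := abs_le.1 (h.dL s (s+ε) e x h0 (by linarith) h1)
    have p0 := phi_nonneg k
    have p1 := phi_le k
    have : s + ε - s = ε := by ring
    rw [this] at a
    have c1 : 2 * ε * (H.d (s+ε) e x - H.d s e x) * phi ℓ k ≤ 2 * ε * (H.K * ε) * ((ℓ:ℝ)^2/4) := by
      have K1 := h.K1
      apply mul_le_mul _ p1 p0 (by positivity)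
      apply mul_le_mul_of_nonneg_left a.2 (by positivity)
    have c2 : 2 * ε * (H.K * ε) * ((ℓ:ℝ)^2/4) = ε * (H.K * (ε * (ℓ:ℝ)^2) / 2) := by ring
    rw [c2, eps_mul (NeZero.pos ℓ)] at c1
    have c3 : H.K * (1/(4*(q:ℝ))) / 2 ≤ H.η / 8 := by
      have := h.Kq
      rw [show H.K * (1/(4*(q:ℝ))) / 2 = H.K / (8 * q) by field_simp; ring]
      rw [div_le_div_iff₀ (by positivity) (by norm_num)]
      nlinarith
    have c4 := mul_le_mul_of_nonneg_left c3 hε.le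
    linarith
  have v1 := mul_le_mul_of_nonneg_left u1 (by linarith : 0 ≤ 1 - ρ)
  have v2 := mul_le_mul_of_nonneg_left u2 hρ0
  have : 0 < ε * H.η := mul_pos hε h.η0
  linarith

lemma aux_w8 {w A K : ℝ} (w1 : 1 ≤ w) (w2 : w ≤ 2) (hK : 0 ≤ K) (hA : A ≤ 4 * K) :
    w * A ≤ 8 * K := by nlinarith

lemma aux_w4 {w A K : ℝ} (w1 : 1 ≤ w) (w2 : w ≤ 2) (hK : 0 ≤ K) (hA : A ≤ 2 * K) :
    w * A ≤ 4 * K := by nlinarith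

lemma aux_kq {q K : ℝ} (hK : 0 ≤ K) (hq : 2 ≤ q) : 4 * K ≤ 2 * K * (2 * q) := by nlinarith

set_option maxHeartbeats 2000000 in
lemma Good.site (h : H.Good) {ℓ : ℕ} [NeZero ℓ] (hl2 : 2 ≤ ℓ) (hℓ : 17 * H.Kx * q ≤ H.η * ℓ)
    (s : ℝ) (h0 : 0 ≤ s) (h1 : s + eps q ℓ ≤ H.S) (e : ZMod q) (x : X) :
    siteExpr H.g H.w (H.Phi ℓ s) e x - H.κ e x / 5 * H.Phi ℓ s e 0 x
      ≤ H.Phi ℓ (s + eps q ℓ) e 0 x := by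
  have hL : (0:ℝ) < ℓ := qpos
  have hL2 : (2:ℝ) ≤ ℓ := by exact_mod_cast hl2
  have hq := qpos (q := q)
  have hq2 : (2 : ℝ) ≤ q := by exact_mod_cast h.q2
  have hε : 0 < eps q ℓ := eps_pos (NeZero.pos ℓ)
  have hεm : eps q ℓ * (ℓ : ℝ) ^ 2 = 1 / (4 * q) := eps_mul (NeZero.pos ℓ)
  set ε := eps q ℓ with hεd
  have hs : s ≤ H.S := by linarith
  have z0 : ∀ t e x, H.Phi ℓ t e 0 x = H.Un ℓ t e x := by
    intro t e x; unfold Phi; simp [phi_zero]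
  have o1 : H.Phi ℓ s e 1 x = H.Un ℓ s e x + (H.Un ℓ s e (H.g e x) - H.Un ℓ s e x) / ℓ
      - 2 * ε * H.d s e x * (ℓ - 1) := by
    have : (1 : ZMod ℓ).val = 1 := ZMod.val_one'' (by omega)
    unfold Phi; rw [phi_one hl2, this, ← hεd]; push_cast; field_simp; ring
  have o2 : H.Phi ℓ s e (-1) ((H.g e).symm x) = H.Un ℓ s e x +
      (H.Un ℓ s e ((H.g e).symm x) - H.Un ℓ s e x) / ℓ
      - 2 * ε * H.d s e ((H.g e).symm x) * (ℓ - 1) := by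
    have hv : ((-1 : ZMod ℓ).val : ℝ) = ℓ - 1 := by
      have := val_neg_one' (q := ℓ)
      have : (((-1 : ZMod ℓ).val + 1 : ℕ) : ℝ) = ℓ := by rw [this]
      push_cast at this; linarith
    unfold Phi; rw [phi_neg_one, hv, ← hεd]; simp; field_simp; ring
  unfold siteExpr
  rw [z0, z0, z0, z0, o1, o2]
  set W := 3 + 2 * H.w e with hW
  have w1 := h.w1 e
  have w2 := h.w2 e
  have W5 : 5 ≤ W := by linarith
  have W7 : W ≤ 7 := by linarith
  -- the laplacian of xi
  have lap := green_laplace h.q2 (fun e' => H.f s e' x) e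
  change H.xi s (e+1) x + H.xi s (e-1) x - 2 * H.xi s e x = - H.f s e x + (∑ e', H.f s e' x) / q at lap
  have mn : (∑ e', H.f s e' x) / q ≤ - H.η / q := by
    apply div_le_div_of_nonneg_right (h.mean s x h0 hs) hq.le
  have kx := h.Kx_nonneg
  have kk := h.K_le_Kx
  have x1 := abs_le.1 (h.xi_bound s e x h0 hs)
  have x2 := abs_le.1 (h.xi_bound s e (H.g e x) h0 hs)
  have x3 := abs_le.1 (h.xi_bound s e ((H.g e).symm x) h0 hs)
  have d1 := abs_le.1 (h.db s e x h0 hs)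
  have d2 := abs_le.1 (h.db s e ((H.g e).symm x) h0 hs)
  -- bracket
  set Br := (H.xi s (e+1) x + H.xi s (e-1) x - 2 * H.xi s e x)
     + H.w e * (H.Un ℓ s e (H.g e x) + H.Un ℓ s e ((H.g e).symm x) - 2 * H.Un ℓ s e x)
     - 2 * ε * ℓ * (ℓ - 1) * (H.w e * (H.d s e x + H.d s e ((H.g e).symm x))) with hBr
  have Br_le : Br ≤ - H.η / q + H.C * H.κ e x + 8 * H.Kx / ℓ + 2 * H.Kx / ℓ := by
    have i1 : H.Un ℓ s e (H.g e x) + H.Un ℓ s e ((H.g e).symm x) - 2 * H.Un ℓ s e x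
       = H.U s (H.g e x) + H.U s ((H.g e).symm x) - 2 * H.U s x
        + (H.xi s e (H.g e x) + H.xi s e ((H.g e).symm x) - 2 * H.xi s e x) / ℓ := by
      unfold Un; ring
    have i2 : 2 * ε * ℓ * (ℓ - 1) = (1 / (2 * q)) - 1 / (2 * q * ℓ) := by
      have : 2 * ε * ℓ * (ℓ - 1) = 2 * (ε * (ℓ:ℝ)^2) * (1 - 1/ℓ) := by field_simp
      rw [this, hεm]; field_simp; ring
    have i3 : Br = (∑ e', H.f s e' x) / q + H.C * H.κ e x
       + H.w e * (H.xi s e (H.g e x) + H.xi s e ((H.g e).symm x) - 2 * H.xi s e x) / ℓ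
       + H.w e * (H.d s e x + H.d s e ((H.g e).symm x)) / (2 * q * ℓ) := by
      rw [hBr, i1, i2, lap]; unfold f; field_simp; ring
    rw [i3]
    have i4 : H.w e * (H.xi s e (H.g e x) + H.xi s e ((H.g e).symm x) - 2 * H.xi s e x) / ℓ ≤ 8 * H.Kx / ℓ := by
      apply div_le_div_of_nonneg_right _ hL.le
      exact aux_w8 w1 w2 kx (by linarith)
    have i5 : H.w e * (H.d s e x + H.d s e ((H.g e).symm x)) / (2 * q * ℓ) ≤ 2 * H.Kx / ℓ := by
      rw [div_le_div_iff₀ (by positivity) hL]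
      have : H.w e * (H.d s e x + H.d s e ((H.g e).symm x)) ≤ 4 * H.Kx := aux_w4 w1 w2 kx (by linarith)
      have h44 : 4 * H.Kx ≤ 2 * H.Kx * (2 * q) := aux_kq kx hq2
      have h45 := mul_le_mul_of_nonneg_right (this.trans h44) hL.le
      linarith
    linarith
  -- rewrite the left side
  have lhs : (1/2) * H.Un ℓ s e x + (H.w e * (H.Un ℓ s e x + (H.Un ℓ s e (H.g e x) - H.Un ℓ s e x) / ℓ
      - 2 * ε * H.d s e x * (ℓ - 1)) + H.w e * (H.Un ℓ s e x +
      (H.Un ℓ s e ((H.g e).symm x) - H.Un ℓ s e x) / ℓ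
      - 2 * ε * H.d s e ((H.g e).symm x) * (ℓ - 1)) + H.Un ℓ s (e+1) x + H.Un ℓ s (e-1) x + H.Un ℓ s e x)
      / (2 * W) = H.Un ℓ s e x + Br / (2 * W * ℓ) := by
    have : H.Un ℓ s (e+1) x + H.Un ℓ s (e-1) x = 2 * H.Un ℓ s e x +
       (H.xi s (e+1) x + H.xi s (e-1) x - 2 * H.xi s e x) / ℓ := by unfold Un; field_simp; ring
    have h2 : (H.w e * (H.Un ℓ s e x + (H.Un ℓ s e (H.g e x) - H.Un ℓ s e x) / ℓ
      - 2 * ε * H.d s e x * (ℓ - 1)) + H.w e * (H.Un ℓ s e x +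
      (H.Un ℓ s e ((H.g e).symm x) - H.Un ℓ s e x) / ℓ
      - 2 * ε * H.d s e ((H.g e).symm x) * (ℓ - 1)) + H.Un ℓ s (e+1) x + H.Un ℓ s (e-1) x + H.Un ℓ s e x)
      = W * H.Un ℓ s e x + Br / ℓ := by
      rw [hBr, hW]
      have : H.Un ℓ s (e+1) x = 2 * H.Un ℓ s e x +
       (H.xi s (e+1) x + H.xi s (e-1) x - 2 * H.xi s e x) / ℓ - H.Un ℓ s (e-1) x := by linarith
      rw [this]; field_simp; ring
    rw [h2]; field_simp; ring
  rw [lhs]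
  -- time difference
  have td : -(2 * H.Kx * ε) ≤ H.Un ℓ (s+ε) e x - H.Un ℓ s e x := by
    have a := abs_le.1 (h.UL s (s+ε) x h0 (by linarith) h1)
    have b := abs_le.1 (h.xi_lip s (s+ε) e x h0 (by linarith) h1)
    have : s + ε - s = ε := by ring
    rw [this] at a b
    have b' : -(H.Kx * ε) ≤ (H.xi (s+ε) e x - H.xi s e x) / ℓ := by
      rw [le_div_iff₀ hL]
      have : 0 ≤ H.Kx * ε := by positivity
      have := mul_le_mul_of_nonneg_left (by linarith : (1:ℝ) ≤ ℓ) this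
      linarith
    have : H.Un ℓ (s+ε) e x - H.Un ℓ s e x = H.U (s+ε) x - H.U s x + (H.xi (s+ε) e x - H.xi s e x) / ℓ := by
      unfold Un; ring
    rw [this]
    have := mul_le_mul_of_nonneg_right kk.1 hε.le
    linarith
  have kηℓ : H.Kx ≤ H.η * ℓ / 34 := by
    have := mul_le_mul_of_nonneg_left hq2 kx
    linarith
  have kη2 : 17 * H.Kx / ℓ ≤ H.η / q := by
    rw [div_le_div_iff₀ hL hq]; linarith
  -- kill
  have kill : Br - 2 * W * ℓ * (H.κ e x / 5 * H.Un ℓ s e x) ≤ - H.η / q + 10 * H.Kx / ℓ := by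
    rcases h.κ0 e x with hk | hk
    · rw [hk] at Br_le ⊢
      have : 8 * H.Kx / ℓ + 2 * H.Kx / ℓ = 10 * H.Kx / ℓ := by ring
      linarith
    · have u := h.κU s e x h0 hs hk
      have : H.η / 2 ≤ H.Un ℓ s e x := by
        unfold Un
        have : - (H.η / 2) ≤ H.xi s e x / ℓ := by
          rw [le_div_iff₀ hL]; linarith [mul_pos h.η0 hL]
        linarith
      rw [hk] at Br_le ⊢
      have e1 : 8 * H.Kx / ℓ + 2 * H.Kx / ℓ = 10 * H.Kx / ℓ := by ring
      have e2 : H.η * ℓ ≤ 2 * W * ℓ * (1 / 5 * H.Un ℓ s e x) := by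
        have : H.η ≤ 2 * W * (1/5 * H.Un ℓ s e x) := by
          have := mul_le_mul W5 this (by linarith [h.η0]) (by linarith)
          linarith
        have := mul_le_mul_of_nonneg_right this hL.le
        linarith
      have : H.C ≤ H.η * ℓ := by linarith [mul_pos h.η0 hL]
      linarith
  have fin : (Br - 2 * W * ℓ * (H.κ e x / 5 * H.Un ℓ s e x)) / (2 * W * ℓ) ≤ -(2 * H.Kx * ε) := by
    rw [div_le_iff₀ (by positivity)]
    refine kill.trans ?_
    have : 2 * H.Kx * ε * (2 * W * ℓ) ≤ 7 * H.Kx / ℓ := by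
      have : ε * ℓ = 1 / (4 * q) / ℓ := by rw [← hεm]; field_simp
      have e2 : 2 * H.Kx * ε * (2 * W * ℓ) = 4 * W * H.Kx * (ε * ℓ) := by ring
      rw [e2, this, le_div_iff₀ hL]
      have : 4 * W * H.Kx * (1 / (4 * ↑q) / ↑ℓ) * ↑ℓ = W * H.Kx / q := by field_simp
      rw [this, div_le_iff₀ hq]
      have a1 := mul_le_mul_of_nonneg_right W7 kx
      have a2 := mul_le_mul_of_nonneg_left hq2 kx
      linarith
    have e3 : 17 * H.Kx / ℓ = 10 * H.Kx / ℓ + 7 * H.Kx / ℓ := by ring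
    rw [neg_div]
    linarith
  have split : (Br - 2 * W * ℓ * (H.κ e x / 5 * H.Un ℓ s e x)) / (2 * W * ℓ) =
     Br / (2 * W * ℓ) - H.κ e x / 5 * H.Un ℓ s e x := by field_simp
  rw [split] at fin
  linarith

lemma Good.approx (h : H.Good) {ℓ : ℕ} [NeZero ℓ]
    (s : ℝ) (h0 : 0 ≤ s) (hs : s ≤ H.S) (e : ZMod q) (k : ZMod ℓ) (x : X) :
    |H.Phi ℓ s e k x - ((1 - (k.val : ℝ) / ℓ) * H.U s x + ((k.val : ℝ) / ℓ) * H.U s (H.g e x))|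
      ≤ H.Kx / ℓ + H.K / (8 * q) := by
  have hL : (0:ℝ) < ℓ := qpos
  have hq := qpos (q := q)
  have hε : 0 < eps q ℓ := eps_pos (NeZero.pos ℓ)
  have hεm : eps q ℓ * (ℓ : ℝ) ^ 2 = 1 / (4 * q) := eps_mul (NeZero.pos ℓ)
  have x1 := abs_le.1 (h.xi_bound s e x h0 hs)
  have x2 := abs_le.1 (h.xi_bound s e (H.g e x) h0 hs)
  set ρ := (k.val : ℝ) / ℓ with hρ
  have hρ0 : 0 ≤ ρ := by positivity
  have hρ1 : ρ ≤ 1 := by rw [hρ, div_le_one hL]; exact val_le_real k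
  have e1 : H.Phi ℓ s e k x - ((1 - ρ) * H.U s x + ρ * H.U s (H.g e x)) =
     ((1-ρ) * H.xi s e x + ρ * H.xi s e (H.g e x)) / ℓ - 2 * eps q ℓ * H.d s e x * phi ℓ k := by
    unfold Phi Un; rw [← hρ]; field_simp; ring
  rw [e1]
  have a1 : |((1-ρ) * H.xi s e x + ρ * H.xi s e (H.g e x)) / ℓ| ≤ H.Kx / ℓ := by
    rw [abs_div, abs_of_pos hL]
    apply div_le_div_of_nonneg_right _ hL.le
    rw [abs_le]; constructor <;> nlinarith
  have a2 : |2 * eps q ℓ * H.d s e x * phi ℓ k| ≤ H.K / (8 * q) := by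
    rw [abs_mul, abs_mul, abs_of_pos (by positivity : 0 < 2 * eps q ℓ), abs_of_nonneg (phi_nonneg k)]
    have K1 := h.K1
    have : 2 * eps q ℓ * |H.d s e x| * phi ℓ k ≤ 2 * eps q ℓ * H.K * ((ℓ:ℝ)^2/4) := by
      apply mul_le_mul _ (phi_le k) (phi_nonneg k) (by positivity)
      apply mul_le_mul_of_nonneg_left (h.db s e x h0 hs) (by positivity)
    refine this.trans (le_of_eq ?_)
    have : 2 * eps q ℓ * H.K * ((ℓ:ℝ)^2/4) = (eps q ℓ * (ℓ:ℝ)^2) * H.K / 2 := by ring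
    rw [this, hεm]; field_simp; ring
  exact (abs_sub _ _).trans (add_le_add a1 a2)

end HData
end Homog
end MBS

namespace MBS

section Chain

variable {B : Type} {q ℓ : ℕ}

/-- permutation acting on configurations -/
def act (p : Equiv.Perm B) (σ : B → Bool) : B → Bool := fun x => σ (p.symm x)

/-- flipping one bit -/
noncomputable def flip (b : B) (σ : B → Bool) : B → Bool := Function.update σ b (!σ b)

/-- vertices of the graph -/
abbrev VT (B : Type) (q ℓ : ℕ) := (B → Bool) × ZMod q × ZMod ℓ

noncomputable def plus (g : ZMod q → Equiv.Perm B) (x : VT B q ℓ) : VT B q ℓ :=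
  (if x.2.2 = -1 then act (g x.2.1) x.1 else x.1, x.2.1, x.2.2 + 1)

noncomputable def minus (g : ZMod q → Equiv.Perm B) (x : VT B q ℓ) : VT B q ℓ :=
  (if x.2.2 = 0 then act (g x.2.1).symm x.1 else x.1, x.2.1, x.2.2 - 1)

lemma act_act_symm (p : Equiv.Perm B) (σ : B → Bool) : act p (act p.symm σ) = σ := by
  funext x; simp [act]

lemma act_symm_act (p : Equiv.Perm B) (σ : B → Bool) : act p.symm (act p σ) = σ := by
  funext x; simp [act]

lemma plus_minus (g : ZMod q → Equiv.Perm B) (x : VT B q ℓ) : plus g (minus g x) = x := by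
  obtain ⟨σ, e, k⟩ := x
  by_cases hk : k = 0
  · simp [plus, minus, hk, act_act_symm]
  · simp [plus, minus, hk]

lemma minus_plus (g : ZMod q → Equiv.Perm B) (x : VT B q ℓ) : minus g (plus g x) = x := by
  obtain ⟨σ, e, k⟩ := x
  by_cases hk : k = -1
  · simp [plus, minus, hk, act_symm_act]
  · have : k + 1 ≠ 0 := fun h => hk (eq_neg_of_add_eq_zero_left h)
    simp [plus, minus, hk, this]

lemma flip_flip (b : B) (σ : B → Bool) : flip b (flip b σ) = σ := by
  funext x; by_cases h : x = b
  · subst h; simp [flip]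
  · simp [flip, h]

lemma flip_ne (b : B) (σ : B → Bool) : flip b σ ≠ σ := by
  intro h
  have := congrFun h b
  simp [flip] at this

/-- generating relation of the graph -/
def rel (g : ZMod q → Equiv.Perm B) (b : ZMod q → B) (x y : VT B q ℓ) : Prop :=
  y = plus g x ∨ (x.2.2 = 0 ∧ (y = (x.1, x.2.1 + 1, 0) ∨ y = (flip (b x.2.1) x.1, x.2.1, 0)))

/-- the graph -/
def gr (g : ZMod q → Equiv.Perm B) (b : ZMod q → B) : SimpleGraph (VT B q ℓ) :=
  SimpleGraph.fromRel (rel g b)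

/-- weights -/
noncomputable def wt (w : ZMod q → ℝ) (x y : VT B q ℓ) : ℝ :=
  if (x.2.2 = 0 ∧ y.2.2 = 0) ∨ x.2.1 ≠ y.2.1 then 1 else w x.2.1

lemma wt_symm (w : ZMod q → ℝ) (x y : VT B q ℓ) : wt w x y = wt w y x := by
  unfold wt
  by_cases h : x.2.1 = y.2.1
  · simp [h, and_comm]
  · have : y.2.1 ≠ x.2.1 := fun h' => h h'.symm
    simp [h, this]

lemma wt_one : (wt (fun _ => 1) : VT B q ℓ → VT B q ℓ → ℝ) = fun _ _ => 1 := by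
  funext x y; simp [wt]

variable [Fintype B] [NeZero q] [NeZero ℓ]

noncomputable def nbrs (g : ZMod q → Equiv.Perm B) (b : ZMod q → B) (x : VT B q ℓ) :
    Finset (VT B q ℓ) :=
  if x.2.2 = 0 then {plus g x, minus g x, (x.1, x.2.1 + 1, 0), (x.1, x.2.1 - 1, 0),
    (flip (b x.2.1) x.1, x.2.1, 0)} else {plus g x, minus g x}

lemma one_ne {m : ℕ} (hm : 3 ≤ m) : (1 : ZMod m) ≠ 0 ∧ (-1 : ZMod m) ≠ 0 ∧ (1 : ZMod m) ≠ -1 := by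
  have : Fact (1 < m) := ⟨by omega⟩
  refine ⟨one_ne_zero, neg_ne_zero.2 one_ne_zero, ?_⟩
  have : Fact (2 < m) := ⟨by omega⟩
  exact (ZMod.neg_one_ne_one).symm

lemma plus_fst2 (g : ZMod q → Equiv.Perm B) (x : VT B q ℓ) : (plus g x).2.2 = x.2.2 + 1 := rfl
lemma minus_fst2 (g : ZMod q → Equiv.Perm B) (x : VT B q ℓ) : (minus g x).2.2 = x.2.2 - 1 := rfl
lemma plus_e (g : ZMod q → Equiv.Perm B) (x : VT B q ℓ) : (plus g x).2.1 = x.2.1 := rfl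
lemma minus_e (g : ZMod q → Equiv.Perm B) (x : VT B q ℓ) : (minus g x).2.1 = x.2.1 := rfl

lemma adj_iff (hq : 3 ≤ q) (hl : 3 ≤ ℓ) (g : ZMod q → Equiv.Perm B) (b : ZMod q → B)
    (x y : VT B q ℓ) : (gr g b).Adj x y ↔ y ∈ nbrs g b x := by
  obtain ⟨l1, l2, l3⟩ := one_ne hl
  obtain ⟨q1, q2, q3⟩ := one_ne hq
  have hpm : x = plus g y ↔ y = minus g x := by
    constructor
    · rintro rfl; rw [minus_plus]
    · rintro rfl; rw [plus_minus]
  unfold gr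
  rw [SimpleGraph.fromRel_adj]
  unfold rel
  rw [hpm]
  constructor
  · rintro ⟨hne, h⟩
    unfold nbrs
    rcases h with (h | ⟨h0, h | h⟩) | (h | ⟨h0, h | h⟩)
    · split_ifs <;> simp [h]
    · simp [h0, h]
    · simp [h0, h]
    · split_ifs <;> simp [h]
    · have : x.2.2 = 0 := by rw [h]
      have hy : y = (x.1, x.2.1 - 1, 0) := by
        rw [h]; obtain ⟨σ, e, k⟩ := y; simp at h0; simp [h0]
      simp [this, hy]
    · have : x.2.2 = 0 := by rw [h]
      have hy : y = (flip (b x.2.1) x.1, x.2.1, 0) := by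
        rw [h]; obtain ⟨σ, e, k⟩ := y; simp at h0; simp [h0, flip_flip]
      simp [this, hy]
  · intro h
    unfold nbrs at h
    by_cases h0 : x.2.2 = 0
    · rw [if_pos h0] at h
      simp only [Finset.mem_insert, Finset.mem_singleton] at h
      rcases h with h | h | h | h | h
      · refine ⟨?_, Or.inl (Or.inl h)⟩
        intro hxy; have := congrArg (fun z => z.2.2) (hxy.trans h)
        simp [plus_fst2, l1] at this
      · refine ⟨?_, Or.inr (Or.inl h)⟩
        intro hxy; have := congrArg (fun z => z.2.2) (hxy.trans h)
        simp [minus_fst2] at this; exact l1 (sub_eq_self.1 this.symm)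
      · refine ⟨?_, Or.inl (Or.inr ⟨h0, Or.inl h⟩)⟩
        intro hxy; have := congrArg (fun z => z.2.1) (hxy.trans h)
        simp [q1] at this
      · refine ⟨?_, Or.inr (Or.inr ⟨by rw [h], Or.inl ?_⟩)⟩
        · intro hxy; have := congrArg (fun z => z.2.1) (hxy.trans h)
          simp at this; exact q1 (sub_eq_self.1 this.symm)
        · rw [h]; obtain ⟨σ, e, k⟩ := x; simp at h0; simp [h0]
      · refine ⟨?_, Or.inl (Or.inr ⟨h0, Or.inr h⟩)⟩
        intro hxy; have := congrArg (fun z => z.1) (hxy.trans h)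
        exact flip_ne _ _ this.symm
    · rw [if_neg h0] at h
      simp only [Finset.mem_insert, Finset.mem_singleton] at h
      rcases h with h | h
      · refine ⟨?_, Or.inl (Or.inl h)⟩
        intro hxy; have := congrArg (fun z => z.2.2) (hxy.trans h)
        simp [plus_fst2, l1] at this
      · refine ⟨?_, Or.inr (Or.inl h)⟩
        intro hxy; have := congrArg (fun z => z.2.2) (hxy.trans h)
        simp [minus_fst2] at this; exact l1 (sub_eq_self.1 this.symm)

lemma sum_adj (hq : 3 ≤ q) (hl : 3 ≤ ℓ) (g : ZMod q → Equiv.Perm B) (b : ZMod q → B)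
    (x : VT B q ℓ) (H : VT B q ℓ → ℝ) :
    (∑ z, if (gr g b).Adj x z then H z else 0) =
      if x.2.2 = 0 then H (plus g x) + H (minus g x) + H (x.1, x.2.1 + 1, 0) +
        H (x.1, x.2.1 - 1, 0) + H (flip (b x.2.1) x.1, x.2.1, 0)
      else H (plus g x) + H (minus g x) := by
  obtain ⟨l1, l2, l3⟩ := one_ne hl
  obtain ⟨q1, q2, q3⟩ := one_ne hq
  have : (∑ z, if (gr g b).Adj x z then H z else 0) = ∑ z ∈ nbrs g b x, H z := by
    rw [← Finset.sum_filter]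
    apply Finset.sum_congr _ (fun _ _ => rfl)
    ext z; simp [adj_iff hq hl]
  rw [this]
  have hpm : plus g x ≠ minus g x := by
    intro h; have := congrArg (fun z => z.2.2) h
    simp only [plus_fst2, minus_fst2] at this
    apply l3
    have : x.2.2 + 1 - x.2.2 = x.2.2 - 1 - x.2.2 := by rw [this]
    simpa using this
  unfold nbrs
  by_cases h0 : x.2.2 = 0
  · rw [if_pos h0, if_pos h0]
    have p0 : (plus g x).2.2 ≠ 0 := by rw [plus_fst2, h0]; simpa using l1
    have m0 : (minus g x).2.2 ≠ 0 := by rw [minus_fst2, h0]; simpa using l2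
    rw [Finset.sum_insert, Finset.sum_insert, Finset.sum_insert, Finset.sum_insert,
      Finset.sum_singleton]
    · ring
    · simp only [Finset.mem_singleton, Prod.mk.injEq]
      rintro ⟨h, -⟩
      exact flip_ne _ _ h.symm
    · simp only [Finset.mem_singleton, Finset.mem_insert, Prod.mk.injEq]
      rintro (⟨-, h, -⟩ | ⟨h, -⟩)
      · apply q3
        have : x.2.1 + 1 - x.2.1 = x.2.1 - 1 - x.2.1 := by rw [h]
        simpa using this
      · exact flip_ne _ _ h.symm
    · simp only [Finset.mem_singleton, Finset.mem_insert]
      rintro (h | h | h) <;> · apply m0; rw [h]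
    · simp only [Finset.mem_singleton, Finset.mem_insert]
      rintro (h | h | h | h)
      · exact hpm h
      all_goals · apply p0; rw [h]
  · rw [if_neg h0, if_neg h0, Finset.sum_pair hpm]

lemma deg_le (hq : 3 ≤ q) (hl : 3 ≤ ℓ) (g : ZMod q → Equiv.Perm B) (b : ZMod q → B)
    (x : VT B q ℓ) : (∑ z, if (gr g b).Adj x z then (1:ℝ) else 0) ≤ 5 := by
  rw [sum_adj hq hl g b x (fun _ => 1)]
  split_ifs <;> norm_num

/-- total weight at a vertex -/
noncomputable def vW (w : ZMod q → ℝ) (x : VT B q ℓ) : ℝ :=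
  if x.2.2 = 0 then 3 + 2 * w x.2.1 else 2 * w x.2.1

lemma sum_wt (hq : 3 ≤ q) (hl : 3 ≤ ℓ) (g : ZMod q → Equiv.Perm B) (b : ZMod q → B)
    (w : ZMod q → ℝ) (x : VT B q ℓ) (H : VT B q ℓ → ℝ) :
    (∑ z, if (gr g b).Adj x z then wt w x z * H z else 0) =
      if x.2.2 = 0 then w x.2.1 * H (plus g x) + w x.2.1 * H (minus g x) + H (x.1, x.2.1 + 1, 0) +
        H (x.1, x.2.1 - 1, 0) + H (flip (b x.2.1) x.1, x.2.1, 0)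
      else w x.2.1 * H (plus g x) + w x.2.1 * H (minus g x) := by
  obtain ⟨l1, l2, l3⟩ := one_ne hl
  obtain ⟨q1, q2, q3⟩ := one_ne hq
  rw [sum_adj hq hl g b x (fun z => wt w x z * H z)]
  by_cases h0 : x.2.2 = 0
  · have p0 : (plus g x).2.2 ≠ 0 := by rw [plus_fst2, h0]; simpa using l1
    have m0 : (minus g x).2.2 ≠ 0 := by rw [minus_fst2, h0]; simpa using l2
    simp [h0, wt, p0, m0, plus_e, minus_e]
  · simp [h0, wt, plus_e, minus_e]

lemma sum_vW (hq : 3 ≤ q) (hl : 3 ≤ ℓ) (g : ZMod q → Equiv.Perm B) (b : ZMod q → B)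
    (w : ZMod q → ℝ) (x : VT B q ℓ) :
    (∑ z, if (gr g b).Adj x z then wt w x z else 0) = vW w x := by
  have := sum_wt hq hl g b w x (fun _ => 1)
  simp only [mul_one] at this
  rw [this]; unfold vW; split_ifs <;> ring

/-- the transition operator -/
noncomputable def T (g : ZMod q → Equiv.Perm B) (b : ZMod q → B) (w : ZMod q → ℝ)
    (F : VT B q ℓ → ℝ) (x : VT B q ℓ) : ℝ :=
  if x.2.2 = 0 then (1/2) * F x + (w x.2.1 * F (plus g x) + w x.2.1 * F (minus g x)
      + F (x.1, x.2.1 + 1, 0) + F (x.1, x.2.1 - 1, 0) + F (flip (b x.2.1) x.1, x.2.1, 0))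
      / (2 * (3 + 2 * w x.2.1))
  else (1/2) * F x + (1/4) * (F (minus g x) + F (plus g x))

lemma mulVec_eq (hq : 3 ≤ q) (hl : 3 ≤ ℓ) (g : ZMod q → Equiv.Perm B) (b : ZMod q → B)
    (w : ZMod q → ℝ) (hw : ∀ e, 1 ≤ w e) (F : VT B q ℓ → ℝ) :
    (lazyGraphP (gr g b) (wt w)).mulVec F = T g b w F := by
  funext x
  have h1 : ∀ y, lazyGraphP (gr g b) (wt w) x y * F y = (if y = x then (1/2) * F x else 0)
      + (if (gr g b).Adj x y then wt w x y * F y else 0) / (2 * vW w x) := by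
    intro y
    unfold lazyGraphP
    rw [sum_vW hq hl]
    by_cases hy : y = x
    · subst hy; simp
    · simp only [hy, if_false]
      split_ifs
      · ring
      · ring
  change ∑ y, lazyGraphP (gr g b) (wt w) x y * F y = _
  rw [Finset.sum_congr rfl (fun y _ => h1 y), Finset.sum_add_distrib, ← Finset.sum_div,
    sum_wt hq hl]
  have := hw x.2.1
  unfold T vW
  simp only [Finset.sum_ite_eq', Finset.mem_univ, if_true]
  split_ifs
  · rfl
  · field_simp; ring

end Chain
end MBS

namespace MBS

section Phase2

variable {B : Type} {q ℓ : ℕ} [Fintype B] [NeZero q] [NeZero ℓ]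

/-- weighted discrepancy -/
noncomputable def Dsum (ψ : B → ℝ) (σ σ' : B → Bool) : ℝ := ∑ x, if σ x ≠ σ' x then ψ x else 0

lemma Dsum_act (p : Equiv.Perm B) (ψ : B → ℝ) (σ σ' : B → Bool) :
    Dsum ψ (act p σ) (act p σ') = Dsum (fun x => ψ (p x)) σ σ' := by
  unfold Dsum act
  rw [← Equiv.sum_comp p]
  simp

lemma Dsum_mono {ψ ψ' : B → ℝ} (h : ∀ x, ψ x ≤ ψ' x) (σ σ' : B → Bool) :
    Dsum ψ σ σ' ≤ Dsum ψ' σ σ' := by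
  unfold Dsum
  apply Finset.sum_le_sum
  intro x _
  split_ifs
  · exact h x
  · exact le_rfl

lemma Dsum_add (ψ ψ' : B → ℝ) (σ σ' : B → Bool) :
    Dsum (fun x => ψ x + ψ' x) σ σ' = Dsum ψ σ σ' + Dsum ψ' σ σ' := by
  unfold Dsum
  rw [← Finset.sum_add_distrib]
  apply Finset.sum_congr rfl
  intro x _
  split_ifs <;> simp

lemma Dsum_smul (c : ℝ) (ψ : B → ℝ) (σ σ' : B → Bool) :
    Dsum (fun x => c * ψ x) σ σ' = c * Dsum ψ σ σ' := by
  unfold Dsum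
  rw [Finset.mul_sum]
  apply Finset.sum_congr rfl
  intro x _
  split_ifs <;> simp

lemma Dsum_flip_both (b : B) (ψ : B → ℝ) (σ σ' : B → Bool) (h : σ b = σ' b) :
    Dsum ψ (flip b σ) (flip b σ') = Dsum ψ σ σ' := by
  unfold Dsum
  apply Finset.sum_congr rfl
  intro x _
  by_cases hx : x = b
  · subst hx; simp [flip, h]
  · simp [flip, hx]

lemma Dsum_flip_right (b : B) (ψ : B → ℝ) (σ σ' : B → Bool) (h : σ b ≠ σ' b) :
    Dsum ψ σ (flip b σ') = Dsum ψ σ σ' - ψ b := by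
  have : Dsum ψ σ σ' - ψ b = ∑ x, ((if σ x ≠ σ' x then ψ x else 0) - if x = b then ψ x else 0) := by
    rw [Finset.sum_sub_distrib]; simp [Dsum]
  rw [this]
  unfold Dsum
  apply Finset.sum_congr rfl
  intro x _
  by_cases hx : x = b
  · subst hx
    have : σ x = !σ' x := by
      revert h; cases σ x <;> cases σ' x <;> simp
    simp [flip, this]
  · simp [flip, hx]

lemma Dsum_flip_left (b : B) (ψ : B → ℝ) (σ σ' : B → Bool) (h : σ b ≠ σ' b) :
    Dsum ψ (flip b σ) σ' = Dsum ψ σ σ' - ψ b := by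
  have h1 : ∀ σ σ' : B → Bool, Dsum ψ σ σ' = Dsum ψ σ' σ := by
    intro σ σ'; unfold Dsum; apply Finset.sum_congr rfl; intro x _; simp [ne_comm]
  rw [h1, Dsum_flip_right b ψ σ' σ (Ne.symm h), h1]

lemma Dsum_kill (b : B) (ψ : B → ℝ) (σ σ' : B → Bool) :
    Dsum (fun x => if b = x then ψ x else 0) σ σ' = if σ b ≠ σ' b then ψ b else 0 := by
  unfold Dsum
  rw [Finset.sum_eq_single b]
  · simp
  · intro x _ hx; simp [Ne.symm hx]
  · simp

lemma plus_zero (hl : 3 ≤ ℓ) (g : ZMod q → Equiv.Perm B) (σ : B → Bool) (e : ZMod q) :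
    plus g ((σ, e, 0) : VT B q ℓ) = (σ, e, 1) := by
  obtain ⟨l1, l2, l3⟩ := one_ne hl
  simp [plus, l2.symm]

lemma minus_zero (g : ZMod q → Equiv.Perm B) (σ : B → Bool) (e : ZMod q) :
    minus g ((σ, e, 0) : VT B q ℓ) = (act (g e).symm σ, e, -1) := by
  simp [minus]

lemma minus_pos (g : ZMod q → Equiv.Perm B) (σ : B → Bool) (e : ZMod q) {k : ZMod ℓ} (hk : k ≠ 0) :
    minus g ((σ, e, k) : VT B q ℓ) = (σ, e, k - 1) := by
  simp [minus, hk]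

lemma plus_if (g : ZMod q → Equiv.Perm B) (σ : B → Bool) (e : ZMod q) (k : ZMod ℓ) :
    plus g ((σ, e, k) : VT B q ℓ) = (if k = -1 then act (g e) σ else σ, e, k + 1) := rfl

lemma T_zero (hl : 3 ≤ ℓ) (g : ZMod q → Equiv.Perm B) (b : ZMod q → B) (w : ZMod q → ℝ)
    (F : VT B q ℓ → ℝ) (σ : B → Bool) (e : ZMod q) :
    T g b w F (σ, e, 0) = (1/2) * F (σ, e, 0) + (w e * F (σ, e, 1) +
      w e * F (act (g e).symm σ, e, -1) + F (σ, e + 1, 0) + F (σ, e - 1, 0)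
      + F (flip (b e) σ, e, 0)) / (2 * (3 + 2 * w e)) := by
  unfold T
  rw [if_pos rfl, plus_zero hl, minus_zero]

lemma T_pos (g : ZMod q → Equiv.Perm B) (b : ZMod q → B) (w : ZMod q → ℝ)
    (F : VT B q ℓ → ℝ) (σ : B → Bool) (e : ZMod q) {k : ZMod ℓ} (hk : k ≠ 0) :
    T g b w F (σ, e, k) = (1/2) * F (σ, e, k) + (1/4) * (F (σ, e, k - 1) +
      F (if k = -1 then act (g e) σ else σ, e, k + 1)) := by
  unfold T
  rw [if_neg (by simpa using hk), minus_pos g σ e hk, plus_if]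

lemma phase2_step (hl : 3 ≤ ℓ) (g : ZMod q → Equiv.Perm B) (b : ZMod q → B)
    (Ψ Ψ' : ZMod q → ZMod ℓ → B → ℝ) (hicond : IntCond g Ψ Ψ')
    (hsite : ∀ e x, siteExpr g (fun _ => 1) Ψ e x - (if b e = x then (1:ℝ) else 0) / 5 * Ψ e 0 x
      ≤ Ψ' e 0 x)
    (F : VT B q ℓ → ℝ) (hF : ∀ σ σ' e k, F (σ, e, k) - F (σ', e, k) ≤ Dsum (Ψ e k) σ σ')
    (σ σ' : B → Bool) (e : ZMod q) (k : ZMod ℓ) :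
    T g b (fun _ => 1) F (σ, e, k) - T g b (fun _ => 1) F (σ', e, k) ≤ Dsum (Ψ' e k) σ σ' := by
  by_cases hk : k = 0
  · subst hk
    have key := Dsum_mono (hsite e) σ σ'
    have expand : Dsum (fun x => siteExpr g (fun _ => 1) Ψ e x -
        (if b e = x then (1:ℝ) else 0) / 5 * Ψ e 0 x) σ σ'
        = (6/10) * Dsum (Ψ e 0) σ σ' + (1/10) * Dsum (Ψ e 1) σ σ' +
          (1/10) * Dsum (fun x => Ψ e (-1) ((g e).symm x)) σ σ' + (1/10) * Dsum (Ψ (e+1) 0) σ σ'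
          + (1/10) * Dsum (Ψ (e-1) 0) σ σ' + (-1/5) * (if σ (b e) ≠ σ' (b e) then Ψ e 0 (b e) else 0) := by
      rw [← Dsum_kill]
      simp only [← Dsum_smul, ← Dsum_add]
      unfold Dsum siteExpr
      apply Finset.sum_congr rfl
      intro x _
      by_cases hb : b e = x
      · simp only [hb, if_true]; split_ifs <;> ring
      · simp only [hb, if_false]; split_ifs <;> ring
    rw [expand] at key
    refine le_trans ?_ key
    rw [T_zero hl, T_zero hl]
    have a1 := hF σ σ' e 1
    have a2 := hF (act (g e).symm σ) (act (g e).symm σ') e (-1)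
    rw [Dsum_act] at a2
    have a3 := hF σ σ' (e+1) 0
    have a4 := hF σ σ' (e-1) 0
    have a0 := hF σ σ' e 0
    by_cases hb : σ (b e) = σ' (b e)
    · have a5 := hF (flip (b e) σ) (flip (b e) σ') e 0
      rw [Dsum_flip_both _ _ _ _ hb] at a5
      rw [if_neg (by simpa using hb)]
      linarith
    · have a5 := hF (flip (b e) σ) σ' e 0
      have a6 := hF σ (flip (b e) σ') e 0
      rw [Dsum_flip_left _ _ _ _ hb] at a5
      rw [Dsum_flip_right _ _ _ _ hb] at a6
      rw [if_pos hb]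
      linarith
  · rw [T_pos g b _ F σ e hk, T_pos g b _ F σ' e hk]
    have key := Dsum_mono (fun x => hicond e k x hk) σ σ'
    rw [Dsum_add, Dsum_smul, Dsum_smul, Dsum_add] at key
    have a0 := hF σ σ' e k
    have a1 := hF σ σ' e (k-1)
    have a2 : F (if k = -1 then act (g e) σ else σ, e, k + 1) -
        F (if k = -1 then act (g e) σ' else σ', e, k + 1) ≤
        Dsum (fun x => Ψ e (k+1) (if k = -1 then g e x else x)) σ σ' := by
      by_cases h1 : k = -1
      · simp only [h1, if_true]
        have := hF (act (g e) σ) (act (g e) σ') e (-1 + 1)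
        rwa [Dsum_act] at this
      · simp only [h1, if_false]
        exact hF σ σ' e (k+1)
    have e1 : Dsum (fun x => Ψ e (k-1) x) σ σ' = Dsum (Ψ e (k-1)) σ σ' := rfl
    have e2 : Dsum (fun x => Ψ e k x) σ σ' = Dsum (Ψ e k) σ σ' := rfl
    have e3 : Dsum (fun x => Ψ' e k x) σ σ' = Dsum (Ψ' e k) σ σ' := rfl
    rw [e1, e2, e3] at key
    linarith

lemma phase2 (hl : 3 ≤ ℓ) (g : ZMod q → Equiv.Perm B) (b : ZMod q → B) (N : ℕ)
    (Ψ : ℕ → ZMod q → ZMod ℓ → B → ℝ) (hicond : ∀ n < N, IntCond g (Ψ n) (Ψ (n+1)))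
    (hsite : ∀ n < N, ∀ e x, siteExpr g (fun _ => 1) (Ψ n) e x -
      (if b e = x then (1:ℝ) else 0) / 5 * Ψ n e 0 x ≤ Ψ (n+1) e 0 x)
    (h0 : ∀ e k x, 1 ≤ Ψ 0 e k x)
    (F : VT B q ℓ → ℝ) (hF0 : ∀ x, 0 ≤ F x) (hF1 : ∀ x, F x ≤ 1) :
    ∀ n ≤ N, ∀ σ σ' e k, (T g b (fun _ => 1))^[n] F (σ, e, k) -
      (T g b (fun _ => 1))^[n] F (σ', e, k) ≤ Dsum (Ψ n e k) σ σ' := by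
  intro n
  induction n with
  | zero =>
    intro _ σ σ' e k
    simp only [Function.iterate_zero, id]
    have nn : ∀ x ∈ (univ : Finset B), 0 ≤ (if σ x ≠ σ' x then Ψ 0 e k x else 0) := by
      intro x _; split_ifs
      · linarith [h0 e k x]
      · exact le_rfl
    by_cases h : σ = σ'
    · subst h; simp [Dsum]
    · obtain ⟨x, hx⟩ := Function.ne_iff.1 h
      have := Finset.single_le_sum nn (Finset.mem_univ x)
      rw [if_pos hx] at this
      have := h0 e k x
      have := hF0 (σ', e, k)
      have := hF1 (σ, e, k)
      unfold Dsum
      linarith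
  | succ n ih =>
    intro hn σ σ' e k
    rw [Function.iterate_succ_apply']
    exact phase2_step hl g b (Ψ n) (Ψ (n+1)) (hicond n (by omega)) (hsite n (by omega)) _
      (ih (by omega)) σ σ' e k

end Phase2

section Phase1

variable {B : Type} {q ℓ : ℕ} [Fintype B] [NeZero q] [NeZero ℓ]

/-- crude bound on second stage -/
noncomputable def MM (q ℓ : ℕ) : ℝ := (ℓ + 2) * q ^ 2 + ℓ ^ 2

noncomputable def QQ (q ℓ : ℕ) : ℝ := ℓ ^ 2 + MM q ℓ

/-- Lyapunov function of the coupling -/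
noncomputable def HH (e e' : ZMod q) (k k' : ZMod ℓ) : ℝ :=
  if k = k' then (if e = e' then 0 else 1 + ((ℓ + 2) * phi q (e - e') + phi ℓ k) / QQ q ℓ)
  else 1 + (phi ℓ (k - k') + MM q ℓ) / QQ q ℓ

lemma QQ_pos : 0 < QQ q ℓ := by
  have h1 := HData.qpos (q := q)
  have h2 := HData.qpos (q := ℓ)
  unfold QQ MM; positivity

lemma HH_leA (e e' : ZMod q) (k k' : ZMod ℓ) :
    HH e e' k k' ≤ 1 + (phi ℓ (k - k') + MM q ℓ) / QQ q ℓ := by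
  have hQ := QQ_pos (q := q) (ℓ := ℓ)
  have h1 := HData.qpos (q := q)
  have h2 := HData.qpos (q := ℓ)
  have hM : 0 ≤ MM q ℓ := by unfold MM; positivity
  unfold HH
  split_ifs with hk he
  · have := phi_nonneg (k - k'); positivity
  · have e0 : phi ℓ (k - k') = 0 := by rw [hk]; simp [phi_zero]
    rw [e0]
    have a := phi_le (e - e')
    have b := phi_le k
    have : (ℓ + 2) * phi q (e - e') + phi ℓ k ≤ 0 + MM q ℓ := by
      unfold MM
      have : ((ℓ:ℝ) + 2) * phi q (e - e') ≤ (ℓ+2) * q^2 := by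
        apply mul_le_mul_of_nonneg_left _ (by positivity)
        nlinarith
      nlinarith
    have := div_le_div_of_nonneg_right this hQ.le
    linarith
  · exact le_rfl

lemma HH_leB (e e' : ZMod q) (k : ZMod ℓ) :
    HH e e' k k ≤ 1 + ((ℓ + 2) * phi q (e - e') + phi ℓ k) / QQ q ℓ := by
  have hQ := QQ_pos (q := q) (ℓ := ℓ)
  have a := phi_nonneg (e - e')
  have b := phi_nonneg k
  unfold HH
  rw [if_pos rfl]
  split_ifs
  · positivity
  · exact le_rfl

lemma HH_le_two (e e' : ZMod q) (k k' : ZMod ℓ) : HH e e' k k' ≤ 2 := by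
  have hQ := QQ_pos (q := q) (ℓ := ℓ)
  refine (HH_leA e e' k k').trans ?_
  have : (phi ℓ (k - k') + MM q ℓ) / QQ q ℓ ≤ 1 := by
    rw [div_le_one hQ]
    have := phi_le (k - k')
    unfold QQ; nlinarith
  linarith

lemma HH_ge_one (e e' : ZMod q) (k k' : ZMod ℓ) (h : ¬ (k = k' ∧ e = e')) : 1 ≤ HH e e' k k' := by
  have hQ := QQ_pos (q := q) (ℓ := ℓ)
  have h1 := HData.qpos (q := q)
  have h2 := HData.qpos (q := ℓ)
  have hM : 0 ≤ MM q ℓ := by unfold MM; positivity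
  have a := phi_nonneg (e - e')
  have b := phi_nonneg k
  have c := phi_nonneg (k - k')
  unfold HH
  split_ifs with hk he
  · exact absurd ⟨hk, he⟩ h
  · have : 0 ≤ ((ℓ + 2) * phi q (e - e') + phi ℓ k) / QQ q ℓ := by positivity
    linarith
  · have : 0 ≤ (phi ℓ (k - k') + MM q ℓ) / QQ q ℓ := by positivity
    linarith

lemma HH_nonneg (e e' : ZMod q) (k k' : ZMod ℓ) : 0 ≤ HH e e' k k' := by
  by_cases h : k = k' ∧ e = e'
  · simp [HH, h]
  · linarith [HH_ge_one e e' k k' h]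

/-- non-lazy step -/
noncomputable def A1 (g : ZMod q → Equiv.Perm B) (b : ZMod q → B)
    (F : VT B q ℓ → ℝ) (x : VT B q ℓ) : ℝ :=
  if x.2.2 = 0 then (F (plus g x) + F (minus g x)
      + F (x.1, x.2.1 + 1, 0) + F (x.1, x.2.1 - 1, 0) + F (flip (b x.2.1) x.1, x.2.1, 0)) / 5
  else (F (minus g x) + F (plus g x)) / 2

lemma T_A1 (g : ZMod q → Equiv.Perm B) (b : ZMod q → B) (F : VT B q ℓ → ℝ) (x : VT B q ℓ) :
    T g b (fun _ => 1) F x = (F x + A1 g b F x) / 2 := by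
  unfold T A1; split_ifs <;> ring

/-- decrease of the gap function -/
lemma A1_bound (g : ZMod q → Equiv.Perm B) (b : ZMod q → B) (F : VT B q ℓ → ℝ) (x : VT B q ℓ)
    (c a : ℝ) (ha : 0 ≤ a) (k' : ZMod ℓ) (hk : x.2.2 ≠ k')
    (hF : ∀ y : VT B q ℓ, F y ≤ c + a * phi ℓ (y.2.2 - k')) :
    A1 g b F x ≤ c + a * (phi ℓ (x.2.2 - k') - 2/5) := by
  have e1 : (plus g x).2.2 - k' = x.2.2 - k' + 1 := by rw [plus_fst2]; ring
  have e2 : (minus g x).2.2 - k' = x.2.2 - k' - 1 := by rw [minus_fst2]; ring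
  have p := phi_second_ne (sub_ne_zero.2 hk)
  have f1 := hF (plus g x)
  have f2 := hF (minus g x)
  rw [e1] at f1
  rw [e2] at f2
  have p' : a * phi ℓ (x.2.2 - k' + 1) + a * phi ℓ (x.2.2 - k' - 1)
      = 2 * (a * phi ℓ (x.2.2 - k')) - 2 * a := by
    rw [← mul_add, p]; ring
  unfold A1
  split_ifs with h0
  · have f3 := hF (x.1, x.2.1 + 1, 0)
    have f4 := hF (x.1, x.2.1 - 1, 0)
    have f5 := hF (flip (b x.2.1) x.1, x.2.1, 0)
    have h0' : phi ℓ (0 - k') = phi ℓ (x.2.2 - k') := by rw [h0]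
    simp only [h0'] at f3 f4 f5
    linarith
  · linarith

lemma A1_bound' (g : ZMod q → Equiv.Perm B) (b : ZMod q → B) (F : VT B q ℓ → ℝ) (x : VT B q ℓ)
    (c a : ℝ) (ha : 0 ≤ a) (k' : ZMod ℓ) (hk : x.2.2 ≠ k')
    (hF : ∀ y : VT B q ℓ, c - a * phi ℓ (y.2.2 - k') ≤ F y) :
    c - a * (phi ℓ (x.2.2 - k') - 2/5) ≤ A1 g b F x := by
  have := A1_bound g b (fun y => - F y) x (-c) a ha k' hk (fun y => by linarith [hF y])
  have e : A1 g b (fun y => - F y) x = - A1 g b F x := by unfold A1; split_ifs <;> ring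
  rw [e] at this
  linarith

lemma phi_neg {m : ℕ} [NeZero m] (j : ZMod m) : phi m (-j) = phi m j := by
  by_cases h : j = 0
  · subst h; simp
  · have : ((-j).val : ℝ) = m - j.val := by
      have := NeZero.mk h
      rw [ZMod.val_neg_of_ne_zero, Nat.cast_sub (ZMod.val_lt j).le]
    unfold phi; rw [this]; ring

/-- contraction factor -/
noncomputable def cf (q ℓ : ℕ) : ℝ := 1 - 1 / (5 * QQ q ℓ)

lemma QQ_ge : 1 ≤ QQ q ℓ := by
  have h2 : (1:ℝ) ≤ ℓ := by exact_mod_cast NeZero.pos ℓ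
  unfold QQ MM
  have : 0 ≤ ((ℓ:ℝ) + 2) * q ^ 2 := by positivity
  nlinarith

lemma cf_nonneg : 0 ≤ cf q ℓ := by
  have := QQ_ge (q := q) (ℓ := ℓ)
  unfold cf
  have : 1 / (5 * QQ q ℓ) ≤ 1 := by
    rw [div_le_one (by linarith)]; linarith
  linarith

lemma cf_mul (e e' : ZMod q) (k k' : ZMod ℓ) :
    HH e e' k k' - (2/5) / QQ q ℓ ≤ cf q ℓ * HH e e' k k' := by
  have hQ := QQ_pos (q := q) (ℓ := ℓ)
  have h := HH_le_two e e' k k'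
  unfold cf
  have : 1 / (5 * QQ q ℓ) * HH e e' k k' ≤ 1 / (5 * QQ q ℓ) * 2 :=
    mul_le_mul_of_nonneg_left h (by positivity)
  have e : 1 / (5 * QQ q ℓ) * 2 = (2/5) / QQ q ℓ := by field_simp
  linarith

lemma phase1_step (hl : 3 ≤ ℓ) (hq : 3 ≤ q) (g : ZMod q → Equiv.Perm B) (b : ZMod q → B)
    (F : VT B q ℓ → ℝ) (ρ c : ℝ) (hc : 0 ≤ c)
    (hF : ∀ σ σ' e e' k k', F (σ, e, k) - F (σ', e', k') ≤ ρ + c * HH e e' k k')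
    (σ σ' : B → Bool) (e e' : ZMod q) (k k' : ZMod ℓ) :
    T g b (fun _ => 1) F (σ, e, k) - T g b (fun _ => 1) F (σ', e', k') ≤
      ρ + c * cf q ℓ * HH e e' k k' := by
  have hQ := QQ_pos (q := q) (ℓ := ℓ)
  by_cases hk : k = k'
  · subst hk
    by_cases he : e = e'
    · subst he
      have hF' : ∀ σ σ' e k, F (σ, e, k) - F (σ', e, k) ≤ ρ := by
        intro σ σ' e k
        have := hF σ σ' e e k k
        simpa [HH] using this
      have : HH e e k k = 0 := by simp [HH]
      rw [this]
      by_cases h0 : k = 0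
      · subst h0
        rw [T_zero hl, T_zero hl]
        linarith [hF' σ σ' e 0, hF' σ σ' e 1, hF' (act (g e).symm σ) (act (g e).symm σ') e (-1),
          hF' σ σ' (e+1) 0, hF' σ σ' (e-1) 0, hF' (flip (b e) σ) (flip (b e) σ') e 0]
      · rw [T_pos g b _ F σ e h0, T_pos g b _ F σ' e h0]
        linarith [hF' σ σ' e k, hF' σ σ' e (k-1), hF' (if k = -1 then act (g e) σ else σ)
          (if k = -1 then act (g e) σ' else σ') e (k+1)]
    · -- stage B
      set a := c / QQ q ℓ with ha
      have a0 : 0 ≤ a := by positivity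
      have hF' : ∀ σ σ' e e' k, F (σ, e, k) - F (σ', e', k) ≤
          ρ + c + a * (ℓ + 2) * phi q (e - e') + a * phi ℓ k := by
        intro σ σ' e e' k
        refine (hF σ σ' e e' k k).trans ?_
        have := mul_le_mul_of_nonneg_left (HH_leB e e' k) hc
        refine (add_le_add_right this _).trans (le_of_eq ?_)
        rw [ha]; field_simp; ring
      have hH : HH e e' k k = 1 + ((ℓ + 2) * phi q (e - e') + phi ℓ k) / QQ q ℓ := by
        simp [HH, he]
      have tgt : ρ + c + a * (ℓ + 2) * phi q (e - e') + a * phi ℓ k - (2/5) * a ≤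
          ρ + c * cf q ℓ * HH e e' k k := by
        have := mul_le_mul_of_nonneg_left (cf_mul e e' k k) hc
        have this2 := add_le_add_right this ρ
        rw [← mul_assoc] at this2
        refine le_trans (le_of_eq ?_) this2
        rw [hH, ha]; field_simp; ring
      refine le_trans ?_ tgt
      by_cases h0 : k = 0
      · subst h0
        rw [T_zero hl, T_zero hl]
        have i0 := hF' σ σ' e e' 0
        have i1 := hF' σ σ' e e' 1
        have i2 := hF' (act (g e).symm σ) (act (g e').symm σ') e e' (-1)
        have i3 := hF' σ σ' (e+1) e' 0
        have i4 := hF' σ σ' (e-1) e' 0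
        have i5 := hF' σ σ' e (e'+1) 0
        have i6 := hF' σ σ' e (e'-1) 0
        have i7 := hF' (flip (b e) σ) (flip (b e') σ') e e' 0
        rw [phi_zero] at *
        rw [phi_one (by omega)] at i1
        rw [phi_neg_one] at i2
        have p := phi_second_ne (sub_ne_zero.2 he)
        have q1 : e + 1 - e' = e - e' + 1 := by ring
        have q2 : e - 1 - e' = e - e' - 1 := by ring
        have q3 : e - (e' + 1) = e - e' - 1 := by ring
        have q4 : e - (e' - 1) = e - e' + 1 := by ring
        rw [q1] at i3
        rw [q2] at i4
        rw [q3] at i5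
        rw [q4] at i6
        set A := a * (ℓ + 2) with hA
        have p' : A * phi q (e - e' + 1) + A * phi q (e - e' - 1)
            = 2 * (A * phi q (e - e')) - 2 * A := by
          rw [← mul_add, p]; ring
        have hA2 : A = a * ℓ + 2 * a := by rw [hA]; ring
        have hal : 0 ≤ a * ℓ := by positivity
        linarith
      · rw [T_pos g b _ F σ e h0, T_pos g b _ F σ' e' h0]
        have i0 := hF' σ σ' e e' k
        have i1 := hF' σ σ' e e' (k-1)
        have i2 := hF' (if k = -1 then act (g e) σ else σ)
          (if k = -1 then act (g e') σ' else σ') e e' (k+1)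
        have p := phi_second_ne h0
        have p' : a * phi ℓ (k + 1) + a * phi ℓ (k - 1) = 2 * (a * phi ℓ k) - 2 * a := by
          rw [← mul_add, p]; ring
        linarith
  · -- stage A
    set a := c / QQ q ℓ with ha
    have a0 : 0 ≤ a := by positivity
    have hF' : ∀ x y : VT B q ℓ, F x - F y ≤ ρ + c + a * MM q ℓ + a * phi ℓ (x.2.2 - y.2.2) := by
      intro x y
      refine (hF x.1 y.1 x.2.1 y.2.1 x.2.2 y.2.2).trans ?_
      have := mul_le_mul_of_nonneg_left (HH_leA x.2.1 y.2.1 x.2.2 y.2.2) hc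
      refine (add_le_add_right this _).trans (le_of_eq ?_)
      rw [ha]; field_simp; ring
    have hH : HH e e' k k' = 1 + (phi ℓ (k - k') + MM q ℓ) / QQ q ℓ := by
      simp [HH, hk]
    have tgt : ρ + c + a * MM q ℓ + a * phi ℓ (k - k') - (2/5) * a ≤
        ρ + c * cf q ℓ * HH e e' k k' := by
      have := mul_le_mul_of_nonneg_left (cf_mul e e' k k') hc
      have this2 := add_le_add_right this ρ
      rw [← mul_assoc] at this2
      refine le_trans (le_of_eq ?_) this2
      rw [hH, ha]; field_simp; ring
    refine le_trans ?_ tgt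
    rw [T_A1, T_A1]
    have b1 := A1_bound g b F (σ, e, k) (F (σ', e', k') + (ρ + c + a * MM q ℓ)) a a0 k' hk (by
      intro y; have := hF' y (σ', e', k'); simp only at this; linarith)
    have b2 := A1_bound' g b F (σ', e', k') (F (σ, e, k) - (ρ + c + a * MM q ℓ)) a a0 k (Ne.symm hk) (by
      intro y; have := hF' (σ, e, k) y; simp only at this
      rw [← phi_neg (y.2.2 - k), neg_sub]; linarith)
    simp only at b1 b2
    rw [← phi_neg (k' - k), neg_sub] at b2
    linarith

lemma phase1 (hl : 3 ≤ ℓ) (hq : 3 ≤ q) (g : ZMod q → Equiv.Perm B) (b : ZMod q → B)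
    (F : VT B q ℓ → ℝ) (ρ : ℝ) (hρ : 0 ≤ ρ) (h1 : ∀ x y, F x - F y ≤ 1)
    (h2 : ∀ σ σ' e k, F (σ, e, k) - F (σ', e, k) ≤ ρ) (m : ℕ) :
    ∀ x y, (T g b (fun _ => 1))^[m] F x - (T g b (fun _ => 1))^[m] F y ≤ ρ + 2 * cf q ℓ ^ m := by
  have key : ∀ m : ℕ, ∀ σ σ' e e' k k', (T g b (fun _ => 1))^[m] F (σ, e, k) -
      (T g b (fun _ => 1))^[m] F (σ', e', k') ≤ ρ + cf q ℓ ^ m * HH e e' k k' := by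
    intro m
    induction m with
    | zero =>
      intro σ σ' e e' k k'
      simp only [Function.iterate_zero, id, pow_zero, one_mul]
      by_cases h : k = k' ∧ e = e'
      · obtain ⟨rfl, rfl⟩ := h
        have := HH_nonneg e e k k
        linarith [h2 σ σ' e k]
      · linarith [HH_ge_one e e' k k' h, h1 (σ, e, k) (σ', e', k')]
    | succ m ih =>
      intro σ σ' e e' k k'
      rw [Function.iterate_succ_apply', pow_succ]
      exact phase1_step hl hq g b _ ρ _ (pow_nonneg cf_nonneg m) ih σ σ' e e' k k'
  rintro ⟨σ, e, k⟩ ⟨σ', e', k'⟩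
  refine (key m σ σ' e e' k k').trans ?_
  have := mul_le_mul_of_nonneg_left (HH_le_two e e' k k') (pow_nonneg (cf_nonneg (q := q) (ℓ := ℓ)) m)
  linarith

end Phase1

section Lower

variable {V : Type} {r q ℓ : ℕ} [Fintype V] [NeZero q] [NeZero ℓ]

/-- lifting a permutation of positions to bits -/
def lift (r : ℕ) (g : ZMod q → Equiv.Perm V) (e : ZMod q) : Equiv.Perm (V × Fin r) :=
  Equiv.prodCongr (g e) (Equiv.refl _)

/-- some position carries the label β -/
def HasLabel (β : Fin r → Bool) (σ : V × Fin r → Bool) : Prop := ∃ v, ∀ i, σ (v, i) = β i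

lemma lower_step (hl : 3 ≤ ℓ) (g : ZMod q → Equiv.Perm V) (b : ZMod q → V × Fin r)
    (w : ZMod q → ℝ) (hw : ∀ e, 1 ≤ w e) (β : Fin r → Bool)
    (Φ Φ' : ZMod q → ZMod ℓ → V → ℝ) (hicond : IntCond g Φ Φ')
    (hsite : ∀ e v, (∀ e', (b e').1 ≠ v) → siteExpr g w Φ e v ≤ Φ' e 0 v)
    (hO : ∀ e v, (∃ e', (b e').1 = v) → 1 ≤ Φ' e 0 v)
    (F : VT (V × Fin r) q ℓ → ℝ) (hF0 : ∀ x, 0 ≤ F x)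
    (hF : ∀ σ e k v, (∀ i, σ (v, i) = β i) → 1 - Φ e k v ≤ F (σ, e, k))
    (σ : V × Fin r → Bool) (e : ZMod q) (k : ZMod ℓ) (v : V) (hv : ∀ i, σ (v, i) = β i) :
    1 - Φ' e k v ≤ T (lift r g) b w F (σ, e, k) := by
  by_cases hk : k = 0
  · subst hk
    rw [T_zero hl]
    have hw' := hw e
    by_cases ho : ∃ e', (b e').1 = v
    · have h1 := hO e v ho
      have h2 : 0 ≤ (1/2) * F (σ, e, 0) + (w e * F (σ, e, 1) +
          w e * F (act (lift r g e).symm σ, e, -1) + F (σ, e + 1, 0) + F (σ, e - 1, 0)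
          + F (flip (b e) σ, e, 0)) / (2 * (3 + 2 * w e)) := by
        have := hF0 (σ, e, 0)
        have := hF0 (σ, e, 1)
        have := hF0 (act (lift r g e).symm σ, e, -1)
        have := hF0 (σ, e + 1, 0)
        have := hF0 (σ, e - 1, 0)
        have := hF0 (flip (b e) σ, e, 0)
        positivity
      linarith
    · push Not at ho
      have h1 := hsite e v ho
      unfold siteExpr at h1
      have i0 := hF σ e 0 v hv
      have i1 := hF σ e 1 v hv
      have i2 := hF (act (lift r g e).symm σ) e (-1) ((g e).symm v) (by
        intro i; simp [act, lift, hv])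
      have i3 := hF σ (e+1) 0 v hv
      have i4 := hF σ (e-1) 0 v hv
      have i5 := hF (flip (b e) σ) e 0 v (by
        intro i
        have : (v, i) ≠ b e := fun h => ho e (by rw [← h])
        simp [flip, this, hv])
      have hW : 0 < 2 * (3 + 2 * w e) := by linarith
      have j1 := mul_le_mul_of_nonneg_left i1 (by linarith : 0 ≤ w e)
      have j2 := mul_le_mul_of_nonneg_left i2 (by linarith : 0 ≤ w e)
      have sum : (3 + 2 * w e) - (w e * Φ e 1 v + w e * Φ e (-1) ((g e).symm v) + Φ (e+1) 0 v
          + Φ (e-1) 0 v + Φ e 0 v) ≤ (w e * F (σ, e, 1) +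
          w e * F (act (lift r g e).symm σ, e, -1) + F (σ, e + 1, 0) + F (σ, e - 1, 0)
          + F (flip (b e) σ, e, 0)) := by linarith
      have := div_le_div_of_nonneg_right sum hW.le
      rw [sub_div] at this
      have e1 : (3 + 2 * w e) / (2 * (3 + 2 * w e)) = 1/2 := by
        have : 3 + 2 * w e ≠ 0 := by linarith
        field_simp
      rw [e1] at this
      linarith
  · rw [T_pos _ b _ F σ e hk]
    have h1 := hicond e k v hk
    have i0 := hF σ e k v hv
    have i1 := hF σ e (k-1) v hv
    have i2 := hF (if k = -1 then act (lift r g e) σ else σ) e (k+1)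
      (if k = -1 then g e v else v) (by
        intro i
        by_cases h : k = -1
        · simp [h, act, lift, hv]
        · simp [h, hv])
    linarith

lemma T_nonneg {B : Type} [Fintype B] (g : ZMod q → Equiv.Perm B) (b : ZMod q → B)
    (w : ZMod q → ℝ) (hw : ∀ e, 1 ≤ w e) (F : VT B q ℓ → ℝ) (hF : ∀ x, 0 ≤ F x) (x) :
    0 ≤ T g b w F x := by
  have := hw x.2.1
  have := hF x
  have := hF (plus g x)
  have := hF (minus g x)
  have := hF (x.1, x.2.1 + 1, 0)
  have := hF (x.1, x.2.1 - 1, 0)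
  have := hF (flip (b x.2.1) x.1, x.2.1, 0)
  unfold T
  split_ifs <;> positivity

lemma lower (hl : 3 ≤ ℓ) (g : ZMod q → Equiv.Perm V) (b : ZMod q → V × Fin r)
    (w : ZMod q → ℝ) (hw : ∀ e, 1 ≤ w e) (β : Fin r → Bool) (N : ℕ)
    (Φ : ℕ → ZMod q → ZMod ℓ → V → ℝ) (hicond : ∀ n < N, IntCond g (Φ n) (Φ (n+1)))
    (hsite : ∀ n < N, ∀ e v, (∀ e', (b e').1 ≠ v) → siteExpr g w (Φ n) e v ≤ Φ (n+1) e 0 v)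
    (hO : ∀ n ≤ N, ∀ e v, (∃ e', (b e').1 = v) → 1 ≤ Φ n e 0 v)
    (h0 : ∀ e k v, 0 ≤ Φ 0 e k v) :
    ∀ n ≤ N, ∀ σ e k v, (∀ i, σ (v, i) = β i) → 1 - Φ n e k v ≤
      (T (lift r g) b w)^[n] (fun x => if HasLabel β x.1 then 1 else 0) (σ, e, k) := by
  have nn : ∀ n x, 0 ≤ (T (lift r g) b w)^[n] (fun x : VT (V × Fin r) q ℓ =>
      if HasLabel β x.1 then (1:ℝ) else 0) x := by
    intro n
    induction n with
    | zero => intro x; simp only [Function.iterate_zero, id]; split_ifs <;> norm_num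
    | succ n ih => intro x; rw [Function.iterate_succ_apply']; exact T_nonneg _ b w hw _ ih x
  intro n
  induction n with
  | zero =>
    intro _ σ e k v hv
    have : HasLabel β σ := ⟨v, hv⟩
    simp only [Function.iterate_zero, id, this, if_true]
    linarith [h0 e k v]
  | succ n ih =>
    intro hn σ e k v hv
    rw [Function.iterate_succ_apply']
    exact lower_step hl g b w hw β (Φ n) (Φ (n+1)) (hicond n (by omega)) (hsite n (by omega))
      (hO (n+1) hn) _ (nn n) (ih (by omega)) σ e k v hv

end Lower
end MBS

namespace MBS

section Abstract

variable {V : Type} [Fintype V] [DecidableEq V]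

/-- total weight -/
noncomputable def SS (G : SimpleGraph V) (w : V → V → ℝ) (x : V) : ℝ :=
  ∑ z, if G.Adj x z then w x z else 0

/-- admissible weights -/
structure Adm (G : SimpleGraph V) (w : V → V → ℝ) : Prop where
  one : ∀ x y, G.Adj x y → 1 ≤ w x y
  two : ∀ x y, G.Adj x y → w x y ≤ 2
  symm : ∀ x y, w x y = w y x
  nb : ∀ x, ∃ y, G.Adj x y

variable {G : SimpleGraph V} {w : V → V → ℝ}

lemma SS_pos (h : Adm G w) (x : V) : 0 < SS G w x := by
  obtain ⟨y, hy⟩ := h.nb x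
  unfold SS
  apply Finset.sum_pos'
  · intro z _; split_ifs with hz
    · linarith [h.one x z hz]
    · exact le_rfl
  · exact ⟨y, Finset.mem_univ y, by rw [if_pos hy]; linarith [h.one x y hy]⟩

lemma P_nonneg (h : Adm G w) (x y : V) : 0 ≤ lazyGraphP G w x y := by
  have := SS_pos h x
  unfold SS at this
  unfold lazyGraphP
  split_ifs with h1 h2
  · norm_num
  · have := h.one x y h2
    positivity
  · exact le_rfl

lemma P_row (h : Adm G w) (x : V) : ∑ y, lazyGraphP G w x y = 1 := by
  have hS := SS_pos h x
  have h1 : ∀ y, lazyGraphP G w x y = (if y = x then (1/2:ℝ) else 0)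
      + (if G.Adj x y then w x y else 0) / (2 * SS G w x) := by
    intro y
    unfold lazyGraphP SS
    by_cases hy : y = x
    · subst hy; simp
    · simp only [hy, if_false]
      split_ifs
      · ring
      · ring
  rw [Finset.sum_congr rfl (fun y _ => h1 y), Finset.sum_add_distrib, ← Finset.sum_div]
  have : (∑ z, if G.Adj x z then w x z else 0) = SS G w x := rfl
  rw [this]
  simp
  field_simp
  norm_num

lemma P_rev (h : Adm G w) (x y : V) :
    SS G w x * lazyGraphP G w x y = SS G w y * lazyGraphP G w y x := by
  have hx := SS_pos h x
  have hy := SS_pos h y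
  have e : ∀ x, (∑ z, if G.Adj x z then w x z else 0) = SS G w x := fun _ => rfl
  unfold lazyGraphP
  rw [e, e]
  by_cases hxy : y = x
  · subst hxy; simp
  · rw [if_neg hxy, if_neg (Ne.symm hxy)]
    by_cases ha : G.Adj x y
    · rw [if_pos ha, if_pos ha.symm, h.symm x y]; field_simp
    · rw [if_neg ha, if_neg (fun h => ha h.symm)]; simp

lemma tot_pos [Nonempty V] (h : Adm G w) : 0 < ∑ v, SS G w v :=
  Finset.sum_pos (fun v _ => SS_pos h v) Finset.univ_nonempty

lemma pi_eq (x : V) : graphPi G w x = SS G w x / ∑ v, SS G w v := rfl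

lemma pi_nonneg (h : Adm G w) (x : V) : 0 ≤ graphPi G w x := by
  rw [pi_eq]
  exact div_nonneg (SS_pos h x).le (Finset.sum_nonneg fun v _ => (SS_pos h v).le)

lemma pi_sum [Nonempty V] (h : Adm G w) : ∑ x, graphPi G w x = 1 := by
  simp only [pi_eq]
  rw [← Finset.sum_div, div_self (tot_pos h).ne']

lemma pi_rev (h : Adm G w) (x y : V) :
    graphPi G w x * lazyGraphP G w x y = graphPi G w y * lazyGraphP G w y x := by
  rw [pi_eq, pi_eq, div_mul_eq_mul_div, div_mul_eq_mul_div, P_rev h]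

lemma pi_stat (h : Adm G w) (F : V → ℝ) :
    ∑ x, graphPi G w x * (lazyGraphP G w).mulVec F x = ∑ x, graphPi G w x * F x := by
  have : ∀ x, graphPi G w x * (lazyGraphP G w).mulVec F x =
      ∑ y, graphPi G w y * lazyGraphP G w y x * F y := by
    intro x
    change _ * ∑ y, _ = _
    rw [Finset.mul_sum]
    apply Finset.sum_congr rfl
    intro y _
    rw [← pi_rev h, mul_assoc]
  rw [Finset.sum_congr rfl (fun x _ => this x), Finset.sum_comm]
  apply Finset.sum_congr rfl
  intro y _
  rw [← Finset.sum_mul, ← Finset.mul_sum, P_row h, mul_one]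

/-- iterates -/
noncomputable def It (G : SimpleGraph V) (w : V → V → ℝ) (n : ℕ) (F : V → ℝ) : V → ℝ :=
  ((lazyGraphP G w) ^ n).mulVec F

lemma It_zero (F : V → ℝ) : It G w 0 F = F := by simp [It]

lemma It_succ (n : ℕ) (F : V → ℝ) : It G w (n+1) F = (lazyGraphP G w).mulVec (It G w n F) := by
  unfold It; rw [pow_succ', Matrix.mulVec_mulVec]

lemma It_add (m n : ℕ) (F : V → ℝ) : It G w (m+n) F = It G w m (It G w n F) := by
  unfold It; rw [pow_add, Matrix.mulVec_mulVec]

lemma It_one (h : Adm G w) (n : ℕ) : It G w n (fun _ => 1) = fun _ => 1 := by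
  induction n with
  | zero => exact It_zero _
  | succ n ih =>
    rw [It_succ, ih]; funext x
    change ∑ y, lazyGraphP G w x y * 1 = 1
    simp only [mul_one]; exact P_row h x

lemma pi_It (h : Adm G w) (n : ℕ) (F : V → ℝ) :
    ∑ x, graphPi G w x * It G w n F x = ∑ x, graphPi G w x * F x := by
  induction n with
  | zero => rw [It_zero]
  | succ n ih => rw [It_succ, pi_stat h, ih]

lemma pow_nonneg' (h : Adm G w) (n : ℕ) (x y : V) : 0 ≤ ((lazyGraphP G w) ^ n) x y := by
  induction n generalizing x y with
  | zero => rw [pow_zero, Matrix.one_apply]; split_ifs <;> norm_num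
  | succ n ih =>
    rw [pow_succ', Matrix.mul_apply]
    exact Finset.sum_nonneg fun z _ => mul_nonneg (P_nonneg h x z) (ih z y)

lemma pow_row (h : Adm G w) (n : ℕ) (x : V) : ∑ y, ((lazyGraphP G w) ^ n) x y = 1 := by
  have := congrFun (It_one h n) x
  change ∑ y, ((lazyGraphP G w) ^ n) x y * 1 = 1 at this
  simpa using this

/-- upper bound via tests -/
lemma tv_le [Nonempty V] (h : Adm G w) (n : ℕ) (x : V) (c : ℝ)
    (hF : ∀ F : V → ℝ, (∀ y, 0 ≤ F y) → (∀ y, F y ≤ 1) →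
      It G w n F x - ∑ y, graphPi G w y * F y ≤ c) :
    (∑ y, |((lazyGraphP G w) ^ n) x y - graphPi G w y|) / 2 ≤ c := by
  set μ := fun y => ((lazyGraphP G w) ^ n) x y with hμ
  set ν := graphPi G w with hν
  have h1 : ∑ y, μ y = 1 := pow_row h n x
  have h2 : ∑ y, ν y = 1 := pi_sum h
  have := hF (fun y => if ν y ≤ μ y then 1 else 0) (fun y => by split_ifs <;> norm_num)
    (fun y => by split_ifs <;> norm_num)
  have e : It G w n (fun y => if ν y ≤ μ y then 1 else 0) x =
    ∑ y, μ y * (if ν y ≤ μ y then 1 else 0) := rfl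
  rw [e, ← Finset.sum_sub_distrib] at this
  have e2 : ∀ y, |μ y - ν y| = 2 * (μ y * (if ν y ≤ μ y then 1 else 0) -
      ν y * (if ν y ≤ μ y then 1 else 0)) - (μ y - ν y) := by
    intro y
    split_ifs with hy
    · rw [abs_of_nonneg (by linarith)]; ring
    · rw [abs_of_neg (by push Not at hy; linarith)]; ring
  change (∑ y, |μ y - ν y|) / 2 ≤ c
  rw [Finset.sum_congr rfl (fun y _ => e2 y), Finset.sum_sub_distrib, Finset.sum_sub_distrib, h1,
    h2, ← Finset.mul_sum]
  linarith

lemma tv_ge [Nonempty V] (h : Adm G w) (n : ℕ) (x : V) (F : V → ℝ) (h0 : ∀ y, 0 ≤ F y)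
    (h1 : ∀ y, F y ≤ 1) :
    It G w n F x - ∑ y, graphPi G w y * F y ≤
      (∑ y, |((lazyGraphP G w) ^ n) x y - graphPi G w y|) / 2 := by
  have r1 := pow_row h n x
  have r2 := pi_sum h
  have e : It G w n F x = ∑ y, ((lazyGraphP G w) ^ n) x y * F y := rfl
  rw [e, ← Finset.sum_sub_distrib, Finset.sum_div]
  have : ∀ y, ((lazyGraphP G w) ^ n) x y * F y - graphPi G w y * F y ≤
      |((lazyGraphP G w) ^ n) x y - graphPi G w y| / 2 +
        (((lazyGraphP G w) ^ n) x y - graphPi G w y) / 2 := by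
    intro y
    rw [← sub_mul]
    set d := ((lazyGraphP G w) ^ n) x y - graphPi G w y
    rcases le_total 0 d with hd | hd
    · rw [abs_of_nonneg hd]
      have := mul_le_mul_of_nonneg_left (h1 y) hd
      linarith
    · rw [abs_of_nonpos hd]
      have := mul_nonneg (neg_nonneg.2 hd) (h0 y)
      linarith
  have s := Finset.sum_le_sum (fun y (_ : y ∈ univ) => this y)
  rw [Finset.sum_add_distrib, ← Finset.sum_div (s := univ) (f := fun y =>
    ((lazyGraphP G w) ^ n) x y - graphPi G w y), Finset.sum_sub_distrib (f := fun y =>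
    ((lazyGraphP G w) ^ n) x y), r1, r2] at s
  linarith

/-- oscillation bounds give distance to equilibrium -/
lemma osc_pi [Nonempty V] (h : Adm G w) (n : ℕ) (F : V → ℝ) (c : ℝ)
    (hF : ∀ x x', It G w n F x - It G w n F x' ≤ c) (x : V) :
    It G w n F x - ∑ y, graphPi G w y * F y ≤ c := by
  rw [← pi_It h n F]
  have e : It G w n F x = ∑ y, graphPi G w y * It G w n F x := by
    rw [← Finset.sum_mul, pi_sum h, one_mul]
  calc It G w n F x - ∑ y, graphPi G w y * It G w n F y
      = ∑ y, graphPi G w y * (It G w n F x - It G w n F y) := by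
        simp only [mul_sub]; rw [Finset.sum_sub_distrib, ← e]
    _ ≤ ∑ y, graphPi G w y * c :=
        Finset.sum_le_sum fun y _ => mul_le_mul_of_nonneg_left (hF x y) (pi_nonneg h y)
    _ = c := by rw [← Finset.sum_mul, pi_sum h, one_mul]

lemma mixFrom_le [Nonempty V] (h : Adm G w) (N : ℕ)
    (hN : ∀ F : V → ℝ, (∀ y, 0 ≤ F y) → (∀ y, F y ≤ 1) → ∀ x x',
      It G w N F x - It G w N F x' ≤ 1/4) (x : V) : graphMixFrom G w x ≤ N := by
  apply Nat.sInf_le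
  exact tv_le h N x _ fun F h0 h1 => osc_pi h N F _ (hN F h0 h1) x

lemma mix_le [Nonempty V] (h : Adm G w) (N : ℕ)
    (hN : ∀ F : V → ℝ, (∀ y, 0 ≤ F y) → (∀ y, F y ≤ 1) → ∀ x x',
      It G w N F x - It G w N F x' ≤ 1/4) : graphMix G w ≤ N := by
  apply csSup_le'
  rintro k ⟨x, rfl⟩
  exact mixFrom_le h N hN x

lemma conn_of_mix [Nonempty V] (h : Adm G w) (N : ℕ)
    (hN : ∀ F : V → ℝ, (∀ y, 0 ≤ F y) → (∀ y, F y ≤ 1) → ∀ x x',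
      It G w N F x - It G w N F x' ≤ 1/4) : G.Connected := by
  refine ⟨fun x x' => ?_⟩
  by_contra hx
  set F : V → ℝ := fun y => if G.Reachable x y then 1 else 0 with hF
  have hPF : (lazyGraphP G w).mulVec F = F := by
    funext z
    change ∑ y, lazyGraphP G w z y * F y = F z
    have : ∀ y, lazyGraphP G w z y * F y = lazyGraphP G w z y * F z := by
      intro y
      unfold lazyGraphP
      split_ifs with h1 h2
      · rw [h1]
      · have : F y = F z := by
          simp only [hF]
          have : G.Reachable x y ↔ G.Reachable x z :=
            ⟨fun h => h.trans h2.symm.reachable, fun h => h.trans h2.reachable⟩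
          simp [this]
        rw [this]
      · simp
    rw [Finset.sum_congr rfl (fun y _ => this y), ← Finset.sum_mul, P_row h, one_mul]
  have hIt : ∀ n, It G w n F = F := by
    intro n
    induction n with
    | zero => exact It_zero _
    | succ n ih => rw [It_succ, ih, hPF]
  have := hN F (fun y => by simp only [hF]; split_ifs <;> norm_num)
    (fun y => by simp only [hF]; split_ifs <;> norm_num) x x'
  rw [hIt] at this
  simp [hF, hx] at this
  norm_num at this

lemma Adm.unit (h : Adm G w) : Adm G (fun _ _ => 1) :=
  ⟨fun _ _ _ => le_rfl, fun _ _ _ => one_le_two, fun _ _ => rfl, h.nb⟩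

lemma P_half (h : Adm G w) (x y : V) :
    (1/2) * lazyGraphP G (fun _ _ => 1) x y ≤ lazyGraphP G w x y := by
  have e : ∀ w x, (∑ z, if G.Adj x z then w x z else 0) = SS G w x := fun _ _ => rfl
  have h1 := SS_pos h x
  have h2 := SS_pos h.unit x
  have h3 : SS G w x ≤ 2 * SS G (fun _ _ => 1) x := by
    unfold SS; rw [Finset.mul_sum]
    apply Finset.sum_le_sum; intro z _
    split_ifs with hz
    · linarith [h.two x z hz]
    · simp
  unfold lazyGraphP
  rw [e w x, e (fun _ _ => 1) x]
  split_ifs with hx ha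
  · norm_num
  · have := h.one x y ha
    rw [← mul_div_assoc, div_le_div_iff₀ (by positivity) (by positivity)]
    have : 1 * (2 * SS G (fun _ _ => 1) x) ≤ w x y * (2 * SS G (fun _ _ => 1) x) :=
      mul_le_mul_of_nonneg_right this (by positivity)
    linarith
  · simp

lemma pow_half (h : Adm G w) (n : ℕ) (x y : V) :
    (1/2)^n * ((lazyGraphP G (fun _ _ => 1)) ^ n) x y ≤ ((lazyGraphP G w) ^ n) x y := by
  induction n generalizing x y with
  | zero => simp
  | succ n ih =>
    rw [pow_succ' (lazyGraphP G w), pow_succ' (lazyGraphP G _), Matrix.mul_apply, Matrix.mul_apply,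
      Finset.mul_sum]
    apply Finset.sum_le_sum
    intro z _
    have := mul_le_mul (P_half h x z) (ih z y)
      (mul_nonneg (by positivity) (pow_nonneg' h.unit n z y)) (P_nonneg h x z)
    refine le_trans (le_of_eq ?_) this
    ring

/-- Doeblin contraction of the perturbed walk -/
lemma perturbed_contr (h : Adm G w) (N : ℕ)
    (hN : ∀ F : V → ℝ, (∀ y, 0 ≤ F y) → (∀ y, F y ≤ 1) → ∀ x x',
      It G (fun _ _ => 1) N F x - It G (fun _ _ => 1) N F x' ≤ 1/4) (F : V → ℝ) (a c : ℝ)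
    (hc : 0 < c) (h0 : ∀ y, a ≤ F y) (h1 : ∀ y, F y ≤ a + c) (x x' : V) :
    It G w N F x - It G w N F x' ≤ (1 - (3/4) * (1/2)^N) * c := by
  set κ : ℝ := (1/2)^N with hκ
  set P := (lazyGraphP G w) ^ N
  set Q := (lazyGraphP G (fun _ _ => 1)) ^ N
  have hP := pow_row h N
  have hQ := pow_row h.unit N
  have hle := pow_half h N
  have b1 : It G w N F x - κ * It G (fun _ _ => 1) N F x ≤ (1 - κ) * (a + c) := by
    have : It G w N F x - κ * It G (fun _ _ => 1) N F x = ∑ y, (P x y - κ * Q x y) * F y := by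
      change ∑ y, P x y * F y - κ * ∑ y, Q x y * F y = _
      rw [Finset.mul_sum, ← Finset.sum_sub_distrib]
      apply Finset.sum_congr rfl; intro y _; ring
    rw [this]
    have e : (1 - κ) * (a + c) = ∑ y, (P x y - κ * Q x y) * (a + c) := by
      rw [← Finset.sum_mul, Finset.sum_sub_distrib, ← Finset.mul_sum, hP, hQ, mul_one]
    rw [e]
    exact Finset.sum_le_sum fun y _ => mul_le_mul_of_nonneg_left (h1 y) (sub_nonneg.2 (hle x y))
  have b2 : (1 - κ) * a ≤ It G w N F x' - κ * It G (fun _ _ => 1) N F x' := by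
    have : It G w N F x' - κ * It G (fun _ _ => 1) N F x' = ∑ y, (P x' y - κ * Q x' y) * F y := by
      change ∑ y, P x' y * F y - κ * ∑ y, Q x' y * F y = _
      rw [Finset.mul_sum, ← Finset.sum_sub_distrib]
      apply Finset.sum_congr rfl; intro y _; ring
    rw [this]
    have e : (1 - κ) * a = ∑ y, (P x' y - κ * Q x' y) * a := by
      rw [← Finset.sum_mul, Finset.sum_sub_distrib, ← Finset.mul_sum, hP, hQ, mul_one]
    rw [e]
    exact Finset.sum_le_sum fun y _ => mul_le_mul_of_nonneg_left (h0 y) (sub_nonneg.2 (hle x' y))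
  have b3 := hN (fun y => (F y - a) / c) (fun y => div_nonneg (by linarith [h0 y]) hc.le)
    (fun y => by rw [div_le_one hc]; linarith [h1 y]) x x'
  have e3 : ∀ x, It G (fun _ _ => 1) N (fun y => (F y - a) / c) x =
      (It G (fun _ _ => 1) N F x - a) / c := by
    intro x
    change ∑ y, Q x y * ((F y - a) / c) = (∑ y, Q x y * F y - a) / c
    have : a = ∑ y, Q x y * a := by rw [← Finset.sum_mul, hQ, one_mul]
    conv_rhs => rw [this]
    rw [← Finset.sum_sub_distrib, Finset.sum_div]
    apply Finset.sum_congr rfl; intro y _; ring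
  rw [e3, e3, ← sub_div, div_le_iff₀ hc] at b3
  have hk : 0 ≤ κ := by positivity
  have := mul_le_mul_of_nonneg_left b3 hk
  linarith

lemma mixset_nonempty [Nonempty V] (h : Adm G w) (N : ℕ)
    (hN : ∀ F : V → ℝ, (∀ y, 0 ≤ F y) → (∀ y, F y ≤ 1) → ∀ x x',
      It G (fun _ _ => 1) N F x - It G (fun _ _ => 1) N F x' ≤ 1/4) (x : V) :
    {t : ℕ | (∑ y, |((lazyGraphP G w) ^ t) x y - graphPi G w y|) / 2 ≤ 1 / 4}.Nonempty := by
  set ρ : ℝ := 1 - (3/4) * (1/2)^N with hρ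
  have hp : (0:ℝ) < (1/2)^N := by positivity
  have hp1 : ((1:ℝ)/2)^N ≤ 1 := pow_le_one₀ (by norm_num) (by norm_num)
  have ρ0 : 0 < ρ := by rw [hρ]; linarith
  have ρ1 : ρ < 1 := by rw [hρ]; linarith
  have key : ∀ j : ℕ, ∀ F : V → ℝ, (∀ y, 0 ≤ F y) → (∀ y, F y ≤ 1) → ∀ x x',
      It G w (N * j) F x - It G w (N * j) F x' ≤ ρ ^ j := by
    intro j F h0 h1
    induction j with
    | zero =>
      intro x x'; rw [mul_zero, It_zero, pow_zero]; linarith [h0 x', h1 x]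
    | succ j ih =>
      intro x x'
      have : N * (j+1) = N + N * j := by ring
      rw [this, It_add, pow_succ']
      obtain ⟨z, hz⟩ := Finite.exists_min (It G w (N * j) F)
      exact perturbed_contr h N hN _ (It G w (N*j) F z) _ (by positivity) hz
        (fun y => by linarith [ih y z]) x x'
  obtain ⟨j, hj⟩ := exists_pow_lt_of_lt_one (by norm_num : (0:ℝ) < 1/4) ρ1
  exact ⟨N * j, tv_le h _ x _ fun F h0 h1 => osc_pi h _ F _
    (fun x x' => (key j F h0 h1 x x').trans hj.le) x⟩

lemma mix_compare [Nonempty V] (h : Adm G w) (N M : ℕ)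
    (hN : ∀ F : V → ℝ, (∀ y, 0 ≤ F y) → (∀ y, F y ≤ 1) → ∀ x x',
      It G (fun _ _ => 1) N F x - It G (fun _ _ => 1) N F x' ≤ 1/4)
    (hM : ∀ x, ∃ F : V → ℝ, (∀ y, 0 ≤ F y) ∧ (∀ y, F y ≤ 1) ∧ ∀ n ≤ M,
      (∑ y, graphPi G w y * F y) + 1/4 < It G w n F x) :
    G.Connected ∧ graphMix G (fun _ _ => 1) ≤ N ∧
      M + 1 ≤ sInf {k : ℕ | ∃ x, k = graphMixFrom G w x} := by
  refine ⟨conn_of_mix h.unit N hN, mix_le h.unit N hN, ?_⟩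
  apply le_csInf
  · exact ⟨_, Classical.arbitrary V, rfl⟩
  rintro k ⟨x, rfl⟩
  apply le_csInf (mixset_nonempty h N hN x)
  intro t ht
  by_contra hlt
  obtain ⟨F, h0, h1, hF⟩ := hM x
  have a := hF t (by omega)
  have b := tv_ge h t x F h0 h1
  have c : (∑ y, |((lazyGraphP G w) ^ t) x y - graphPi G w y|) / 2 ≤ 1 / 4 := ht
  linarith

end Abstract
end MBS

namespace MBS

section Transport

variable {V W : Type} [Fintype V] [DecidableEq V] [Fintype W] [DecidableEq W]

lemma lazy_transport (f : W ≃ V) (G : SimpleGraph V) (w : V → V → ℝ) :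
    lazyGraphP (G.comap f) (fun x y => w (f x) (f y)) = (lazyGraphP G w).submatrix f f := by
  funext x y
  simp only [lazyGraphP, Matrix.submatrix_apply, SimpleGraph.comap_adj, f.injective.eq_iff]
  rw [f.sum_comp (fun z => if G.Adj (f x) z then w (f x) z else 0)]

lemma pi_transport (f : W ≃ V) (G : SimpleGraph V) (w : V → V → ℝ) (x : W) :
    graphPi (G.comap f) (fun x y => w (f x) (f y)) x = graphPi G w (f x) := by
  simp only [graphPi, SimpleGraph.comap_adj]
  rw [f.sum_comp (fun z => if G.Adj (f x) z then w (f x) z else 0)]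
  congr 1
  rw [← f.sum_comp (fun v => ∑ z, if G.Adj v z then w v z else 0)]
  apply Finset.sum_congr rfl
  intro v _
  rw [f.sum_comp (fun z => if G.Adj (f v) z then w (f v) z else 0)]

lemma pow_transport (f : W ≃ V) (A : Matrix V V ℝ) (n : ℕ) :
    (A.submatrix f f) ^ n = (A ^ n).submatrix f f := by
  induction n with
  | zero => simp
  | succ n ih => rw [pow_succ, pow_succ, ih, Matrix.submatrix_mul_equiv]

lemma mixFrom_transport (f : W ≃ V) (G : SimpleGraph V) (w : V → V → ℝ) (x : W) :
    graphMixFrom (G.comap f) (fun x y => w (f x) (f y)) x = graphMixFrom G w (f x) := by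
  unfold graphMixFrom
  congr 1
  ext t
  simp only [Set.mem_setOf_eq]
  rw [lazy_transport, pow_transport]
  simp only [pi_transport, Matrix.submatrix_apply]
  rw [f.sum_comp (fun y => |((lazyGraphP G w) ^ t) (f x) y - graphPi G w y|)]

lemma set_transport (f : W ≃ V) (G : SimpleGraph V) (w : V → V → ℝ) :
    {k : ℕ | ∃ x, k = graphMixFrom (G.comap f) (fun x y => w (f x) (f y)) x} =
      {k : ℕ | ∃ x, k = graphMixFrom G w x} := by
  ext k
  simp only [Set.mem_setOf_eq, mixFrom_transport]
  constructor
  · rintro ⟨x, hx⟩; exact ⟨f x, hx⟩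
  · rintro ⟨x, hx⟩; exact ⟨f.symm x, by simpa using hx⟩

end Transport

/-- the object to be constructed for every `n` -/
def Target (n : ℕ) : Prop :=
  ∃ (V : Type) (_ : Fintype V) (G : SimpleGraph V) (w : V → V → ℝ), n ≤ Fintype.card V ∧
    G.Connected ∧ (∀ x, (∑ z, if G.Adj x z then (1:ℝ) else 0) ≤ 5) ∧ (∀ x y, w x y = w y x) ∧
    (∀ x y, G.Adj x y → 1 ≤ w x y ∧ w x y ≤ 1 + 1 / ((n:ℝ) + 1)) ∧
    (graphMix G (fun _ _ => 1) : ℝ) ≤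
      1 / ((n:ℝ) + 1) * (sInf {k : ℕ | ∃ x, k = graphMixFrom G w x} : ℕ)

lemma target_fin (n : ℕ) (h : Target n) :
    ∃ (m : ℕ) (G : SimpleGraph (Fin m)) (w : Fin m → Fin m → ℝ), n ≤ m ∧
    G.Connected ∧ (∀ x, G.degree x ≤ 5) ∧ (∀ x y, w x y = w y x) ∧
    (∀ x y, G.Adj x y → 1 ≤ w x y ∧ w x y ≤ 1 + 1 / ((n:ℝ) + 1)) ∧
    (graphMix G (fun _ _ => 1) : ℝ) ≤
      1 / ((n:ℝ) + 1) * (sInf {k : ℕ | ∃ x, k = graphMixFrom G w x} : ℕ) := by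
  obtain ⟨V, _, G, w, h1, h2, h3, h4, h5, h6⟩ := h
  let f := (Fintype.equivFin V).symm
  refine ⟨Fintype.card V, G.comap f, fun x y => w (f x) (f y), h1, ?_, ?_, fun x y => h4 _ _,
    fun x y h => h5 _ _ h, ?_⟩
  · exact (SimpleGraph.Iso.connected_iff (SimpleGraph.Iso.comap f G)).2 h2
  · intro x
    have := h3 (f x)
    rw [← f.sum_comp (fun z => if G.Adj (f x) z then (1:ℝ) else 0)] at this
    have e : (∑ z, if G.Adj (f x) (f z) then (1:ℝ) else 0) = ((G.comap f).degree x : ℝ) := by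
      rw [← SimpleGraph.card_neighborFinset_eq_degree, SimpleGraph.neighborFinset_eq_filter,
        Finset.sum_boole]
      rfl
    rw [e] at this
    exact_mod_cast this
  · have e1 : graphMix (G.comap f) (fun _ _ => 1) = graphMix G (fun _ _ => 1) := by
      unfold graphMix
      rw [← set_transport f G (fun _ _ => 1)]
    rw [e1, set_transport f G w]
    exact h6

theorem main_of_target (h : ∀ n, Target n) :
    ∃ (m : ℕ → ℕ) (G : ∀ n, SimpleGraph (Fin (m n)))
      (w : ∀ n, Fin (m n) → Fin (m n) → ℝ) (δ : ℕ → ℝ) (D : ℕ),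
      Tendsto m atTop atTop ∧
      (∀ n, (G n).Connected) ∧
      (∀ n v, (G n).degree v ≤ D) ∧
      (∀ n, 0 < δ n) ∧ Tendsto δ atTop (nhds 0) ∧
      (∀ n x y, w n x y = w n y x) ∧
      (∀ n x y, (G n).Adj x y → 1 ≤ w n x y ∧ w n x y ≤ 1 + δ n) ∧
      (∀ n, (graphMix (G n) (fun _ _ => 1) : ℝ) ≤
        δ n * (sInf {k : ℕ | ∃ x, k = graphMixFrom (G n) (w n) x} : ℕ)) := by
  choose m G w h1 h2 h3 h4 h5 h6 using fun n => target_fin n (h n)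
  refine ⟨m, G, w, fun n => 1 / ((n:ℝ) + 1), 5, tendsto_atTop_mono h1 tendsto_id, h2, h3,
    fun n => by positivity, tendsto_one_div_add_atTop_nhds_zero_nat, h4, h5, h6⟩

end MBS

namespace MBS

section Spec

variable {B : Type} {q ℓ : ℕ} [Fintype B] [NeZero q] [NeZero ℓ]

lemma It_eq (hq : 3 ≤ q) (hl : 3 ≤ ℓ) (g : ZMod q → Equiv.Perm B) (b : ZMod q → B)
    (w : ZMod q → ℝ) (hw : ∀ e, 1 ≤ w e) (n : ℕ) (F : VT B q ℓ → ℝ) :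
    It (gr g b) (wt w) n F = (T g b w)^[n] F := by
  induction n with
  | zero => exact It_zero _
  | succ n ih => rw [It_succ, ih, mulVec_eq hq hl g b w hw, Function.iterate_succ_apply']

lemma adm_gr (hq : 3 ≤ q) (hl : 3 ≤ ℓ) (g : ZMod q → Equiv.Perm B) (b : ZMod q → B)
    (w : ZMod q → ℝ) (hw : ∀ e, 1 ≤ w e) (hw2 : ∀ e, w e ≤ 2) :
    Adm (gr g b : SimpleGraph (VT B q ℓ)) (wt w) := by
  refine ⟨?_, ?_, wt_symm w, ?_⟩
  · intro x y _; unfold wt; split_ifs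
    · exact le_rfl
    · exact hw _
  · intro x y _; unfold wt; split_ifs
    · norm_num
    · exact hw2 _
  · intro x
    refine ⟨plus g x, ?_⟩
    rw [adj_iff hq hl]
    unfold nbrs; split_ifs <;> simp

lemma It_mem {V : Type} [Fintype V] [DecidableEq V] {G : SimpleGraph V} {w : V → V → ℝ}
    (h : Adm G w) (n : ℕ) (F : V → ℝ) (h0 : ∀ y, 0 ≤ F y) (h1 : ∀ y, F y ≤ 1) (x : V) :
    0 ≤ It G w n F x ∧ It G w n F x ≤ 1 := by
  have e : It G w n F x = ∑ y, ((lazyGraphP G w) ^ n) x y * F y := rfl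
  rw [e]
  constructor
  · exact Finset.sum_nonneg fun y _ => mul_nonneg (pow_nonneg' h n x y) (h0 y)
  · rw [← pow_row h n x]
    apply Finset.sum_le_sum
    intro y _
    exact mul_le_of_le_one_right (pow_nonneg' h n x y) (h1 y)

/-- bits, as a sealed product -/
def Bits (V : Type) (r : ℕ) : Type := V × Fin r

noncomputable instance {V : Type} [Fintype V] {r : ℕ} : Fintype (Bits V r) :=
  inferInstanceAs (Fintype (V × Fin r))

/-- constructor -/
def Bits.mk {V : Type} {r : ℕ} (v : V) (i : Fin r) : Bits V r := (v, i)

lemma card_label {V : Type} [Fintype V] (r : ℕ) (β : Fin r → Bool) (v : V) :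
    (Finset.univ.filter (fun σ : Bits V r → Bool => ∀ i, σ (Bits.mk v i) = β i)).card * 2 ^ r ≤
      Fintype.card (Bits V r → Bool) := by
  have e : (2:ℕ) ^ r = (Finset.univ : Finset (Fin r → Bool)).card := by simp
  rw [e, ← Finset.card_product]
  apply Finset.card_le_card_of_injOn
    (fun p : (Bits V r → Bool) × (Fin r → Bool) => fun x : Bits V r =>
      if x.1 = v then p.2 x.2 else p.1 x)
  · intro p _; simp
  · rintro ⟨σ, γ⟩ h ⟨σ', γ'⟩ h' heq
    simp only [Finset.coe_product, Set.mem_prod, Finset.mem_coe, Finset.mem_filter,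
      Finset.mem_univ, true_and, and_true] at h h'
    simp only at heq
    have h2 : γ = γ' := by
      funext i
      have := congrFun heq (Bits.mk v i)
      have e1 : (Bits.mk v i).1 = v := rfl
      rw [if_pos e1, if_pos e1] at this
      exact this
    have h1 : σ = σ' := by
      funext x
      obtain ⟨u, i⟩ := x
      by_cases hu : u = v
      · subst hu; exact (h i).trans (h' i).symm
      · have := congrFun heq (Bits.mk u i)
        have e1 : ¬ (Bits.mk u i).1 = v := hu
        rw [if_neg e1, if_neg e1] at this
        exact this
    rw [h1, h2]

/-- label -/
def HasLabelB {V : Type} {r : ℕ} (β : Fin r → Bool) (σ : Bits V r → Bool) : Prop :=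
  ∃ v, ∀ i, σ (Bits.mk v i) = β i

lemma pi_label {V : Type} [Fintype V] {r : ℕ} (hq : 3 ≤ q) (hl : 3 ≤ ℓ)
    (g : ZMod q → Equiv.Perm (Bits V r)) (b : ZMod q → Bits V r)
    (w : ZMod q → ℝ) (hw : ∀ e, 1 ≤ w e) (hw2 : ∀ e, w e ≤ 2) (β : Fin r → Bool) :
    ∑ y : VT (Bits V r) q ℓ, graphPi (gr g b) (wt w) y * (if HasLabelB β y.1 then 1 else 0)
      ≤ Fintype.card V / 2 ^ r := by
  have hA := adm_gr (ℓ := ℓ) hq hl g b w hw hw2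
  have ht := tot_pos hA
  have hS : ∀ y : VT (Bits V r) q ℓ, SS (gr g b) (wt w) y = vW w y := fun y => sum_vW hq hl g b w y
  have hpi : ∀ y : VT (Bits V r) q ℓ, graphPi (gr g b) (wt w) y = vW w y / ∑ z : VT (Bits V r) q ℓ, vW w z := by
    intro y; rw [pi_eq]; simp only [hS]
  set c : ℝ := ∑ p : ZMod q × ZMod ℓ, (if p.2 = 0 then 3 + 2 * w p.1 else 2 * w p.1) with hc
  have hc0 : 0 < c := by
    apply Finset.sum_pos
    · intro p _; have := hw p.1; split_ifs <;> linarith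
    · exact Finset.univ_nonempty
  have fub : ∀ f : (Bits V r → Bool) → ℝ, ∑ y : VT (Bits V r) q ℓ, vW w y * f y.1 =
      c * ∑ σ, f σ := by
    intro f
    rw [Fintype.sum_prod_type, hc, Finset.mul_sum]
    apply Finset.sum_congr rfl
    intro σ _
    rw [Finset.sum_mul]
    rfl
  have tot : ∑ z : VT (Bits V r) q ℓ, vW w z = c * Fintype.card (Bits V r → Bool) := by
    have := fub (fun _ => 1)
    simpa using this
  have e1 : ∑ y : VT (Bits V r) q ℓ, graphPi (gr g b) (wt w) y * (if HasLabelB β y.1 then 1 else 0)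
      = (∑ y : VT (Bits V r) q ℓ, vW w y * (if HasLabelB β y.1 then 1 else 0)) /
        ∑ z : VT (Bits V r) q ℓ, vW w z := by
    rw [Finset.sum_div]
    apply Finset.sum_congr rfl
    intro y _
    rw [hpi]; ring
  rw [e1, fub (fun σ => if HasLabelB β σ then 1 else 0), tot, mul_div_mul_left _ _ hc0.ne']
  have hN : (0:ℝ) < Fintype.card (Bits V r → Bool) := by
    exact_mod_cast Fintype.card_pos
  rw [div_le_div_iff₀ hN (by positivity)]
  have b1 : (∑ σ : Bits V r → Bool, if HasLabelB β σ then (1:ℝ) else 0) ≤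
      ∑ v : V, ((Finset.univ.filter
        (fun σ : Bits V r → Bool => ∀ i, σ (Bits.mk v i) = β i)).card : ℝ) := by
    have : ∀ σ : Bits V r → Bool, (if HasLabelB β σ then (1:ℝ) else 0) ≤
        ∑ v : V, if ∀ i, σ (Bits.mk v i) = β i then (1:ℝ) else 0 := by
      intro σ
      have nn : ∀ v ∈ (univ : Finset V), (0:ℝ) ≤ if ∀ i, σ (Bits.mk v i) = β i then (1:ℝ) else 0 := by
        intro v _; split_ifs <;> norm_num
      split_ifs with h
      · obtain ⟨v, hv⟩ := h
        have := Finset.single_le_sum nn (Finset.mem_univ v)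
        rw [if_pos hv] at this
        exact this
      · exact Finset.sum_nonneg nn
    refine (Finset.sum_le_sum fun σ _ => this σ).trans ?_
    rw [Finset.sum_comm]
    apply Finset.sum_le_sum
    intro v _
    rw [Finset.sum_boole]
  have b2 : (∑ v : V, ((Finset.univ.filter
        (fun σ : Bits V r → Bool => ∀ i, σ (Bits.mk v i) = β i)).card : ℝ)) * 2 ^ r ≤
        Fintype.card V * Fintype.card (Bits V r → Bool) := by
    rw [Finset.sum_mul]
    have : ∀ v : V, ((Finset.univ.filter
        (fun σ : Bits V r → Bool => ∀ i, σ (Bits.mk v i) = β i)).card : ℝ) * 2 ^ r ≤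
        Fintype.card (Bits V r → Bool) := by
      intro v
      exact_mod_cast card_label r β v
    refine (Finset.sum_le_sum fun v _ => this v).trans ?_
    simp
  refine le_trans ?_ b2
  exact mul_le_mul_of_nonneg_right b1 (by positivity)

/-- lifting -/
def liftB {V : Type} (r : ℕ) (g : ZMod q → Equiv.Perm V) : ZMod q → Equiv.Perm (Bits V r) := lift r g

lemma target_intro {A : Type} [iF : Fintype A] [iD : DecidableEq A] (n : ℕ) (G : SimpleGraph A)
    (w : A → A → ℝ) (h1 : n ≤ Fintype.card A) (h2 : G.Connected)
    (h3 : ∀ x, (∑ z, if G.Adj x z then (1:ℝ) else 0) ≤ 5) (h4 : ∀ x y, w x y = w y x)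
    (h5 : ∀ x y, G.Adj x y → 1 ≤ w x y ∧ w x y ≤ 1 + 1 / ((n:ℝ) + 1))
    (h6 : (graphMix G (fun _ _ => 1) : ℝ) ≤
      1 / ((n:ℝ) + 1) * (sInf {k : ℕ | ∃ x, k = graphMixFrom G w x} : ℕ)) : Target n := by
  have e : iD = fun a b => Classical.propDecidable (a = b) := Subsingleton.elim _ _
  subst e
  exact ⟨A, iF, G, w, h1, h2, h3, h4, h5, h6⟩

/-- The chain estimates, assembled. -/
lemma chain_target {V : Type} [Fintype V] {r : ℕ} (n : ℕ) (hq : 3 ≤ q) (hl : 3 ≤ ℓ) (hln : n ≤ ℓ)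
    (g : ZMod q → Equiv.Perm V) (b : ZMod q → Bits V r)
    (w : ZMod q → ℝ) (hw : ∀ e, 1 ≤ w e) (hwn : ∀ e, w e ≤ 1 + 1 / ((n:ℝ) + 1))
    (N₂ m M : ℕ) (hcf : 2 * cf q ℓ ^ m ≤ 1/8)
    (Ψ : ℕ → ZMod q → ZMod ℓ → Bits V r → ℝ)
    (hicond : ∀ n < N₂, IntCond (liftB r g) (Ψ n) (Ψ (n+1)))
    (hsite : ∀ n < N₂, ∀ e x, siteExpr (liftB r g) (fun _ => 1) (Ψ n) e x -
      (if b e = x then (1:ℝ) else 0) / 5 * Ψ n e 0 x ≤ Ψ (n+1) e 0 x)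
    (h0 : ∀ e k x, 1 ≤ Ψ 0 e k x)
    (hend : ∀ σ σ' e k, Dsum (Ψ N₂ e k) σ σ' ≤ 1/8)
    (Φ : ℕ → ZMod q → ZMod ℓ → V → ℝ) (hicond' : ∀ n < M, IntCond g (Φ n) (Φ (n+1)))
    (hsite' : ∀ n < M, ∀ e v, (∀ e', (b e').1 ≠ v) → siteExpr g w (Φ n) e v ≤ Φ (n+1) e 0 v)
    (hO : ∀ n ≤ M, ∀ e v, (∃ e', (b e').1 = v) → 1 ≤ Φ n e 0 v)
    (h0' : ∀ e k v, 0 ≤ Φ 0 e k v) (a : V) (ha : ∀ n ≤ M, ∀ e k, Φ n e k a ≤ 1/2)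
    (hcard : (Fintype.card V : ℝ) / 2 ^ r < 1/4)
    (hcomp : ((N₂ + m : ℕ) : ℝ) ≤ 1 / ((n:ℝ) + 1) * ((M + 1 : ℕ) : ℝ)) : Target n := by
  have hw2 : ∀ e, w e ≤ 2 := by
    intro e; have := hwn e
    have : 1 / ((n:ℝ) + 1) ≤ 1 := by
      rw [div_le_one (by positivity)]; linarith [Nat.cast_nonneg (α := ℝ) n]
    linarith
  have hA := adm_gr (ℓ := ℓ) hq hl (liftB r g) b w hw hw2
  have hA1 := adm_gr (ℓ := ℓ) hq hl (liftB r g) b (fun _ => 1) (fun _ => le_rfl)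
    (fun _ => one_le_two)
  have It1 : ∀ n F, It (gr (liftB r g) b : SimpleGraph (VT (Bits V r) q ℓ)) (fun _ _ => 1) n F =
      (T (liftB r g) b (fun _ => 1))^[n] F := by
    intro n F; rw [← It_eq hq hl _ _ _ (fun _ => le_rfl), wt_one]
  obtain ⟨c1, c2, c3⟩ := mix_compare hA (N₂ + m) M (by
    intro F f0 f1 x x'
    rw [It1, Nat.add_comm, Function.iterate_add_apply]
    have hm : ∀ x, 0 ≤ (T (liftB r g) b (fun _ => 1))^[N₂] F x ∧
        (T (liftB r g) b (fun _ => 1))^[N₂] F x ≤ 1 := by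
      intro x; rw [← It_eq hq hl _ _ _ (fun _ => le_rfl)]
      exact It_mem hA1 N₂ F f0 f1 x
    have p1 := phase1 hl hq (liftB r g) b ((T (liftB r g) b (fun _ => 1))^[N₂] F) (1/8) (by norm_num)
      (fun x y => by linarith [(hm x).2, (hm y).1])
      (fun σ σ' e k => (phase2 hl (liftB r g) b N₂ Ψ hicond hsite h0 F f0 f1 N₂ le_rfl σ σ' e k).trans
        (hend σ σ' e k)) m x x'
    linarith) (by
    intro x
    obtain ⟨σ, e, k⟩ := x
    set β : Fin r → Bool := fun i => σ (Bits.mk a i) with hβ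
    refine ⟨fun y => if HasLabelB β y.1 then 1 else 0, fun y => by dsimp only; split_ifs <;> norm_num,
      fun y => by dsimp only; split_ifs <;> norm_num, ?_⟩
    intro n' hn'
    have l1 : 1 - Φ n' e k a ≤ (T (liftB r g) b w)^[n']
        (fun y => if HasLabelB β y.1 then 1 else 0) (σ, e, k) := lower hl g b w hw β M Φ hicond' hsite' hO h0' n' hn' σ e k a (fun i => rfl)
    have l2 := pi_label (ℓ := ℓ) hq hl (liftB r g) b w hw hw2 β
    have l3 := ha n' hn' e k
    rw [It_eq hq hl _ _ _ hw]
    linarith)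
  refine target_intro (A := VT (Bits V r) q ℓ) n (gr (liftB r g) b) (wt w) ?_ c1
    (fun x => deg_le hq hl _ b x) (wt_symm w) ?_ ?_
  · refine hln.trans ?_
    have h1 : Fintype.card (ZMod ℓ) = ℓ := ZMod.card ℓ
    rw [Fintype.card_prod, Fintype.card_prod, h1]
    have p1 : 0 < Fintype.card (Bits V r → Bool) := Fintype.card_pos
    have p2 : 0 < Fintype.card (ZMod q) := Fintype.card_pos
    calc ℓ = 1 * (1 * ℓ) := by ring
      _ ≤ _ := Nat.mul_le_mul p1 (Nat.mul_le_mul p2 le_rfl)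
  · intro x y _
    unfold wt
    split_ifs
    · refine ⟨le_rfl, ?_⟩
      have : 0 ≤ 1 / ((n:ℝ) + 1) := by positivity
      linarith
    · exact ⟨hw _, hwn _⟩
  · have k2 : ((graphMix (gr (liftB r g) b : SimpleGraph (VT (Bits V r) q ℓ)) (fun _ _ => 1) : ℕ) : ℝ)
        ≤ ((N₂ + m : ℕ) : ℝ) := by
      exact Nat.cast_le.2 c2
    have k3 : ((M + 1 : ℕ) : ℝ) ≤ ((sInf {k : ℕ | ∃ x, k = graphMixFrom
        (gr (liftB r g) b : SimpleGraph (VT (Bits V r) q ℓ)) (wt w) x} : ℕ) : ℝ) := by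
      exact Nat.cast_le.2 c3
    have hp : 0 ≤ 1 / ((n:ℝ) + 1) := by positivity
    have := mul_le_mul_of_nonneg_left k3 hp
    have fin := (k2.trans hcomp).trans this
    exact fin

end Spec
end MBS

namespace MBS

section FromGood

lemma cf_pow_small {q ℓ : ℕ} [NeZero q] [NeZero ℓ] :
    2 * cf q ℓ ^ (⌈15 * QQ q ℓ⌉₊) ≤ 1/8 := by
  have hQ := QQ_ge (q := q) (ℓ := ℓ)
  have hQ0 : 0 < QQ q ℓ := by linarith
  have h1 : cf q ℓ ≤ Real.exp (-(1 / (5 * QQ q ℓ))) := by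
    have := Real.add_one_le_exp (-(1 / (5 * QQ q ℓ)))
    unfold cf; linarith
  have h0 : 0 ≤ cf q ℓ := by
    unfold cf
    have : 1 / (5 * QQ q ℓ) ≤ 1 := by
      rw [div_le_one (by positivity)]; linarith
    linarith
  have h2 : cf q ℓ ^ (⌈15 * QQ q ℓ⌉₊) ≤ Real.exp (-3) := by
    refine (pow_le_pow_left₀ h0 h1 _).trans ?_
    rw [← Real.exp_nat_mul]
    apply Real.exp_le_exp.2
    have h3 : 15 * QQ q ℓ ≤ (⌈15 * QQ q ℓ⌉₊ : ℝ) := Nat.le_ceil _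
    have h4 : 3 = 15 * QQ q ℓ * (1 / (5 * QQ q ℓ)) := by field_simp; norm_num
    have h5 := mul_le_mul_of_nonneg_right h3 (show 0 ≤ 1 / (5 * QQ q ℓ) by positivity)
    linarith
  have h6 : Real.exp (-3) ≤ 1/16 := by
    rw [Real.exp_neg, ← one_div]
    apply one_div_le_one_div_of_le (by norm_num)
    have e1 : Real.exp 3 = Real.exp 1 ^ 3 := by rw [← Real.exp_nat_mul]; norm_num
    have e2 := Real.exp_one_gt_d9
    rw [e1]
    have : (2.7:ℝ)^3 ≤ Real.exp 1 ^ 3 := pow_le_pow_left₀ (by norm_num) (by linarith) 3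
    refine le_trans ?_ this
    norm_num
  linarith

lemma frac_mem {ℓ : ℕ} [NeZero ℓ] (k : ZMod ℓ) : 0 ≤ (k.val : ℝ) / ℓ ∧ (k.val : ℝ) / ℓ ≤ 1 := by
  have hL : (0:ℝ) < ℓ := by exact_mod_cast NeZero.pos ℓ
  refine ⟨by positivity, ?_⟩
  rw [div_le_one hL]
  exact_mod_cast (ZMod.val_lt k).le

lemma comb_ge {t a b c : ℝ} (h0 : 0 ≤ t) (h1 : t ≤ 1) (ha : c ≤ a) (hb : c ≤ b) :
    c ≤ (1 - t) * a + t * b := by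
  have := mul_le_mul_of_nonneg_left ha (sub_nonneg.2 h1)
  have := mul_le_mul_of_nonneg_left hb h0
  linarith

lemma comb_le {t a b c : ℝ} (h0 : 0 ≤ t) (h1 : t ≤ 1) (ha : a ≤ c) (hb : b ≤ c) :
    (1 - t) * a + t * b ≤ c := by
  have := mul_le_mul_of_nonneg_left ha (sub_nonneg.2 h1)
  have := mul_le_mul_of_nonneg_left hb h0
  linarith

set_option maxHeartbeats 1000000 in
lemma from_good {V : Type} [Fintype V] {r q : ℕ} [NeZero q] (n : ℕ) (hq : 12 ≤ q)
    (g : ZMod q → Equiv.Perm V) (b : ZMod q → Bits V r)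
    (w : ZMod q → ℝ) (hw : ∀ e, 1 ≤ w e) (hwn : ∀ e, w e ≤ 1 + 1 / ((n:ℝ) + 1))
    (H1 : HData (Bits V r) q) (G1 : H1.Good) (H2 : HData V q) (G2 : H2.Good)
    (g1 : H1.g = liftB r g) (w1 : H1.w = fun _ => 1)
    (k1 : ∀ e x, H1.κ e x = if b e = x then 1 else 0)
    (g2 : H2.g = g) (w2 : H2.w = w) (k2 : ∀ e v, H2.κ e v = if (b e).1 = v then 1 else 0)
    (S1 : 0 ≤ H1.S) (S2 : 0 ≤ H2.S) (U1 : ∀ x, 2 ≤ H1.U 0 x)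
    (U1p : ∀ s x, 0 ≤ s → s ≤ H1.S → 0 ≤ H1.U s x)
    (U1e : ∑ x, H1.U H1.S x ≤ 1/64) (q1 : H1.K / (8 * q) ≤ 1/2)
    (q1' : (Fintype.card (Bits V r) : ℝ) * (H1.K / (8 * q)) ≤ 1/64)
    (q2 : H2.K / (8 * q) ≤ 1/16)
    (U2O : ∀ s e, 0 ≤ s → s ≤ H2.S → 9/8 ≤ H2.U s (b e).1) (U20 : ∀ v, 1/8 ≤ H2.U 0 v)
    (a : V) (U2a : ∀ s, 0 ≤ s → s ≤ H2.S → H2.U s a ≤ 3/8)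
    (U2a' : ∀ s e, 0 ≤ s → s ≤ H2.S → H2.U s (g e a) ≤ 3/8)
    (hcard : (Fintype.card V : ℝ) / 2 ^ r < 1/4)
    (hcomp : H1.S + 1 ≤ 1 / ((n:ℝ) + 1) * H2.S) : Target n := by
  subst g2 w2
  have hqr : (12:ℝ) ≤ q := by exact_mod_cast hq
  have X1 := G1.Kx_nonneg
  have X2 := G2.Kx_nonneg
  obtain ⟨L1, hL1⟩ := exists_nat_ge (17 * H1.Kx * q / H1.η)
  obtain ⟨L2, hL2⟩ := exists_nat_ge (17 * H2.Kx * q / H2.η)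
  obtain ⟨L3, hL3⟩ := exists_nat_ge (96 * (Fintype.card (Bits V r) : ℝ) * H1.Kx)
  obtain ⟨L4, hL4⟩ := exists_nat_ge (2 * H1.Kx)
  obtain ⟨L5, hL5⟩ := exists_nat_ge (16 * H2.Kx)
  set ℓ : ℕ := L1 + L2 + L3 + L4 + L5 + n + 3 + 2 * q ^ 2 with hℓd
  have hl3 : 3 ≤ ℓ := by omega
  haveI : NeZero ℓ := ⟨by omega⟩
  have hℓr : (ℓ : ℝ) = L1 + L2 + L3 + L4 + L5 + n + 3 + 2 * q ^ 2 := by rw [hℓd]; push_cast; ring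
  have p1 : (0:ℝ) ≤ L1 := Nat.cast_nonneg _
  have p2 : (0:ℝ) ≤ L2 := Nat.cast_nonneg _
  have p3 : (0:ℝ) ≤ L3 := Nat.cast_nonneg _
  have p4 : (0:ℝ) ≤ L4 := Nat.cast_nonneg _
  have p5 : (0:ℝ) ≤ L5 := Nat.cast_nonneg _
  have p6 : (0:ℝ) ≤ n := Nat.cast_nonneg _
  have p7 : (0:ℝ) ≤ 2 * (q:ℝ) ^ 2 := by positivity
  have hL : (0:ℝ) < ℓ := by rw [hℓr]; linarith
  have c1 : 17 * H1.Kx * q ≤ H1.η * ℓ := by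
    have : 17 * H1.Kx * q / H1.η ≤ ℓ := by linarith
    rw [div_le_iff₀ G1.η0] at this; linarith
  have c2 : 17 * H2.Kx * q ≤ H2.η * ℓ := by
    have : 17 * H2.Kx * q / H2.η ≤ ℓ := by linarith
    rw [div_le_iff₀ G2.η0] at this; linarith
  have c3 : (Fintype.card (Bits V r) : ℝ) * (H1.Kx / ℓ) ≤ 1/96 := by
    rw [← mul_div_assoc, div_le_iff₀ hL]; linarith
  have c4 : H1.Kx / ℓ ≤ 1/2 := by rw [div_le_iff₀ hL]; linarith
  have c5 : H2.Kx / ℓ ≤ 1/16 := by rw [div_le_iff₀ hL]; linarith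
  have hε : 0 < HData.eps q ℓ := HData.eps_pos (NeZero.pos ℓ)
  have hεm : HData.eps q ℓ * (ℓ : ℝ) ^ 2 = 1 / (4 * q) := HData.eps_mul (NeZero.pos ℓ)
  set ε := HData.eps q ℓ with hεd
  set N₂ : ℕ := ⌊H1.S / ε⌋₊ with hN
  set M : ℕ := ⌊H2.S / ε⌋₊ with hM
  set m : ℕ := ⌈15 * QQ q ℓ⌉₊ with hm
  have tN : ∀ j : ℕ, j ≤ N₂ → (j:ℝ) * ε ≤ H1.S := by
    intro j hj
    have h1 : (j:ℝ) ≤ N₂ := by exact_mod_cast hj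
    have h2 : (N₂:ℝ) ≤ H1.S / ε := Nat.floor_le (by positivity)
    rw [← le_div_iff₀ hε]; linarith
  have tM : ∀ j : ℕ, j ≤ M → (j:ℝ) * ε ≤ H2.S := by
    intro j hj
    have h1 : (j:ℝ) ≤ M := by exact_mod_cast hj
    have h2 : (M:ℝ) ≤ H2.S / ε := Nat.floor_le (by positivity)
    rw [← le_div_iff₀ hε]; linarith
  have t0 : ∀ j : ℕ, 0 ≤ (j:ℝ) * ε := fun j => by positivity
  have ts : ∀ j : ℕ, ((j+1 : ℕ):ℝ) * ε = j * ε + ε := fun j => by push_cast; ring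
  refine chain_target n (by omega) hl3 (by omega) H2.g b H2.w hw hwn N₂ m M cf_pow_small
    (fun j => H1.Phi ℓ (j * ε)) ?_ ?_ ?_ ?_ (fun j => H2.Phi ℓ (j * ε)) ?_ ?_ ?_ ?_ a ?_ hcard ?_
  · intro j hj
    have := G1.interior c1 (j * ε) (t0 j) (by rw [← ts]; exact tN _ hj)
    simp only [ts]
    rw [← g1]; exact this
  · intro j hj e x
    have := G1.site (by omega) c1 (j * ε) (t0 j) (by rw [← ts]; exact tN _ hj) e x
    simp only [ts]
    rw [g1, w1, k1] at this; exact this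
  · intro e k x
    have h1 := abs_le.1 (G1.approx (ℓ := ℓ) ((0:ℕ) * ε) (t0 0) (tN 0 (Nat.zero_le _)) e k x)
    have h2 := frac_mem k
    have z : ((0:ℕ):ℝ) * ε = 0 := by simp
    rw [z] at h1
    have h3 := comb_ge h2.1 h2.2 (U1 x) (U1 (H1.g e x))
    simp only [z]
    linarith [h1.1]
  · intro σ σ' e k
    have h2 := frac_mem k
    have hs := tN N₂ le_rfl
    have hs0 := t0 N₂
    set s := (N₂:ℝ) * ε with hsd
    have hSs : H1.S - s ≤ ε := by
      have := Nat.lt_floor_add_one (H1.S / ε)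
      rw [← hN, div_lt_iff₀ hε] at this
      linarith
    have hU : ∀ x, H1.U s x ≤ H1.U H1.S x + H1.Kx / ℓ := by
      intro x
      have h3 := abs_le.1 (G1.UL s H1.S x hs0 hs le_rfl)
      have h4 : H1.K * (H1.S - s) ≤ H1.Kx * (1 / ℓ) := by
        apply mul_le_mul G1.K_le_Kx.1 _ (by linarith) X1
        refine hSs.trans ?_
        rw [hεd]; unfold HData.eps
        apply one_div_le_one_div_of_le hL
        have l1 : (1:ℝ) ≤ ℓ := by linarith
        have : (ℓ:ℝ) * 1 ≤ ℓ * ℓ := mul_le_mul_of_nonneg_left l1 hL.le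
        have : 1 * ((ℓ:ℝ)^2) ≤ 4 * q * (ℓ:ℝ)^2 :=
          mul_le_mul_of_nonneg_right (by linarith) (by positivity)
        linarith [sq (ℓ:ℝ)]
      rw [mul_one_div] at h4
      linarith [h3.1]
    have hPhi : ∀ x, (if σ x ≠ σ' x then H1.Phi ℓ s e k x else 0) ≤
        H1.U s x + H1.U s (H1.g e x) + (H1.Kx / ℓ + H1.K / (8 * q)) := by
      intro x
      have u1 := U1p s x hs0 hs
      have u2 := U1p s (H1.g e x) hs0 hs
      have a1 := G1.K1
      have e1 : 0 ≤ H1.Kx / ℓ := by positivity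
      have e2 : 0 ≤ H1.K / (8 * q) := by positivity
      split_ifs
      · have h1 := abs_le.1 (G1.approx (ℓ := ℓ) s hs0 hs e k x)
        have h3 : (1 - (k.val : ℝ) / ℓ) * H1.U s x ≤ 1 * H1.U s x :=
          mul_le_mul_of_nonneg_right (by linarith) u1
        have h4 : (k.val : ℝ) / ℓ * H1.U s (H1.g e x) ≤ 1 * H1.U s (H1.g e x) :=
          mul_le_mul_of_nonneg_right h2.2 u2
        linarith [h1.2]
      · linarith
    unfold Dsum
    refine (Finset.sum_le_sum fun x _ => hPhi x).trans ?_
    rw [Finset.sum_add_distrib, Finset.sum_add_distrib, Equiv.sum_comp (H1.g e) (fun x => H1.U s x)]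
    have hsum := Finset.sum_le_sum fun (x : Bits V r) (_ : x ∈ univ) => hU x
    rw [Finset.sum_add_distrib] at hsum
    simp only [Finset.sum_const, Finset.card_univ, nsmul_eq_mul] at hsum ⊢
    rw [mul_add]
    linarith
  · intro j hj
    have := G2.interior c2 (j * ε) (t0 j) (by rw [← ts]; exact tM _ hj)
    simp only [ts]; exact this
  · intro j hj e v hv
    have := G2.site (by omega) c2 (j * ε) (t0 j) (by rw [← ts]; exact tM _ hj) e v
    simp only [ts]
    rw [k2, if_neg (hv e)] at this
    linarith
  · intro j hj e v hv
    obtain ⟨e', rfl⟩ := hv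
    have h1 := abs_le.1 (G2.approx (ℓ := ℓ) (j * ε) (t0 j) (tM j hj) e 0 (b e').1)
    have h2 := U2O (j * ε) e' (t0 j) (tM j hj)
    simp only [ZMod.val_zero, Nat.cast_zero, zero_div, sub_zero, one_mul, zero_mul, add_zero] at h1
    linarith [h1.1]
  · intro e k v
    have h1 := abs_le.1 (G2.approx (ℓ := ℓ) ((0:ℕ) * ε) (t0 0) (tM 0 (Nat.zero_le _)) e k v)
    have h2 := frac_mem k
    have z : ((0:ℕ):ℝ) * ε = 0 := by simp
    rw [z] at h1
    have h3 := comb_ge h2.1 h2.2 (U20 v) (U20 (H2.g e v))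
    simp only [z]
    linarith [h1.1]
  · intro j hj e k
    have h1 := abs_le.1 (G2.approx (ℓ := ℓ) (j * ε) (t0 j) (tM j hj) e k a)
    have h2 := frac_mem k
    have h3 := comb_le h2.1 h2.2 (U2a (j * ε) (t0 j) (tM j hj)) (U2a' (j * ε) e (t0 j) (tM j hj))
    linarith [h1.2]
  · have a1 : (N₂ : ℝ) ≤ H1.S / ε := Nat.floor_le (by positivity)
    have a2 : H2.S / ε ≤ (M : ℝ) + 1 := (Nat.lt_floor_add_one _).le
    have hQ := QQ_ge (q := q) (ℓ := ℓ)
    have a3 : (m : ℝ) ≤ 15 * QQ q ℓ + 1 := (Nat.ceil_lt_add_one (by linarith)).le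
    have a4 : QQ q ℓ ≤ 3 * (ℓ:ℝ)^2 := by
      unfold QQ MM
      have b1 : ((ℓ:ℝ) + 2) * q ^ 2 ≤ (2 * ℓ) * q ^ 2 :=
        mul_le_mul_of_nonneg_right (by linarith) (by positivity)
      have b2 : (ℓ:ℝ) * (2 * q^2) ≤ ℓ * ℓ := mul_le_mul_of_nonneg_left (by linarith) hL.le
      linarith [sq (ℓ:ℝ)]
    have a5 : (m:ℝ) ≤ 46 * (ℓ:ℝ)^2 := by
      have l1 : (1:ℝ) ≤ ℓ := by linarith
      have : (1:ℝ)^2 ≤ (ℓ:ℝ)^2 := pow_le_pow_left₀ (by norm_num) l1 2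
      linarith
    have a6 : (m:ℝ) ≤ 1 / ε := by
      rw [le_div_iff₀ hε]
      have := mul_le_mul_of_nonneg_right a5 hε.le
      have h3 : 1 / (4 * (q:ℝ)) ≤ 1/48 := by
        apply one_div_le_one_div_of_le <;> linarith
      linarith
    push_cast
    have h7 := div_le_div_of_nonneg_right hcomp hε.le
    have h8 := mul_le_mul_of_nonneg_left a2 (show 0 ≤ 1 / ((n:ℝ) + 1) by positivity)
    rw [add_div, mul_div_assoc] at h7
    linarith

end FromGood
end MBS

namespace MBS

section MkGood

variable {V : Type} [Fintype V] {r q : ℕ} [NeZero q]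

/-- the exponential profile -/
noncomputable def UU (α β : V → ℝ) (s : ℝ) (v : V) : ℝ := Real.exp (α v - β v * s)

lemma UU_pos (α β : V → ℝ) (s : ℝ) (v : V) : 0 < UU α β s v := Real.exp_pos _

lemma UU_tangent (α β : V → ℝ) (s t : ℝ) (v : V) :
    (t - s) * (-β v * UU α β s v) ≤ UU α β t v - UU α β s v := by
  have h1 : UU α β t v = UU α β s v * Real.exp (-β v * (t - s)) := by
    unfold UU; rw [← Real.exp_add]; congr 1; ring
  have h2 := Real.add_one_le_exp (-β v * (t - s))
  have h3 := mul_le_mul_of_nonneg_left h2 (UU_pos α β s v).le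
  rw [h1]; linarith

lemma UU_lip (α β : V → ℝ) (s t : ℝ) (v : V) (hst : s ≤ t) (L : ℝ)
    (hs : |β v| * UU α β s v ≤ L) (ht : |β v| * UU α β t v ≤ L) :
    |UU α β t v - UU α β s v| ≤ L * (t - s) := by
  have h1 := UU_tangent α β s t v
  have h2 := UU_tangent α β t s v
  have a1 : -β v * UU α β s v ≥ -L := by
    have := mul_le_mul_of_nonneg_right (le_abs_self (β v)) (UU_pos α β s v).le
    linarith
  have a2 : -β v * UU α β t v ≤ L := by
    have := mul_le_mul_of_nonneg_right (neg_le_abs (β v)) (UU_pos α β t v).le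
    linarith
  have b1 := mul_le_mul_of_nonneg_left a1 (sub_nonneg.2 hst)
  have b2 := mul_le_mul_of_nonneg_left a2 (sub_nonneg.2 hst)
  rw [abs_le]; constructor <;> linarith

lemma abs_min_sub_min (a b c d L : ℝ) (h1 : |a - c| ≤ L) (h2 : |b - d| ≤ L) :
    |min a b - min c d| ≤ L := by
  rw [abs_le] at *
  constructor
  · have : min c d - L ≤ min a b := le_min (by linarith [min_le_left c d]) (by linarith [min_le_right c d])
    linarith
  · have : min a b - L ≤ min c d := le_min (by linarith [min_le_left a b]) (by linarith [min_le_right a b])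
    linarith

/-- derivative -/
noncomputable def DD (α β : V → ℝ) (s : ℝ) (v : V) : ℝ := -β v * UU α β s v

/-- upper data -/
noncomputable def HU (r : ℕ) (g : ZMod q → Equiv.Perm V) (b : ZMod q → Bits V r) (α β : V → ℝ)
    (S K η : ℝ) : HData (Bits V r) q where
  g := liftB r g
  w := fun _ => 1
  κ := fun e x => if b e = x then 1 else 0
  U := fun s x => UU α β s x.1
  d := fun s e x => min (DD α β s x.1) (DD α β s (g e x.1)) - 2 * η
  C := 5 * K * q + η
  K := K
  η := η
  S := S

/-- lower data -/
noncomputable def HL (g : ZMod q → Equiv.Perm V) (b : ZMod q → Bits V r) (w : ZMod q → ℝ)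
    (h : V → ℝ) (c S K η : ℝ) : HData V q where
  g := g
  w := w
  κ := fun e v => if (b e).1 = v then 1 else 0
  U := fun s v => h v + 1/8 + c * s
  d := fun _ _ _ => c - 2 * η
  C := 12 * K * q + η
  K := K
  η := η
  S := S

lemma sum_ite_ge {X : Type} (C : ℝ) (hC : 0 ≤ C) (b : ZMod q → X) (x : X) (hx : ∃ e, b e = x) :
    C ≤ ∑ e, C * (if b e = x then (1:ℝ) else 0) := by
  obtain ⟨e, he⟩ := hx
  have := Finset.single_le_sum (f := fun e => C * (if b e = x then (1:ℝ) else 0))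
    (fun e _ => by split_ifs <;> simp [hC]) (Finset.mem_univ e)
  simpa [he] using this

set_option maxHeartbeats 1000000 in
lemma good_upper (g : ZMod q → Equiv.Perm V) (hg : ∀ e, (g e).symm = g e) (b : ZMod q → Bits V r)
    (O : V → Prop) (hb : ∀ e, O (b e).1) (hbs : ∀ x : Bits V r, O x.1 → ∃ e, b e = x)
    (α β : V → ℝ) (S K η : ℝ) (hη : 0 < η) (hη1 : η ≤ 1) (hq : 2 ≤ q) (hK : K ≤ η * q)
    (K1 : ∀ s v, 0 ≤ s → s ≤ S → UU α β s v ≤ K)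
    (K2 : ∀ s v, 0 ≤ s → s ≤ S → |β v| * UU α β s v + 2 ≤ K)
    (K3 : ∀ s v, 0 ≤ s → s ≤ S → |β v| * (|β v| * UU α β s v) ≤ K) (K0 : 0 ≤ K)
    (hlo : ∀ s v, 0 ≤ s → s ≤ S → η ≤ UU α β s v)
    (up : ∀ s v, 0 ≤ s → s ≤ S → ¬ O v → ∀ v', (v' = v ∨ ∃ e, v' = g e v) →
      ∑ e, 2 * (UU α β s (g e v) - UU α β s v) ≤ DD α β s v' - 3 * η) :
    (HU r g b α β S K η).Good := by
  have hqr : (2:ℝ) ≤ q := by exact_mod_cast hq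
  have hq0 : (0:ℝ) < q := by linarith
  have absD : ∀ s v, |DD α β s v| = |β v| * UU α β s v := by
    intro s v; unfold DD; rw [abs_mul, abs_neg, abs_of_pos (UU_pos α β s v)]
  have gg : ∀ e v, g e (g e v) = v := by
    intro e v
    have := (g e).symm_apply_apply v
    rwa [hg e] at this
  have symmL : ∀ e (x : Bits V r), ((liftB r g e).symm x).1 = g e x.1 := by
    intro e x
    have : ((liftB r g e).symm x).1 = (g e).symm x.1 := rfl
    rw [this, hg]
  have appL : ∀ e (x : Bits V r), (liftB r g e x).1 = g e x.1 := fun e x => rfl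
  have DL : ∀ s t v, 0 ≤ s → s ≤ t → t ≤ S → |DD α β t v - DD α β s v| ≤ K * (t - s) := by
    intro s t v h0 hst ht
    have l := UU_lip α β s t v hst (max (|β v| * UU α β s v) (|β v| * UU α β t v))
      (le_max_left _ _) (le_max_right _ _)
    have e : DD α β t v - DD α β s v = (-β v) * (UU α β t v - UU α β s v) := by unfold DD; ring
    rw [e, abs_mul, abs_neg]
    refine (mul_le_mul_of_nonneg_left l (abs_nonneg _)).trans ?_
    rw [← mul_assoc]
    apply mul_le_mul_of_nonneg_right _ (sub_nonneg.2 hst)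
    rcases max_choice (|β v| * UU α β s v) (|β v| * UU α β t v) with h | h <;> rw [h]
    · exact K3 s v h0 (hst.trans ht)
    · exact K3 t v (h0.trans hst) ht
  have fE : ∀ s e x, (HU r g b α β S K η).f s e x = 2 * (UU α β s (g e x.1) - UU α β s x.1)
      - (min (DD α β s x.1) (DD α β s (g e x.1)) - 2 * η) / q
      - (5 * K * q + η) * (if b e = x then (1:ℝ) else 0) := by
    intro s e x
    unfold HData.f HU
    simp only [symmL, appL, gg]
    rw [min_comm (DD α β s (g e x.1)) (DD α β s x.1)]
    field_simp
    ring
  refine ⟨fun _ => le_rfl, fun _ => one_le_two, ?_, ?_, K0, hη, hq, hK, ?_, ?_, ?_, ?_, ?_, ?_, ?_, ?_⟩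
  · intro e x
    by_cases h : b e = x
    · right; exact if_pos h
    · left; exact if_neg h
  · change 0 ≤ 5 * K * q + η; positivity
  · intro s x h0 h1
    change |UU α β s x.1| ≤ K
    rw [abs_of_pos (UU_pos _ _ _ _)]; exact K1 s x.1 h0 h1
  · intro s e x h0 h1
    change |min (DD α β s x.1) (DD α β s (g e x.1)) - 2 * η| ≤ K
    have a1 := K2 s x.1 h0 h1
    have a2 := K2 s (g e x.1) h0 h1
    rw [← absD] at a1 a2
    have m : |min (DD α β s x.1) (DD α β s (g e x.1)) - min 0 0| ≤ K - 2 :=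
      abs_min_sub_min _ _ _ _ _ (by rw [sub_zero]; linarith) (by rw [sub_zero]; linarith)
    rw [min_self, sub_zero] at m
    rw [abs_le] at m ⊢
    constructor <;> linarith [m.1, m.2]
  · intro s t x h0 hst h1
    change |UU α β t x.1 - UU α β s x.1| ≤ K * (t - s)
    exact UU_lip α β s t x.1 hst K (by linarith [K2 s x.1 h0 (hst.trans h1)])
      (by linarith [K2 t x.1 (h0.trans hst) h1])
  · intro s t e x h0 hst h1
    change |min (DD α β t x.1) (DD α β t (g e x.1)) - 2 * η -
      (min (DD α β s x.1) (DD α β s (g e x.1)) - 2 * η)| ≤ K * (t - s)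
    rw [sub_sub_sub_cancel_right]
    exact abs_min_sub_min _ _ _ _ _ (DL s t _ h0 hst h1) (DL s t _ h0 hst h1)
  · intro s t e x h0 hst h1
    change (t - s) * (min (DD α β s x.1) (DD α β s (g e x.1)) - 2 * η + η) ≤
      UU α β t x.1 - UU α β s x.1
    refine le_trans ?_ (UU_tangent α β s t x.1)
    apply mul_le_mul_of_nonneg_left _ (sub_nonneg.2 hst)
    have := min_le_left (DD α β s x.1) (DD α β s (g e x.1))
    have e1 : DD α β s x.1 = -β x.1 * UU α β s x.1 := rfl
    linarith
  · intro s t e x h0 hst h1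
    change (t - s) * (min (DD α β s x.1) (DD α β s (g e x.1)) - 2 * η + η) ≤
      UU α β t (g e x.1) - UU α β s (g e x.1)
    refine le_trans ?_ (UU_tangent α β s t (g e x.1))
    apply mul_le_mul_of_nonneg_left _ (sub_nonneg.2 hst)
    have := min_le_right (DD α β s x.1) (DD α β s (g e x.1))
    have e1 : DD α β s (g e x.1) = -β (g e x.1) * UU α β s (g e x.1) := rfl
    linarith
  · intro s x h0 h1
    change ∑ e, (HU r g b α β S K η).f s e x ≤ - η
    simp only [fE]
    rw [Finset.sum_sub_distrib, Finset.sum_sub_distrib, ← Finset.sum_div]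
    have cardq : (Finset.univ : Finset (ZMod q)).card = q := by
      rw [Finset.card_univ, ZMod.card]
    by_cases hO : O x.1
    · have c := sum_ite_ge (5 * K * q + η) (by positivity) b x (hbs x hO)
      have b1 : ∑ e : ZMod q, 2 * (UU α β s (g e x.1) - UU α β s x.1) ≤ ∑ e : ZMod q, 2 * K := by
        apply Finset.sum_le_sum
        intro e _
        have := K1 s (g e x.1) h0 h1
        have := UU_pos α β s x.1
        linarith
      have b2 : ∑ e : ZMod q, (-K) ≤
          ∑ e : ZMod q, (min (DD α β s x.1) (DD α β s (g e x.1)) - 2 * η) := by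
        apply Finset.sum_le_sum
        intro e _
        have a1 := K2 s x.1 h0 h1
        have a2 := K2 s (g e x.1) h0 h1
        rw [← absD] at a1 a2
        have := neg_abs_le (DD α β s x.1)
        have := neg_abs_le (DD α β s (g e x.1))
        have : -(K - 2) ≤ min (DD α β s x.1) (DD α β s (g e x.1)) := le_min (by linarith) (by linarith)
        linarith
      rw [Finset.sum_const, cardq, nsmul_eq_mul] at b1 b2
      have b3 := div_le_div_of_nonneg_right b2 hq0.le
      rw [mul_div_cancel_left₀ _ hq0.ne'] at b3
      have : K * 1 ≤ K * q := mul_le_mul_of_nonneg_left (by linarith) K0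
      linarith
    · have c : ∑ e : ZMod q, (5 * K * q + η) * (if b e = x then (1:ℝ) else 0) = 0 := by
        apply Finset.sum_eq_zero
        intro e _
        rw [if_neg, mul_zero]
        rintro rfl; exact hO (hb e)
      rw [c]
      set A := ∑ e : ZMod q, 2 * (UU α β s (g e x.1) - UU α β s x.1) with hA
      have b2 : ∑ e : ZMod q, (A + η) ≤
          ∑ e : ZMod q, (min (DD α β s x.1) (DD α β s (g e x.1)) - 2 * η) := by
        apply Finset.sum_le_sum
        intro e _
        have u1 := up s x.1 h0 h1 hO x.1 (Or.inl rfl)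
        have u2 := up s x.1 h0 h1 hO (g e x.1) (Or.inr ⟨e, rfl⟩)
        rw [← hA] at u1 u2
        have : A + 3 * η ≤ min (DD α β s x.1) (DD α β s (g e x.1)) := le_min (by linarith) (by linarith)
        linarith
      rw [Finset.sum_const, cardq, nsmul_eq_mul] at b2
      have b3 := div_le_div_of_nonneg_right b2 hq0.le
      rw [mul_div_cancel_left₀ _ hq0.ne'] at b3
      linarith
  · intro s e x h0 h1 _
    exact hlo s x.1 h0 h1

set_option maxHeartbeats 1000000 in
lemma good_lower (g : ZMod q → Equiv.Perm V) (hg : ∀ e, (g e).symm = g e) (b : ZMod q → Bits V r)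
    (O : V → Prop) (hb : ∀ e, O (b e).1) (hbs : ∀ v, O v → ∃ e, (b e).1 = v)
    (w : ZMod q → ℝ) (w1 : ∀ e, 1 ≤ w e) (w2 : ∀ e, w e ≤ 2)
    (h : V → ℝ) (hh : ∀ v, 0 ≤ h v) (hh1 : ∀ v, O v → 1 ≤ h v)
    (c S K η : ℝ) (hc : 0 < c) (hS : c * S ≤ 1/8) (hη : 0 < η) (hη1 : η ≤ 1) (hηc : 2 * η ≤ c)
    (hq : 2 ≤ q) (hK : K ≤ η * q)
    (K1 : ∀ v, h v + 1 ≤ K) (K2 : c ≤ K) 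
    (lo : ∀ v, ¬ O v → ∑ e, 2 * w e * (h (g e v) - h v) ≤ c - 3 * η) :
    (HL g b w h c S K η).Good := by
  have hqr : (2:ℝ) ≤ q := by exact_mod_cast hq
  have hq0 : (0:ℝ) < q := by linarith
  have K0 : 0 ≤ K := by linarith
  have fE : ∀ s e x, (HL g b w h c S K η).f s e x = 2 * w e * (h (g e x) - h x)
      - (w e * (c - 2 * η)) / q
      - (12 * K * q + η) * (if (b e).1 = x then (1:ℝ) else 0) := by
    intro s e x
    unfold HData.f HL
    simp only [hg]
    field_simp
    ring
  have nn : 0 ≤ c - 2 * η := by linarith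
  refine ⟨w1, w2, ?_, ?_, K0, hη, hq, hK, ?_, ?_, ?_, ?_, ?_, ?_, ?_, ?_⟩
  · intro e x
    by_cases h : (b e).1 = x
    · right; exact if_pos h
    · left; exact if_neg h
  · change 0 ≤ 12 * K * q + η; positivity
  · intro s x h0 h1
    change |h x + 1/8 + c * s| ≤ K
    have := hh x
    have := K1 x
    have : 0 ≤ c * s := by positivity
    have : c * s ≤ c * S := mul_le_mul_of_nonneg_left h1 hc.le
    rw [abs_of_nonneg (by linarith)]; linarith
  · intro s e x h0 h1
    change |c - 2 * η| ≤ K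
    rw [abs_of_nonneg nn]; linarith
  · intro s t x h0 hst h1
    change |h x + 1/8 + c * t - (h x + 1/8 + c * s)| ≤ K * (t - s)
    have e : h x + 1/8 + c * t - (h x + 1/8 + c * s) = c * (t - s) := by ring
    have : 0 ≤ t - s := by linarith
    rw [e, abs_of_nonneg (by positivity)]
    exact mul_le_mul_of_nonneg_right K2 this
  · intro s t e x h0 hst h1
    change |c - 2 * η - (c - 2 * η)| ≤ K * (t - s)
    have : 0 ≤ t - s := by linarith
    rw [sub_self, abs_zero]; positivity
  · intro s t e x h0 hst h1
    change (t - s) * (c - 2 * η + η) ≤ h x + 1/8 + c * t - (h x + 1/8 + c * s)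
    have : 0 ≤ (t - s) * η := mul_nonneg (by linarith) hη.le
    linarith
  · intro s t e x h0 hst h1
    change (t - s) * (c - 2 * η + η) ≤ h (g e x) + 1/8 + c * t - (h (g e x) + 1/8 + c * s)
    have : 0 ≤ (t - s) * η := mul_nonneg (by linarith) hη.le
    linarith
  · intro s x h0 h1
    change ∑ e, (HL g b w h c S K η).f s e x ≤ - η
    simp only [fE]
    rw [Finset.sum_sub_distrib, Finset.sum_sub_distrib, ← Finset.sum_div]
    have cardq : (Finset.univ : Finset (ZMod q)).card = q := by
      rw [Finset.card_univ, ZMod.card]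
    have b2 : ∑ e : ZMod q, (c - 2 * η) ≤ ∑ e : ZMod q, w e * (c - 2 * η) := by
      apply Finset.sum_le_sum
      intro e _
      have := mul_le_mul_of_nonneg_right (w1 e) nn
      linarith
    rw [Finset.sum_const, cardq, nsmul_eq_mul] at b2
    have b3 := div_le_div_of_nonneg_right b2 hq0.le
    rw [mul_div_cancel_left₀ _ hq0.ne'] at b3
    by_cases hO : O x
    · have c := sum_ite_ge (12 * K * q + η) (by positivity) (fun e => (b e).1) x (hbs x hO)
      have b1 : ∑ e : ZMod q, 2 * w e * (h (g e x) - h x) ≤ ∑ e : ZMod q, 4 * K := by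
        apply Finset.sum_le_sum
        intro e _
        have k1 := K1 (g e x)
        have k2 := hh x
        have k3 := w1 e
        have k4 := w2 e
        have l1 : 2 * w e * (h (g e x) - h x) ≤ 2 * w e * K :=
          mul_le_mul_of_nonneg_left (by linarith) (by linarith)
        have l2 : w e * K ≤ 2 * K := mul_le_mul_of_nonneg_right k4 K0
        linarith
      rw [Finset.sum_const, cardq, nsmul_eq_mul] at b1
      have : 0 ≤ K * q := by positivity
      linarith
    · have c : ∑ e : ZMod q, (12 * K * q + η) * (if (b e).1 = x then (1:ℝ) else 0) = 0 := by
        apply Finset.sum_eq_zero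
        intro e _
        rw [if_neg, mul_zero]
        rintro rfl; exact hO (hb e)
      rw [c]
      have := lo x hO
      linarith
  · intro s e x h0 h1 hk
    change (if (b e).1 = x then (1:ℝ) else 0) = 1 at hk
    change η ≤ h x + 1/8 + c * s
    have : (b e).1 = x := by
      by_contra hne
      rw [if_neg hne] at hk; norm_num at hk
    have h3 := hh1 x (this ▸ hb e)
    have : 0 ≤ c * s := by positivity
    linarith

end MkGood
end MBS

namespace MBS

section FromData

lemma sum_extend {E : Type} [Fintype E] {Z A : Type} [Fintype Z] (ι : E ↪ Z) (f : E → A) (a0 : A)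
    (F : A → ℝ) (hF : F a0 = 0) :
    ∑ z, F (Function.extend ι f (fun _ => a0) z) = ∑ e, F (f e) := by
  have e1 : ∑ e, F (f e) = ∑ z ∈ univ.map ι, F (Function.extend ι f (fun _ => a0) z) := by
    rw [Finset.sum_map]
    apply Finset.sum_congr rfl
    intro e _
    rw [ι.injective.extend_apply]
  rw [e1]
  symm
  apply Finset.sum_subset (Finset.subset_univ _)
  intro z _ hz
  rw [Function.extend_apply', hF]
  rintro ⟨e, rfl⟩
  exact hz (Finset.mem_map_of_mem _ (Finset.mem_univ e))

lemma extend_cases {E Z A : Type} (ι : E ↪ Z) (f : E → A) (a0 : A) (z : Z) :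
    Function.extend ι f (fun _ => a0) z = a0 ∨ ∃ e, Function.extend ι f (fun _ => a0) z = f e := by
  by_cases h : ∃ e, ι e = z
  · obtain ⟨e, rfl⟩ := h
    right; exact ⟨e, ι.injective.extend_apply _ _ _⟩
  · left; exact Function.extend_apply' _ _ _ h

lemma UU_cont {V : Type} (α β : V → ℝ) (v : V) : Continuous fun s => UU α β s v := by
  unfold UU; fun_prop

lemma DD_cont {V : Type} (α β : V → ℝ) (v : V) : Continuous fun s => DD α β s v := by
  unfold DD; exact continuous_const.mul (UU_cont α β v)

/-- strict inequality on a compact interval gives a uniform gap -/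
lemma gap_of_lt (f : ℝ → ℝ) (hf : Continuous f) (S : ℝ) (h : ∀ s, 0 ≤ s → s ≤ S → 0 < f s) :
    ∀ᶠ η in nhdsWithin (0:ℝ) (Set.Ioi 0), ∀ s, 0 ≤ s → s ≤ S → 3 * η ≤ f s := by
  by_cases hS : 0 ≤ S
  · obtain ⟨x, hx, hmin⟩ := isCompact_Icc.exists_isMinOn (Set.nonempty_Icc.2 hS) hf.continuousOn
    have hp := h x hx.1 hx.2
    have : ∀ᶠ η in nhdsWithin (0:ℝ) (Set.Ioi 0), η < f x / 3 :=
      (eventually_lt_nhds (by positivity)).filter_mono nhdsWithin_le_nhds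
    filter_upwards [this] with η hη s h0 h1
    have := hmin (show s ∈ Set.Icc 0 S from ⟨h0, h1⟩)
    simp only [Set.mem_setOf_eq] at this
    linarith
  · exact Eventually.of_forall fun η s h0 h1 => absurd (h0.trans h1) hS

lemma bdd_of_cont (f : ℝ → ℝ) (hf : Continuous f) (S : ℝ) :
    ∀ᶠ K in atTop, ∀ s, 0 ≤ s → s ≤ S → f s ≤ K := by
  obtain ⟨B, hB⟩ := (isCompact_Icc (a := (0:ℝ)) (b := S)).bddAbove_image hf.continuousOn
  filter_upwards [eventually_ge_atTop B] with K hK s h0 h1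
  exact (hB ⟨s, ⟨h0, h1⟩, rfl⟩).trans hK

set_option maxHeartbeats 1000000 in
lemma from_data (n : ℕ) {V E : Type} [Fintype V] [Fintype E] (ge : E → Equiv.Perm V)
    (hge : ∀ e, (ge e).symm = ge e) (ω : E → ℝ) (hω : ∀ e, 1 ≤ ω e)
    (hωn : ∀ e, ω e ≤ 1 + 1 / ((n:ℝ) + 1)) (O : V → Prop) (hO : ∃ v, O v) (r : ℕ) (hr : 0 < r)
    (α β : V → ℝ) (S : ℝ) (hS : 0 ≤ S)
    (up : ∀ s v, 0 ≤ s → s ≤ S → ¬ O v → ∀ v', (v' = v ∨ ∃ e, v' = ge e v) →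
      ∑ e, 2 * (UU α β s (ge e v) - UU α β s v) < DD α β s v')
    (U0 : ∀ v, 2 ≤ UU α β 0 v) (UE : r * ∑ v, UU α β S v ≤ 1/64)
    (h : V → ℝ) (hh : ∀ v, 0 ≤ h v) (hh1 : ∀ v, O v → 1 ≤ h v) (c : ℝ) (hc : 0 < c)
    (lo : ∀ v, ¬ O v → ∑ e, 2 * ω e * (h (ge e v) - h v) < c)
    (a : V) (ha : h a ≤ 1/8) (ha' : ∀ e, h (ge e a) ≤ 1/8)
    (hcard : (Fintype.card V : ℝ) / 2 ^ r < 1/4)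
    (hcomp : 8 * c * (S + 1) ≤ 1 / ((n:ℝ) + 1)) : Target n := by
  -- choose η
  have ev1 : ∀ v, ∀ᶠ η in nhdsWithin (0:ℝ) (Set.Ioi 0), ∀ s, 0 ≤ s → s ≤ S → 3 * η ≤ UU α β s v :=
    fun v => gap_of_lt _ (UU_cont α β v) S fun s _ _ => UU_pos α β s v
  have ev2 : ∀ v v', ∀ᶠ η in nhdsWithin (0:ℝ) (Set.Ioi 0), (¬ O v ∧ (v' = v ∨ ∃ e, v' = ge e v)) →
      ∀ s, 0 ≤ s → s ≤ S → 3 * η ≤ DD α β s v' - ∑ e, 2 * (UU α β s (ge e v) - UU α β s v) := by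
    intro v v'
    by_cases hv : ¬ O v ∧ (v' = v ∨ ∃ e, v' = ge e v)
    · have := gap_of_lt (fun s => DD α β s v' - ∑ e, 2 * (UU α β s (ge e v) - UU α β s v))
        ((DD_cont α β v').sub (continuous_finsetSum _ fun e _ =>
          continuous_const.mul ((UU_cont α β _).sub (UU_cont α β _)))) S
        (fun s h0 h1 => by
          have := up s v h0 h1 hv.1 v' hv.2
          linarith)
      filter_upwards [this] with η hη _ using hη
    · exact Eventually.of_forall fun η h => absurd h hv
  have ev3 : ∀ v, ∀ᶠ η in nhdsWithin (0:ℝ) (Set.Ioi 0), ¬ O v →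
      3 * η ≤ c - ∑ e, 2 * ω e * (h (ge e v) - h v) := by
    intro v
    by_cases hv : O v
    · exact Eventually.of_forall fun η h => absurd hv h
    · have := gap_of_lt (fun _ => c - ∑ e, 2 * ω e * (h (ge e v) - h v)) continuous_const 0
        (fun s h0 h1 => by have := lo v hv; linarith)
      filter_upwards [this] with η hη _ using hη 0 le_rfl le_rfl
  have ev4 := gap_of_lt (fun _ => c) continuous_const 0 (fun s _ _ => hc)
  have ev5 := gap_of_lt (fun _ => 1) continuous_const 0 (fun s _ _ => one_pos)
  have ev6 : ∀ᶠ η in nhdsWithin (0:ℝ) (Set.Ioi 0), (0:ℝ) < η := eventually_mem_nhdsWithin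
  have ev2' : ∀ᶠ η in nhdsWithin (0:ℝ) (Set.Ioi 0), ∀ v v', (¬ O v ∧ (v' = v ∨ ∃ e, v' = ge e v)) →
      ∀ s, 0 ≤ s → s ≤ S → 3 * η ≤ DD α β s v' - ∑ e, 2 * (UU α β s (ge e v) - UU α β s v) :=
    eventually_all.2 fun v => eventually_all.2 fun v' => ev2 v v'
  obtain ⟨η, η1, η2, η3, η4, η5, hη⟩ := ((eventually_all.2 ev1).and (ev2'.and
    ((eventually_all.2 ev3).and (ev4.and (ev5.and ev6))))).exists
  have η4' := η4 0 le_rfl le_rfl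
  have η5' := η5 0 le_rfl le_rfl
  -- choose K
  have f1 : ∀ v, ∀ᶠ K in atTop, ∀ s, 0 ≤ s → s ≤ S → UU α β s v ≤ K :=
    fun v => bdd_of_cont _ (UU_cont α β v) S
  have f2 : ∀ v, ∀ᶠ K in atTop, ∀ s, 0 ≤ s → s ≤ S → |β v| * UU α β s v + 2 ≤ K :=
    fun v => bdd_of_cont _ ((continuous_const.mul (UU_cont α β v)).add continuous_const) S
  have f3 : ∀ v, ∀ᶠ K in atTop, ∀ s, 0 ≤ s → s ≤ S → |β v| * (|β v| * UU α β s v) ≤ K :=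
    fun v => bdd_of_cont _ (continuous_const.mul (continuous_const.mul (UU_cont α β v))) S
  have f4 : ∀ v, ∀ᶠ K : ℝ in atTop, h v + 1 ≤ K := fun v => eventually_ge_atTop _
  obtain ⟨K, K1, K2, K3, K4, K5, K0⟩ := ((eventually_all.2 f1).and ((eventually_all.2 f2).and
    ((eventually_all.2 f3).and ((eventually_all.2 f4).and ((eventually_ge_atTop c).and
      (eventually_ge_atTop (0:ℝ))))))).exists
  -- choose q
  obtain ⟨q1, hq1⟩ := exists_nat_ge (K / η)
  obtain ⟨q2, hq2⟩ := exists_nat_ge (8 * (Fintype.card (Bits V r) : ℝ) * K)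
  obtain ⟨q3, hq3⟩ := exists_nat_ge (2 * K)
  set q : ℕ := q1 + q2 + q3 + 12 + Fintype.card E + Fintype.card (Bits V r) with hqd
  haveI : NeZero q := ⟨by omega⟩
  have hqr : (q:ℝ) = q1 + q2 + q3 + 12 + Fintype.card E + Fintype.card (Bits V r) := by
    rw [hqd]; push_cast; ring
  have z1 : (0:ℝ) ≤ q1 := Nat.cast_nonneg _
  have z2 : (0:ℝ) ≤ q2 := Nat.cast_nonneg _
  have z3 : (0:ℝ) ≤ q3 := Nat.cast_nonneg _
  have z4 : (0:ℝ) ≤ (Fintype.card E : ℝ) := Nat.cast_nonneg _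
  have z5 : (0:ℝ) ≤ (Fintype.card (Bits V r) : ℝ) := Nat.cast_nonneg _
  have hq12 : 12 ≤ q := by omega
  have hq0 : (0:ℝ) < q := by linarith
  have Kq : K ≤ η * q := by
    have : K / η ≤ q := by linarith
    rw [div_le_iff₀ hη] at this; linarith
  obtain ⟨ι⟩ : Nonempty (E ↪ ZMod q) :=
    Function.Embedding.nonempty_of_card_le (by rw [ZMod.card]; omega)
  obtain ⟨v0, hv0⟩ := hO
  let OB := {x : Bits V r // O x.1}
  obtain ⟨j⟩ : Nonempty (OB ↪ ZMod q) :=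
    Function.Embedding.nonempty_of_card_le (by
      rw [ZMod.card]
      have : Fintype.card OB ≤ Fintype.card (Bits V r) := Fintype.card_subtype_le _
      omega)
  haveI : Nonempty OB := ⟨⟨Bits.mk v0 ⟨0, hr⟩, hv0⟩⟩
  let b : ZMod q → Bits V r := fun z => (Function.invFun j z).1
  have hb : ∀ e, O (b e).1 := fun e => (Function.invFun j e).2
  have hbs : ∀ x : Bits V r, O x.1 → ∃ e, b e = x := by
    intro x hx
    refine ⟨j ⟨x, hx⟩, ?_⟩
    have := Function.leftInverse_invFun j.injective ⟨x, hx⟩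
    change (Function.invFun j (j ⟨x, hx⟩)).1 = x
    rw [this]
  let gw : ZMod q → Equiv.Perm V × ℝ := Function.extend ι (fun e => (ge e, ω e)) (fun _ => (1, 1))
  let g : ZMod q → Equiv.Perm V := fun z => (gw z).1
  let w : ZMod q → ℝ := fun z => (gw z).2
  have hcases : ∀ z, gw z = (1, 1) ∨ ∃ e, gw z = (ge e, ω e) := fun z => extend_cases ι _ _ z
  have hg : ∀ z, (g z).symm = g z := by
    intro z
    change (gw z).1.symm = (gw z).1
    rcases hcases z with h | ⟨e, h⟩ <;> rw [h]
    · rfl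
    · exact hge e
  have hw : ∀ z, 1 ≤ w z := by
    intro z
    change 1 ≤ (gw z).2
    rcases hcases z with h | ⟨e, h⟩ <;> rw [h]
    exact hω e
  have hn : 0 ≤ 1 / ((n:ℝ) + 1) := by positivity
  have hn1 : 1 / ((n:ℝ) + 1) ≤ 1 := by
    rw [div_le_one (by positivity)]; linarith [Nat.cast_nonneg (α := ℝ) n]
  have hwn : ∀ z, w z ≤ 1 + 1 / ((n:ℝ) + 1) := by
    intro z
    change (gw z).2 ≤ _
    rcases hcases z with h | ⟨e, h⟩ <;> rw [h]
    · linarith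
    · exact hωn e
  have sumg : ∀ F : Equiv.Perm V × ℝ → ℝ, F (1, 1) = 0 → ∑ z, F (g z, w z) = ∑ e, F (ge e, ω e) := by
    intro F hF
    exact sum_extend ι (fun e => (ge e, ω e)) (1, 1) F hF
  have G1 := good_upper g hg b O hb hbs α β S K η hη (by linarith) (by omega) Kq
    (fun s v h0 h1 => K1 v s h0 h1) (fun s v h0 h1 => K2 v s h0 h1) (fun s v h0 h1 => K3 v s h0 h1)
    K0 (fun s v h0 h1 => by linarith [η1 v s h0 h1]) (by
      intro s v h0 h1 hv v' hv'
      have e := sumg (fun p => 2 * (UU α β s (p.1 v) - UU α β s v)) (by simp)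
      simp only at e
      rw [e]
      have h3 : v' = v ∨ ∃ e, v' = ge e v := by
        rcases hv' with h | ⟨z, hz⟩
        · exact Or.inl h
        · change v' = (gw z).1 v at hz
          rcases hcases z with h | ⟨e, h⟩ <;> rw [h] at hz
          · left; exact hz
          · right; exact ⟨e, hz⟩
      have := η2 v v' ⟨hv, h3⟩ s h0 h1
      linarith)
  have hbs' : ∀ v, O v → ∃ e, (b e).1 = v := by
    intro v hv
    obtain ⟨e, he⟩ := hbs (Bits.mk v ⟨0, hr⟩) hv
    exact ⟨e, by rw [he]; rfl⟩
  have hcS : c * (1 / (8 * c)) = 1/8 := by field_simp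
  have G2 := good_lower g hg b O hb hbs' w hw (fun z => (hwn z).trans (by linarith)) h hh hh1 c
    (1 / (8 * c)) K η hc hcS.le hη (by linarith) (by linarith) (by omega) Kq K4 K5 (by
      intro v hv
      have e := sumg (fun p => 2 * p.2 * (h (p.1 v) - h v)) (by simp)
      simp only at e
      rw [e]
      linarith [η3 v hv])
  have hS2 : 0 ≤ 1 / (8 * c) := by positivity
  have cs : ∀ s, s ≤ 1 / (8 * c) → c * s ≤ 1/8 := by
    intro s h1
    have := mul_le_mul_of_nonneg_left h1 hc.le
    linarith
  refine from_good n hq12 g b w hw hwn _ G1 _ G2 rfl rfl (fun _ _ => rfl) rfl rfl (fun _ _ => rfl)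
    hS hS2 ?_ ?_ ?_ ?_ ?_ ?_ ?_ ?_ a ?_ ?_ hcard ?_
  · intro x; exact U0 x.1
  · intro s x _ _; exact (UU_pos α β s x.1).le
  · change ∑ x : V × Fin r, UU α β S x.1 ≤ 1/64
    rw [Fintype.sum_prod_type]
    simp only [Finset.sum_const, Finset.card_univ, Fintype.card_fin, nsmul_eq_mul]
    rw [← Finset.mul_sum]; exact UE
  · change K / (8 * q) ≤ 1/2
    rw [div_le_iff₀ (by positivity)]; linarith
  · change (Fintype.card (Bits V r) : ℝ) * (K / (8 * q)) ≤ 1/64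
    rw [← mul_div_assoc, div_le_iff₀ (by positivity)]; linarith
  · change K / (8 * q) ≤ 1/16
    rw [div_le_iff₀ (by positivity)]; linarith
  · intro s e h0 h1
    change 9/8 ≤ h (b e).1 + 1/8 + c * s
    have := hh1 _ (hb e)
    have : 0 ≤ c * s := by positivity
    linarith
  · intro v
    change 1/8 ≤ h v + 1/8 + c * 0
    linarith [hh v]
  · intro s h0 h1
    change h a + 1/8 + c * s ≤ 3/8
    linarith [cs s h1]
  · intro s z h0 h1
    change h (g z a) + 1/8 + c * s ≤ 3/8
    have : h (g z a) ≤ 1/8 := by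
      change h ((gw z).1 a) ≤ 1/8
      rcases hcases z with h | ⟨e, h⟩ <;> rw [h]
      · exact ha
      · exact ha' e
    linarith [cs s h1]
  · change S + 1 ≤ 1 / ((n:ℝ) + 1) * (1 / (8 * c))
    rw [mul_one_div, le_div_iff₀ (by positivity)]
    linarith

end FromData
end MBS

namespace MBS

section Tree

/-- positions -/
noncomputable def Vfin (δ : ℝ) (Z : ℕ) : Finset (ℕ × ℕ × ℕ) :=
  ((range (Z+2)) ×ˢ (range (Z+2)) ×ˢ range (2^(Z+1))).filter
    (fun x => x.1 + x.2.1 ≤ Z + 1 ∧ x.2.2 < 2^(x.1 + x.2.1) ∧ (1+δ/2) * x.2.1 ≤ x.1 + 3)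

lemma mem_Vfin {δ : ℝ} {Z l r u : ℕ} : (l, r, u) ∈ Vfin δ Z ↔
    l + r ≤ Z + 1 ∧ u < 2^(l+r) ∧ (1+δ/2) * r ≤ l + 3 := by
  unfold Vfin
  rw [Finset.mem_filter]
  constructor
  · exact fun h => h.2
  · intro h
    refine ⟨?_, h⟩
    simp only [Finset.mem_product, Finset.mem_range]
    refine ⟨by omega, by omega, ?_⟩
    exact lt_of_lt_of_le h.2.1 (Nat.pow_le_pow_right (by norm_num) h.1)

/-- positions, as a type -/
@[ext]
structure VV (δ : ℝ) (Z : ℕ) : Type where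
  /-- position -/
  val : ℕ × ℕ × ℕ
  prop : val ∈ Vfin δ Z

noncomputable instance (δ : ℝ) (Z : ℕ) : Fintype (VV δ Z) :=
  Fintype.ofInjective (fun v : VV δ Z => (⟨v.val, v.prop⟩ : {x : ℕ × ℕ × ℕ // x ∈ Vfin δ Z}))
    (fun a b h => VV.ext (congrArg Subtype.val h))

variable {δ : ℝ} {Z : ℕ}

namespace VV
/-- left count -/
def l (v : VV δ Z) : ℕ := v.1.1
/-- right count -/
def r (v : VV δ Z) : ℕ := v.1.2.1
/-- index -/
def u (v : VV δ Z) : ℕ := v.1.2.2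
end VV

/-- parent -/
def par (d : Bool) (x : ℕ × ℕ × ℕ) : ℕ × ℕ × ℕ :=
  if d then (x.1 - 1, x.2.1, x.2.2 / 2) else (x.1, x.2.1 - 1, x.2.2 / 2)

/-- whether the parent makes sense -/
def parOK (d : Bool) (x : ℕ × ℕ × ℕ) : Prop := if d then 0 < x.1 else 0 < x.2.1

/-- parent within the set, or self -/
noncomputable def pp (d : Bool) (y : VV δ Z) : VV δ Z :=
  if h : parOK d y.1 ∧ par d y.1 ∈ Vfin δ Z then ⟨par d y.1, h.2⟩ else y

lemma swap_sum {V : Type} [Fintype V] (p : V → V) (c : V → ℝ) (Φ : V → ℝ) (v : V) :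
    ∑ y, c y * (Φ (Equiv.swap y (p y) v) - Φ v) =
      c v * (Φ (p v) - Φ v) + ∑ y ∈ univ.filter (fun y => y ≠ v ∧ p y = v), c y * (Φ y - Φ v) := by
  rw [← Finset.add_sum_erase _ _ (Finset.mem_univ v), Equiv.swap_apply_left]
  congr 1
  have e : univ.filter (fun y => y ≠ v ∧ p y = v) = (univ.erase v).filter (fun y => p y = v) := by
    ext y; simp
  rw [e, Finset.sum_filter]
  apply Finset.sum_congr rfl
  intro y hy
  have hy' : y ≠ v := Finset.ne_of_mem_erase hy
  split_ifs with h
  · rw [h, Equiv.swap_apply_right]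
  · rw [Equiv.swap_apply_of_ne_of_ne hy'.symm (Ne.symm h), sub_self, mul_zero]

/-- the operations -/
noncomputable def gop (e : VV δ Z × Bool × Fin (Z+2)) : Equiv.Perm (VV δ Z) :=
  if e.2.2.val < e.1.l + e.1.r then Equiv.swap e.1 (pp e.2.1 e.1) else 1

lemma gop_symm (e : VV δ Z × Bool × Fin (Z+2)) : (gop e).symm = gop e := by
  unfold gop; split_ifs
  · exact Equiv.symm_swap _ _
  · rfl

lemma count_lt (N k : ℕ) (hk : k ≤ N) (A : ℝ) :
    ∑ j : Fin N, (if j.val < k then A else 0) = k * A := by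
  rw [Fin.sum_univ_eq_sum_range (fun j => if j < k then A else 0) N, ← Finset.sum_filter]
  have : (range N).filter (fun j => j < k) = range k := by
    ext j; simp; omega
  rw [this, Finset.sum_const, Finset.card_range, nsmul_eq_mul]

lemma VV.zle (v : VV δ Z) : v.l + v.r ≤ Z + 1 := (mem_Vfin.1 v.2).1

lemma gop_sum (ω : Bool → ℝ) (Φ : VV δ Z → ℝ) (v : VV δ Z) :
    ∑ e : VV δ Z × Bool × Fin (Z+2), 2 * ω e.2.1 * (Φ (gop e v) - Φ v) =
      ∑ d : Bool, 2 * ω d * ∑ y : VV δ Z, ((y.l : ℝ) + y.r) * (Φ (Equiv.swap y (pp d y) v) - Φ v) := by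
  rw [Fintype.sum_prod_type]
  simp only [Fintype.sum_prod_type]
  rw [Finset.sum_comm]
  apply Finset.sum_congr rfl
  intro d _
  rw [Finset.mul_sum]
  apply Finset.sum_congr rfl
  intro y _
  have := count_lt (Z+2) (y.l + y.r) (by have := y.zle; omega)
    (2 * ω d * (Φ (Equiv.swap y (pp d y) v) - Φ v))
  have e2 : 2 * ω d * (((y.l : ℝ) + y.r) * (Φ (Equiv.swap y (pp d y) v) - Φ v)) =
      ((y.l + y.r : ℕ) : ℝ) * (2 * ω d * (Φ (Equiv.swap y (pp d y) v) - Φ v)) := by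
    push_cast; ring
  rw [e2, ← this]
  apply Finset.sum_congr rfl
  intro j _
  unfold gop
  simp only
  split_ifs <;> simp

/-- near positions -/
def near (l r l' r' : ℕ) : Prop := (l' = l ∧ r' = r) ∨ (l' = l + 1 ∧ r' = r) ∨ (l = l' + 1 ∧ r' = r) ∨
  (l' = l ∧ r' = r + 1) ∨ (l' = l ∧ r = r' + 1)

lemma near_symm {l r l' r' : ℕ} (h : near l r l' r') : near l' r' l r := by
  unfold near at *; omega

lemma pp_near (d : Bool) (y : VV δ Z) : near y.l y.r (pp d y).l (pp d y).r := by
  by_cases h : parOK d y.1 ∧ par d y.1 ∈ Vfin δ Z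
  · have e : pp d y = ⟨par d y.1, h.2⟩ := by rw [pp, dif_pos h]
    rw [e]
    cases d
    · have : 0 < y.1.2.1 := by simpa [parOK] using h.1
      right; right; right; right
      refine ⟨rfl, ?_⟩
      change y.1.2.1 = y.1.2.1 - 1 + 1
      omega
    · have : 0 < y.1.1 := by simpa [parOK] using h.1
      right; right; left
      refine ⟨?_, rfl⟩
      change y.1.1 = y.1.1 - 1 + 1
      omega
  · have e : pp d y = y := by rw [pp, dif_neg h]
    rw [e]; left; exact ⟨rfl, rfl⟩

lemma gop_near (e : VV δ Z × Bool × Fin (Z+2)) (v : VV δ Z) :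
    near v.l v.r (gop e v).l (gop e v).r := by
  unfold gop
  split_ifs
  · by_cases h1 : v = e.1
    · rw [h1, Equiv.swap_apply_left]; exact pp_near _ _
    · by_cases h2 : v = pp e.2.1 e.1
      · have : Equiv.swap e.1 (pp e.2.1 e.1) v = e.1 := by rw [h2, Equiv.swap_apply_right]
        rw [this]
        have := near_symm (pp_near e.2.1 e.1)
        rw [← h2] at this; exact this
      · rw [Equiv.swap_apply_of_ne_of_ne h1 h2]; left; exact ⟨rfl, rfl⟩
  · left; exact ⟨rfl, rfl⟩

/-- the cone -/
def cone (δ : ℝ) (z0 Z l r : ℕ) : Prop :=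
  (1 + δ/2) * r ≤ l ∧ (l:ℝ) ≤ (1 + 2*δ) * r ∧ z0 ≤ l + r ∧ l + r ≤ Z

lemma cone_pos {z0 l r : ℕ} (hδ : 0 < δ) (hδ1 : δ ≤ 1) (hz : 4 ≤ z0) (h : cone δ z0 Z l r) :
    0 < l ∧ 0 < r := by
  obtain ⟨h1, h2, h3, h4⟩ := h
  have hr : 0 < r := by
    by_contra h0
    have : r = 0 := by omega
    subst this
    simp at h2
    omega
  refine ⟨?_, hr⟩
  have : (0:ℝ) < r := by exact_mod_cast hr
  have : (0:ℝ) < (1 + δ/2) * r := by positivity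
  have : (0:ℝ) < l := by linarith
  exact_mod_cast this

lemma parent_sum {z0 : ℕ} (hδ : 0 < δ) (hδ1 : δ ≤ 1) (hz : 4 ≤ z0) (φ : ℕ → ℕ → ℝ) (v : VV δ Z)
    (hv : cone δ z0 Z v.l v.r) (d : Bool) :
    ∑ y : VV δ Z, ((y.l : ℝ) + y.r) * (φ (Equiv.swap y (pp d y) v).l (Equiv.swap y (pp d y) v).r
      - φ v.l v.r) =
      ((v.l : ℝ) + v.r) * (φ (if d then v.l - 1 else v.l) (if d then v.r else v.r - 1) - φ v.l v.r) +
      2 * ((v.l : ℝ) + v.r + 1) *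
        (φ (if d then v.l + 1 else v.l) (if d then v.r else v.r + 1) - φ v.l v.r) := by
  rw [swap_sum (pp d) (fun y => (y.l : ℝ) + y.r) (fun y => φ y.l y.r) v]
  obtain ⟨lp, rp⟩ := cone_pos hδ hδ1 hz hv
  obtain ⟨⟨l, r, u⟩, hm⟩ := v
  change cone δ z0 Z l r at hv
  change 0 < l at lp
  change 0 < r at rp
  obtain ⟨c1, c2, c3, c4⟩ := hv
  obtain ⟨m1, m2, m3⟩ := mem_Vfin.1 hm
  have ev : 2 ^ (l + 1 + r) = 2 * 2 ^ (l + r) := by ring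
  have ev' : 2 ^ (l + (r + 1)) = 2 * 2 ^ (l + r) := by ring
  cases d
  · have lm : (l, r - 1, u / 2) ∈ Vfin δ Z := by
      rw [mem_Vfin]
      obtain ⟨r', rfl⟩ : ∃ r', r = r' + 1 := ⟨r - 1, by omega⟩
      have e3 : 2 ^ (l + (r' + 1)) = 2 * 2 ^ (l + r') := by ring
      refine ⟨by omega, ?_, ?_⟩
      · have : r' + 1 - 1 = r' := rfl
        rw [this]; omega
      · push_cast at c1 ⊢
        linarith
    have p1 : pp false (⟨(l, r, u), hm⟩ : VV δ Z) = ⟨(l, r - 1, u / 2), lm⟩ := by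
      unfold pp
      rw [dif_pos ⟨by simpa [parOK] using rp, by simpa [par] using lm⟩]
      rfl
    have k1 : (l, r + 1, 2 * u) ∈ Vfin δ Z := by
      rw [mem_Vfin]; refine ⟨by omega, by omega, ?_⟩
      push_cast; linarith
    have k2 : (l, r + 1, 2 * u + 1) ∈ Vfin δ Z := by
      rw [mem_Vfin]; refine ⟨by omega, by omega, ?_⟩
      push_cast; linarith
    have hf : univ.filter (fun y : VV δ Z => y ≠ ⟨(l, r, u), hm⟩ ∧ pp false y = ⟨(l, r, u), hm⟩) =
        {⟨(l, r + 1, 2 * u), k1⟩, ⟨(l, r + 1, 2 * u + 1), k2⟩} := by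
      ext ⟨⟨l', r', u'⟩, hy⟩
      simp only [Finset.mem_filter, Finset.mem_univ, true_and, Finset.mem_insert,
        Finset.mem_singleton]
      constructor
      · rintro ⟨h1, h2⟩
        unfold pp at h2
        split_ifs at h2 with h3
        swap
        · exact absurd h2 h1
        have h4 := congrArg VV.val h2
        have h5 : 0 < r' := by simpa [parOK] using h3.1
        have h6 : l' = l ∧ r' - 1 = r ∧ u' / 2 = u := by simpa [par] using h4
        obtain ⟨rfl, h7, h8⟩ := h6
        have h9 : r' = r + 1 := by omega
        subst h9
        rcases (by omega : u' = 2 * u ∨ u' = 2 * u + 1) with h | h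
        · left; subst h; rfl
        · right; subst h; rfl
      · intro h
        have key : ∀ (k : ℕ) (hk : (l, r + 1, k) ∈ Vfin δ Z), k / 2 = u →
            (⟨(l, r + 1, k), hk⟩ : VV δ Z) ≠ ⟨(l, r, u), hm⟩ ∧
            pp false (⟨(l, r + 1, k), hk⟩ : VV δ Z) = ⟨(l, r, u), hm⟩ := by
          intro k hk hku
          refine ⟨?_, ?_⟩
          · intro h
            have := congrArg VV.r h
            simp [VV.r] at this
          · unfold pp
            rw [dif_pos ⟨by simp [parOK], by simpa [par, hku] using hm⟩]
            apply VV.ext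
            simp [par, hku]
        rcases h with h | h <;> rw [h]
        · exact key _ k1 (by omega)
        · exact key _ k2 (by omega)
    have hne : (⟨(l, r + 1, 2 * u), k1⟩ : VV δ Z) ≠ ⟨(l, r + 1, 2 * u + 1), k2⟩ := by
      intro h
      have := congrArg VV.u h
      simp [VV.u] at this
    rw [hf, Finset.sum_pair hne, p1]
    simp only [VV.l, VV.r, Bool.false_eq_true, if_false]
    push_cast; ring
  · have lm : (l - 1, r, u / 2) ∈ Vfin δ Z := by
      rw [mem_Vfin]
      obtain ⟨l', rfl⟩ : ∃ l', l = l' + 1 := ⟨l - 1, by omega⟩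
      have e3 : 2 ^ (l' + 1 + r) = 2 * 2 ^ (l' + r) := by ring
      refine ⟨by omega, ?_, ?_⟩
      · have : l' + 1 - 1 = l' := rfl
        rw [this]; omega
      · push_cast at c1 ⊢
        linarith
    have p1 : pp true (⟨(l, r, u), hm⟩ : VV δ Z) = ⟨(l - 1, r, u / 2), lm⟩ := by
      unfold pp
      rw [dif_pos ⟨by simpa [parOK] using lp, by simpa [par] using lm⟩]
      rfl
    have k1 : (l + 1, r, 2 * u) ∈ Vfin δ Z := by
      rw [mem_Vfin]; refine ⟨by omega, by omega, ?_⟩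
      push_cast; linarith
    have k2 : (l + 1, r, 2 * u + 1) ∈ Vfin δ Z := by
      rw [mem_Vfin]; refine ⟨by omega, by omega, ?_⟩
      push_cast; linarith
    have hf : univ.filter (fun y : VV δ Z => y ≠ ⟨(l, r, u), hm⟩ ∧ pp true y = ⟨(l, r, u), hm⟩) =
        {⟨(l + 1, r, 2 * u), k1⟩, ⟨(l + 1, r, 2 * u + 1), k2⟩} := by
      ext ⟨⟨l', r', u'⟩, hy⟩
      simp only [Finset.mem_filter, Finset.mem_univ, true_and, Finset.mem_insert,
        Finset.mem_singleton]
      constructor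
      · rintro ⟨h1, h2⟩
        unfold pp at h2
        split_ifs at h2 with h3
        swap
        · exact absurd h2 h1
        have h4 := congrArg VV.val h2
        have h5 : 0 < l' := by simpa [parOK] using h3.1
        have h6 : l' - 1 = l ∧ r' = r ∧ u' / 2 = u := by simpa [par] using h4
        obtain ⟨h7, rfl, h8⟩ := h6
        have h9 : l' = l + 1 := by omega
        subst h9
        rcases (by omega : u' = 2 * u ∨ u' = 2 * u + 1) with h | h
        · left; subst h; rfl
        · right; subst h; rfl
      · intro h
        have key : ∀ (k : ℕ) (hk : (l + 1, r, k) ∈ Vfin δ Z), k / 2 = u →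
            (⟨(l + 1, r, k), hk⟩ : VV δ Z) ≠ ⟨(l, r, u), hm⟩ ∧
            pp true (⟨(l + 1, r, k), hk⟩ : VV δ Z) = ⟨(l, r, u), hm⟩ := by
          intro k hk hku
          refine ⟨?_, ?_⟩
          · intro h
            have := congrArg VV.l h
            simp [VV.l] at this
          · unfold pp
            rw [dif_pos ⟨by simp [parOK], by simpa [par, hku] using hm⟩]
            apply VV.ext
            simp [par, hku]
        rcases h with h | h <;> rw [h]
        · exact key _ k1 (by omega)
        · exact key _ k2 (by omega)
    have hne : (⟨(l + 1, r, 2 * u), k1⟩ : VV δ Z) ≠ ⟨(l + 1, r, 2 * u + 1), k2⟩ := by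
      intro h
      have := congrArg VV.u h
      simp [VV.u] at this
    rw [hf, Finset.sum_pair hne, p1]
    simp only [VV.l, VV.r, if_true]
    push_cast; ring

lemma op_sum {z0 : ℕ} (hδ : 0 < δ) (hδ1 : δ ≤ 1) (hz : 4 ≤ z0) (ω : Bool → ℝ) (φ : ℕ → ℕ → ℝ)
    (v : VV δ Z) (hv : cone δ z0 Z v.l v.r) :
    ∑ e : VV δ Z × Bool × Fin (Z+2), 2 * ω e.2.1 * (φ (gop e v).l (gop e v).r - φ v.l v.r) =
      2 * ω true * (((v.l : ℝ) + v.r) * (φ (v.l - 1) v.r - φ v.l v.r) +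
        2 * ((v.l : ℝ) + v.r + 1) * (φ (v.l + 1) v.r - φ v.l v.r)) +
      2 * ω false * (((v.l : ℝ) + v.r) * (φ v.l (v.r - 1) - φ v.l v.r) +
        2 * ((v.l : ℝ) + v.r + 1) * (φ v.l (v.r + 1) - φ v.l v.r)) := by
  rw [gop_sum ω (fun y => φ y.l y.r) v, Fintype.sum_bool]
  rw [parent_sum hδ hδ1 hz φ v hv true, parent_sum hδ hδ1 hz φ v hv false]
  simp

end Tree
end MBS

namespace MBS

section Analysis

lemma ex_le {x : ℝ} (hx : |x| ≤ 1) : Real.exp x ≤ 1 + x + x^2 := by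
  have := abs_le.1 (Real.abs_exp_sub_one_sub_id_le hx)
  linarith [this.2]

/-- the basic function -/
noncomputable def ff (x : ℝ) : ℝ := 2 * Real.exp x + Real.exp (-x) - 3

lemma ff_le {x : ℝ} (hx : |x| ≤ 1) : ff x ≤ x + 3 * x^2 := by
  have h1 := ex_le hx
  have h2 := ex_le (x := -x) (by rwa [abs_neg])
  unfold ff
  have : (-x)^2 = x^2 := by ring
  rw [this] at h2
  linarith

lemma ff_flip (x : ℝ) : ff (-Real.log 2 - x) = ff x := by
  unfold ff
  have e1 : Real.exp (-Real.log 2 - x) = Real.exp (-x) / 2 := by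
    rw [show -Real.log 2 - x = -x - Real.log 2 by ring, Real.exp_sub, Real.exp_log (by norm_num)]
  have e2 : Real.exp (-(-Real.log 2 - x)) = 2 * Real.exp x := by
    rw [show -(-Real.log 2 - x) = Real.log 2 + x by ring, Real.exp_add,
      Real.exp_log (by norm_num)]
  rw [e1, e2]; ring

lemma exp_seg (a b θ : ℝ) (h0 : 0 ≤ θ) (h1 : θ ≤ 1) :
    Real.exp (a + θ * (b - a)) ≤ (1 - θ) * Real.exp a + θ * Real.exp b := by
  have := convexOn_exp.2 (Set.mem_univ a) (Set.mem_univ b) (sub_nonneg.2 h1) h0 (by ring)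
  simp only [smul_eq_mul] at this
  rw [show a + θ * (b - a) = (1 - θ) * a + θ * b by ring]
  exact this

lemma ff_seg (x θ : ℝ) (h0 : 0 ≤ θ) (h1 : θ ≤ 1) :
    ff (x + θ * ((-Real.log 2 - x) - x)) ≤ ff x := by
  have e := ff_flip x
  have a1 := exp_seg x (-Real.log 2 - x) θ h0 h1
  have a2 := exp_seg (-x) (-(-Real.log 2 - x)) θ h0 h1
  have a3 : -(x + θ * ((-Real.log 2 - x) - x)) = -x + θ * (-(-Real.log 2 - x) - (-x)) := by ring
  have : ff (x + θ * ((-Real.log 2 - x) - x)) ≤ (1 - θ) * ff x + θ * ff (-Real.log 2 - x) := by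
    unfold ff
    rw [a3]
    linarith
  rw [e] at this
  linarith

/-- the generator -/
noncomputable def LL (w1 w2 : ℝ) (φ : ℕ → ℕ → ℝ) (l r : ℕ) : ℝ :=
  2 * w1 * (((l : ℝ) + r) * (φ (l - 1) r - φ l r) +
        2 * ((l : ℝ) + r + 1) * (φ (l + 1) r - φ l r)) +
      2 * w2 * (((l : ℝ) + r) * (φ l (r - 1) - φ l r) +
        2 * ((l : ℝ) + r + 1) * (φ l (r + 1) - φ l r))

/-- exponentials -/
noncomputable def EE (p q k : ℝ) (l r : ℕ) : ℝ := Real.exp (p * l + q * r + k)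

lemma LL_EE (w1 w2 p q k : ℝ) (l r : ℕ) (hl : 0 < l) (hr : 0 < r) :
    LL w1 w2 (EE p q k) l r =
      2 * (((l:ℝ) + r) * (w1 * ff p + w2 * ff q) +
        2 * (w1 * (Real.exp p - 1) + w2 * (Real.exp q - 1))) * EE p q k l r := by
  obtain ⟨l, rfl⟩ : ∃ l', l = l' + 1 := ⟨l - 1, by omega⟩
  obtain ⟨r, rfl⟩ : ∃ l', r = l' + 1 := ⟨r - 1, by omega⟩
  have e1 : EE p q k (l + 1 - 1) (r + 1) = Real.exp (-p) * EE p q k (l+1) (r+1) := by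
    unfold EE; rw [← Real.exp_add]; congr 1; simp; ring
  have e2 : EE p q k (l + 1 + 1) (r + 1) = Real.exp p * EE p q k (l+1) (r+1) := by
    unfold EE; rw [← Real.exp_add]; congr 1; push_cast; ring
  have e3 : EE p q k (l + 1) (r + 1 - 1) = Real.exp (-q) * EE p q k (l+1) (r+1) := by
    unfold EE; rw [← Real.exp_add]; congr 1; simp; ring
  have e4 : EE p q k (l + 1) (r + 1 + 1) = Real.exp q * EE p q k (l+1) (r+1) := by
    unfold EE; rw [← Real.exp_add]; congr 1; push_cast; ring
  unfold LL
  rw [e1, e2, e3, e4]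
  unfold ff
  ring

lemma EE_pos (p q k : ℝ) (l r : ℕ) : 0 < EE p q k l r := Real.exp_pos _

lemma LL_EE_nonpos (w1 p q k : ℝ) (l r : ℕ) (hl : 0 < l) (hr : 0 < r) (hw : 0 ≤ w1)
    (hp : |p| ≤ 1) (hq : |q| ≤ 1) (h : w1 * (p + 3 * p^2) + (q + 3 * q^2) ≤ 0) :
    LL w1 1 (EE p q k) l r ≤ 0 := by
  rw [LL_EE _ _ _ _ _ _ _ hl hr]
  have a1 := mul_le_mul_of_nonneg_left (ff_le hp) hw
  have a2 := ff_le hq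
  have a3 := mul_le_mul_of_nonneg_left (ex_le hp) hw
  have a4 := ex_le hq
  have a5 : 0 ≤ w1 * p^2 := by positivity
  have a6 : 0 ≤ q^2 := by positivity
  have b1 : w1 * ff p + 1 * ff q ≤ 0 := by linarith
  have b2 : w1 * (Real.exp p - 1) + 1 * (Real.exp q - 1) ≤ 0 := by linarith
  have b3 : (0:ℝ) ≤ (l:ℝ) + r := by positivity
  have b4 := mul_nonpos_of_nonneg_of_nonpos b3 b1
  apply mul_nonpos_of_nonpos_of_nonneg
  · linarith
  · exact (EE_pos _ _ _ _ _).le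

lemma LL_add (w1 w2 : ℝ) (φ ψ : ℕ → ℕ → ℝ) (l r : ℕ) :
    LL w1 w2 (fun a b => φ a b + ψ a b) l r = LL w1 w2 φ l r + LL w1 w2 ψ l r := by
  unfold LL; ring

lemma LL_log (δ K : ℝ) (hδ : 0 < δ) (hδ1 : δ ≤ 1) (hK : 0 < K) (l r : ℕ) (hl : 0 < l) (hr : 0 < r) :
    LL (1+δ) 1 (fun a b => Real.log ((a:ℝ) + b + 1) / K) l r ≤ 12 / K := by
  obtain ⟨l, rfl⟩ : ∃ l', l = l' + 1 := ⟨l - 1, by omega⟩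
  obtain ⟨r, rfl⟩ : ∃ l', r = l' + 1 := ⟨r - 1, by omega⟩
  unfold LL
  simp only [Nat.add_sub_cancel]
  push_cast
  have hl0 : (0:ℝ) ≤ l := Nat.cast_nonneg _
  have hr0 : (0:ℝ) ≤ r := Nat.cast_nonneg _
  obtain ⟨z, hz⟩ : ∃ z : ℝ, z = l + 1 + (r + 1) := ⟨_, rfl⟩
  rw [show (l:ℝ) + (r + 1) + 1 = z by rw [hz]; ring, show (l:ℝ) + 1 + r + 1 = z by rw [hz]; ring,
    show (l:ℝ) + 1 + 1 + (r + 1) + 1 = z + 2 by rw [hz]; ring,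
    show (l:ℝ) + 1 + (r + 1 + 1) + 1 = z + 2 by rw [hz]; ring, ← hz]
  have zp : 0 < z := by rw [hz]; positivity
  have d1 : Real.log z ≤ Real.log (z+1) := Real.log_le_log zp (by linarith)
  have d2 : (z+1) * (Real.log (z+2) - Real.log (z+1)) ≤ 1 := by
    rw [← Real.log_div (by linarith) (by linarith)]
    have := Real.log_le_sub_one_of_pos (x := (z+2)/(z+1)) (by positivity)
    have e : (z+2)/(z+1) - 1 = 1/(z+1) := by field_simp; ring
    rw [e] at this
    calc _ ≤ (z+1) * (1/(z+1)) := mul_le_mul_of_nonneg_left this (by linarith)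
      _ = 1 := by field_simp
  have d3 : z * (Real.log z - Real.log (z+1)) ≤ 0 :=
    mul_nonpos_of_nonneg_of_nonpos zp.le (by linarith)
  have e : 2 * (1 + δ) * (z * (Real.log z / K - Real.log (z + 1) / K) +
      2 * (z + 1) * (Real.log (z + 2) / K - Real.log (z + 1) / K)) +
      2 * 1 * (z * (Real.log z / K - Real.log (z + 1) / K) +
      2 * (z + 1) * (Real.log (z + 2) / K - Real.log (z + 1) / K)) =
      (2 * (2 + δ) * (z * (Real.log z - Real.log (z+1)) +
        2 * ((z+1) * (Real.log (z+2) - Real.log (z+1))))) / K := by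
    field_simp; ring
  rw [e]
  apply div_le_div_of_nonneg_right _ hK.le
  have f1 : z * (Real.log z - Real.log (z+1)) +
        2 * ((z+1) * (Real.log (z+2) - Real.log (z+1))) ≤ 2 := by linarith
  have f2 := mul_le_mul_of_nonneg_left f1 (show 0 ≤ 2 * (2 + δ) by linarith)
  linarith

/-- the lower test function -/
noncomputable def hfun (δ t : ℝ) (z0 Z : ℕ) (l r : ℕ) : ℝ :=
  EE (-t) (t * (1 + δ/2)) 0 l r + (EE t (-t * (1 + 2*δ)) 0 l r +
    (EE (-t) (-t) (t * z0) l r + Real.log ((l:ℝ) + r + 1) / Real.log ((Z:ℝ) + 1)))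

lemma LL_hfun (δ t : ℝ) (hδ : 0 < δ) (hδ1 : δ ≤ 1) (ht : t = δ / 40) (z0 Z : ℕ) (hZ : 0 < Z)
    (l r : ℕ) (hl : 0 < l) (hr : 0 < r) :
    LL (1+δ) 1 (hfun δ t z0 Z) l r < 13 / Real.log ((Z:ℝ) + 1) := by
  have hZ' : (0:ℝ) < Z := by exact_mod_cast hZ
  have hK : 0 < Real.log ((Z:ℝ) + 1) := Real.log_pos (by linarith)
  have t0 : 0 < t := by rw [ht]; positivity
  have t1 : t ≤ 1/40 := by rw [ht]; linarith
  have e : LL (1+δ) 1 (hfun δ t z0 Z) l r = LL (1+δ) 1 (EE (-t) (t * (1 + δ/2)) 0) l r +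
      (LL (1+δ) 1 (EE t (-t * (1 + 2*δ)) 0) l r + (LL (1+δ) 1 (EE (-t) (-t) (t * z0)) l r +
        LL (1+δ) 1 (fun a b => Real.log ((a:ℝ) + b + 1) / Real.log ((Z:ℝ) + 1)) l r)) := by
    unfold hfun
    rw [LL_add, LL_add, LL_add]
  have tt : t * (t * 40) = t * δ := by rw [ht]; ring
  have td : t * δ ≤ 1/40 := by
    have := mul_le_mul t1 hδ1 hδ.le (by norm_num)
    linarith
  have td0 : 0 < t * δ := mul_pos t0 hδ
  have tdd : t * t * δ ≤ t * t := by
    have := mul_le_mul_of_nonneg_left hδ1 (mul_pos t0 t0).le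
    linarith
  have tdd2 : t * t * (δ * δ) ≤ t * t := by
    have := mul_le_mul_of_nonneg_left (mul_le_one₀ hδ1 hδ.le hδ1) (mul_pos t0 t0).le
    linarith
  have ttp := mul_pos t0 t0
  have n1 := LL_EE_nonpos (1+δ) (-t) (t * (1 + δ/2)) 0 l r hl hr (by linarith)
    (by rw [abs_neg, abs_of_pos t0]; linarith)
    (by rw [abs_of_pos (by positivity)]; linarith)
    (by
      have : (1+δ) * (-t + 3 * (-t)^2) + (t * (1 + δ/2) + 3 * (t * (1 + δ/2))^2) =
        - (t*δ)/2 + 6 * (t*t) + 6 * (t*t*δ) + 3/4 * (t*t*(δ*δ)) := by ring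
      rw [this]; linarith)
  have n2 := LL_EE_nonpos (1+δ) t (-t * (1 + 2*δ)) 0 l r hl hr (by linarith)
    (by rw [abs_of_pos t0]; linarith)
    (by rw [neg_mul, abs_neg, abs_of_pos (by positivity)]; linarith)
    (by
      have : (1+δ) * (t + 3 * t^2) + (-t * (1 + 2*δ) + 3 * (-t * (1 + 2*δ))^2) =
        - (t*δ) + 6 * (t*t) + 15 * (t*t*δ) + 12 * (t*t*(δ*δ)) := by ring
      rw [this]; linarith)
  have n3 := LL_EE_nonpos (1+δ) (-t) (-t) (t * z0) l r hl hr (by linarith)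
    (by rw [abs_neg, abs_of_pos t0]; linarith)
    (by rw [abs_neg, abs_of_pos t0]; linarith)
    (by
      have : (1+δ) * (-t + 3 * (-t)^2) + (-t + 3 * (-t)^2) =
        - 2 * t - t * δ + 6 * (t*t) + 3 * (t*t*δ) := by ring
      rw [this]; linarith)
  have n4 := LL_log δ _ hδ hδ1 hK l r hl hr
  rw [e]
  have : 12 / Real.log ((Z:ℝ) + 1) < 13 / Real.log ((Z:ℝ) + 1) := by
    apply div_lt_div_of_pos_right (by norm_num) hK
  linarith

lemma hfun_nonneg (δ t : ℝ) (z0 Z l r : ℕ) : 0 ≤ hfun δ t z0 Z l r := by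
  unfold hfun
  have : 0 ≤ Real.log ((l:ℝ) + r + 1) / Real.log ((Z:ℝ) + 1) := by
    apply div_nonneg <;> apply Real.log_nonneg
    · have := Nat.cast_nonneg (α := ℝ) l
      have := Nat.cast_nonneg (α := ℝ) r
      linarith
    · have := Nat.cast_nonneg (α := ℝ) Z
      linarith
  have := EE_pos (-t) (t * (1 + δ/2)) 0 l r
  have := EE_pos t (-t * (1 + 2*δ)) 0 l r
  have := EE_pos (-t) (-t) (t * z0) l r
  linarith

lemma hfun_out (δ t : ℝ) (t0 : 0 < t) (z0 Z l r : ℕ) (hZ : 0 < Z) (h : ¬ cone δ z0 Z l r) :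
    1 ≤ hfun δ t z0 Z l r := by
  have a1 := EE_pos (-t) (t * (1 + δ/2)) 0 l r
  have a2 := EE_pos t (-t * (1 + 2*δ)) 0 l r
  have a3 := EE_pos (-t) (-t) (t * z0) l r
  have hZ' : (0:ℝ) < Z := by exact_mod_cast hZ
  have hK : 0 < Real.log ((Z:ℝ) + 1) := Real.log_pos (by linarith)
  have a4 : 0 ≤ Real.log ((l:ℝ) + r + 1) / Real.log ((Z:ℝ) + 1) := by
    apply div_nonneg _ hK.le
    apply Real.log_nonneg
    have := Nat.cast_nonneg (α := ℝ) l
    have := Nat.cast_nonneg (α := ℝ) r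
    linarith
  have one : ∀ p q k : ℝ, 0 ≤ p * l + q * r + k → 1 ≤ EE p q k l r := fun p q k hk =>
    Real.one_le_exp hk
  unfold hfun
  by_cases b1 : (1 + δ/2) * r ≤ l
  swap
  · have := one (-t) (t * (1 + δ/2)) 0 (by
      have := mul_le_mul_of_nonneg_left (not_le.1 b1).le t0.le
      linarith)
    linarith
  by_cases b2 : (l:ℝ) ≤ (1 + 2*δ) * r
  swap
  · have := one t (-t * (1 + 2*δ)) 0 (by
      have := mul_le_mul_of_nonneg_left (not_le.1 b2).le t0.le
      linarith)
    linarith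
  by_cases b3 : z0 ≤ l + r
  swap
  · have := one (-t) (-t) (t * z0) (by
      have h3 : ((l + r : ℕ):ℝ) ≤ z0 := by exact_mod_cast (not_le.1 b3).le
      push_cast at h3
      have := mul_le_mul_of_nonneg_left h3 t0.le
      linarith)
    linarith
  by_cases b4 : l + r ≤ Z
  · exact absurd ⟨b1, b2, b3, b4⟩ h
  · have h3 : (Z:ℝ) ≤ ((l + r : ℕ):ℝ) := by exact_mod_cast (not_le.1 b4).le
    push_cast at h3
    have : 1 ≤ Real.log ((l:ℝ) + r + 1) / Real.log ((Z:ℝ) + 1) := by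
      rw [le_div_iff₀ hK, one_mul]
      exact Real.log_le_log (by linarith) (by linarith)
    linarith

lemma near_bounds {l r l' r' : ℕ} (h : near l r l' r') :
    (l:ℝ) - 1 ≤ l' ∧ (l':ℝ) ≤ l + 1 ∧ (r:ℝ) - 1 ≤ r' ∧ (r':ℝ) ≤ r + 1 := by
  unfold near at h
  have h1 : l ≤ l' + 1 ∧ l' ≤ l + 1 ∧ r ≤ r' + 1 ∧ r' ≤ r + 1 := by omega
  obtain ⟨a, b, c, d⟩ := h1
  have a' : (l:ℝ) ≤ l' + 1 := by exact_mod_cast a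
  have b' : (l':ℝ) ≤ l + 1 := by exact_mod_cast b
  have c' : (r:ℝ) ≤ r' + 1 := by exact_mod_cast c
  have d' : (r':ℝ) ≤ r + 1 := by exact_mod_cast d
  exact ⟨by linarith, b', by linarith, d'⟩

lemma exp_neg4 {x : ℝ} (hx : x ≤ -4) : Real.exp x ≤ 1/32 := by
  have h1 : Real.exp x ≤ Real.exp (-4) := Real.exp_le_exp.2 hx
  have h2 : Real.exp (-4) = (Real.exp 1)⁻¹ ^ 4 := by
    rw [← Real.exp_neg, ← Real.exp_nat_mul]; norm_num
  have h3 : (Real.exp 1)⁻¹ ≤ (2.7:ℝ)⁻¹ := by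
    apply inv_anti₀ (by norm_num)
    have := Real.exp_one_gt_d9
    linarith
  have h4 : (Real.exp 1)⁻¹ ^ 4 ≤ (2.7:ℝ)⁻¹ ^ 4 :=
    pow_le_pow_left₀ (by positivity) h3 4
  have h5 : (2.7:ℝ)⁻¹ ^ 4 ≤ 1/32 := by norm_num
  linarith

lemma hfun_near (δ t : ℝ) (hδ : 0 < δ) (hδ1 : δ ≤ 1) (t0 : 0 < t) (z0 Z l R l' r' : ℕ) (hZ : 0 < Z)
    (hl1 : (1 + δ) * R ≤ l) (hl2 : (l:ℝ) ≤ (1 + δ) * R + 1) (hn : near l R l' r')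
    (c1 : 4 ≤ t * (δ * R / 2 - 3)) (c2 : 4 ≤ t * (δ * R - 5))
    (c3 : 4 ≤ t * (2 * R - 2 - z0))
    (c4 : 32 * Real.log (3 * R + 6) ≤ Real.log ((Z:ℝ) + 1)) :
    hfun δ t z0 Z l' r' ≤ 1/8 := by
  obtain ⟨b1, b2, b3, b4⟩ := near_bounds hn
  have hR : (0:ℝ) ≤ R := Nat.cast_nonneg _
  have hl' : (0:ℝ) ≤ l' := Nat.cast_nonneg _
  have hr' : (0:ℝ) ≤ r' := Nat.cast_nonneg _
  have hZ' : (0:ℝ) < Z := by exact_mod_cast hZ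
  have hK : 0 < Real.log ((Z:ℝ) + 1) := Real.log_pos (by linarith)
  have dR : δ * R ≤ R := by
    have := mul_le_mul_of_nonneg_right hδ1 hR
    linarith
  have dR0 : 0 ≤ δ * R := by positivity
  have x1 : δ * r' ≤ δ * (R + 1) := mul_le_mul_of_nonneg_left b4 hδ.le
  have x2 : δ * (R - 1) ≤ δ * r' := mul_le_mul_of_nonneg_left b3 hδ.le
  have m1 : EE (-t) (t * (1 + δ/2)) 0 l' r' ≤ 1/32 := by
    apply exp_neg4
    have : δ * R / 2 - 3 ≤ l' - (1 + δ/2) * r' := by linarith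
    have := mul_le_mul_of_nonneg_left this t0.le
    linarith
  have m2 : EE t (-t * (1 + 2*δ)) 0 l' r' ≤ 1/32 := by
    apply exp_neg4
    have : δ * R - 5 ≤ (1 + 2*δ) * r' - l' := by linarith
    have := mul_le_mul_of_nonneg_left this t0.le
    linarith
  have m3 : EE (-t) (-t) (t * z0) l' r' ≤ 1/32 := by
    apply exp_neg4
    have : 2 * (R:ℝ) - 2 - z0 ≤ l' + r' - z0 := by linarith
    have := mul_le_mul_of_nonneg_left this t0.le
    linarith
  have m4 : Real.log ((l':ℝ) + r' + 1) / Real.log ((Z:ℝ) + 1) ≤ 1/32 := by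
    rw [div_le_iff₀ hK]
    have := Real.log_le_log (x := (l':ℝ) + r' + 1) (y := 3 * R + 6) (by linarith) (by linarith)
    linarith
  unfold hfun
  linarith

end Analysis
end MBS

namespace MBS

section Upper

variable {δ : ℝ} {Z : ℕ}

/-- p coefficient -/
noncomputable def pc (x θ : ℝ) : ℝ := x + θ * ((-Real.log 2 - x) - x)

/-- alpha -/
noncomputable def al (δ t : ℝ) (l r : ℕ) : ℝ := Real.log 6 + t * l + (-t * (1 + δ/2)) * r

/-- beta -/
noncomputable def be (δ t lam S : ℝ) (l r : ℕ) : ℝ :=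
  lam - (((-Real.log 2 - t) - t) * l + ((-Real.log 2 - (-t * (1 + δ/2))) - (-t * (1 + δ/2))) * r) / S

lemma UU_eq (t lam S : ℝ) (hS : 0 < S) (s : ℝ) (v : VV δ Z) :
    UU (fun v : VV δ Z => al δ t v.l v.r) (fun v => be δ t lam S v.l v.r) s v =
      EE (pc t (s/S)) (pc (-t * (1 + δ/2)) (s/S)) (Real.log 6 - lam * s) v.l v.r := by
  unfold UU EE al be pc
  congr 1
  field_simp
  ring

lemma pc_bounds (x θ m : ℝ) (h0 : 0 ≤ θ) (h1 : θ ≤ 1) (hm : 0 ≤ m) (hm1 : m ≤ 1/10)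
    (hx : |x| ≤ m) : -1 ≤ pc x θ ∧ pc x θ ≤ m ∧ (x ≤ 0 → pc x θ ≤ 0) := by
  obtain ⟨h2, h3⟩ := abs_le.1 hx
  have l2 := Real.log_two_lt_d9
  have l2' := Real.log_two_gt_d9
  unfold pc
  have e : x + θ * ((-Real.log 2 - x) - x) = (1 - θ) * x + θ * (-Real.log 2 - x) := by ring
  rw [e]
  have h1' : 0 ≤ 1 - θ := by linarith
  refine ⟨?_, ?_, ?_⟩
  · have a1 := mul_le_mul_of_nonneg_left (show -1 ≤ x by linarith) h1'
    have a2 := mul_le_mul_of_nonneg_left (show -1 ≤ -Real.log 2 - x by linarith) h0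
    linarith
  · have a1 := mul_le_mul_of_nonneg_left h3 h1'
    have a2 := mul_le_mul_of_nonneg_left (show -Real.log 2 - x ≤ m by linarith) h0
    linarith
  · intro hx
    have a1 := mul_nonpos_of_nonneg_of_nonpos h1' hx
    have a2 := mul_nonpos_of_nonneg_of_nonpos h0 (show -Real.log 2 - x ≤ 0 by linarith)
    linarith

lemma EE_near {p q k : ℝ} (hp : |p| ≤ 1) (hq : |q| ≤ 1) {l r l' r' : ℕ} (h : near l r l' r') :
    EE p q k l' r' ≤ 3 * EE p q k l r := by
  have e3 : Real.exp 1 ≤ 3 := by have := Real.exp_one_lt_d9; linarith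
  obtain ⟨p1, p2⟩ := abs_le.1 hp
  obtain ⟨q1, q2⟩ := abs_le.1 hq
  have key : p * l' + q * r' + k ≤ 1 + (p * l + q * r + k) := by
    unfold near at h
    rcases h with ⟨rfl, rfl⟩ | ⟨rfl, rfl⟩ | ⟨rfl, rfl⟩ | ⟨rfl, rfl⟩ | ⟨rfl, rfl⟩ <;> push_cast <;>
      linarith
  unfold EE
  calc Real.exp (p * l' + q * r' + k) ≤ Real.exp (1 + (p * l + q * r + k)) := Real.exp_le_exp.2 key
    _ = Real.exp 1 * Real.exp (p * l + q * r + k) := Real.exp_add _ _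
    _ ≤ _ := mul_le_mul_of_nonneg_right e3 (Real.exp_pos _).le

lemma upper_main (t κ lam S : ℝ) (hδ : 0 < δ) (hδ1 : δ ≤ 1) (ht : t = δ / 40) (hκ : κ = t * δ / 4)
    (z0 : ℕ) (hz0 : 4 ≤ κ * z0) (hlam : lam = z0 * κ / 6) (hS : 12 / κ ≤ S)
    (s : ℝ) (hs0 : 0 ≤ s) (hsS : s ≤ S) (l r l' r' : ℕ) (hl : 0 < l) (hr : 0 < r)
    (hz : z0 ≤ l + r) (hn : near l r l' r') (k : ℝ) :
    LL 1 1 (EE (pc t (s/S)) (pc (-t * (1 + δ/2)) (s/S)) k) l r <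
      - be δ t lam S l' r' * EE (pc t (s/S)) (pc (-t * (1 + δ/2)) (s/S)) k l' r' := by
  have t0 : 0 < t := by rw [ht]; positivity
  have t1 : t ≤ 1/40 := by rw [ht]; linarith
  have κ0 : 0 < κ := by rw [hκ]; positivity
  have S0 : 0 < S := lt_of_lt_of_le (by positivity) hS
  have θ0 : 0 ≤ s / S := by positivity
  have θ1 : s / S ≤ 1 := by rw [div_le_one S0]; exact hsS
  have tt : t * (t * 40) = t * δ := by rw [ht]; ring
  have td : t * δ ≤ 1/40 := by
    have := mul_le_mul t1 hδ1 hδ.le (by norm_num)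
    linarith
  have td0 : 0 < t * δ := mul_pos t0 hδ
  have ttp := mul_pos t0 t0
  have tdd : t * t * δ ≤ t * t := by
    have := mul_le_mul_of_nonneg_left hδ1 ttp.le
    linarith
  have tdd2 : t * t * (δ * δ) ≤ t * t := by
    have := mul_le_mul_of_nonneg_left (mul_le_one₀ hδ1 hδ.le hδ1) ttp.le
    linarith
  have aq : |(-t * (1 + δ/2))| ≤ 1/20 := by
    rw [neg_mul, abs_neg, abs_of_pos (by positivity)]; linarith
  have ap : |t| ≤ 1/20 := by rw [abs_of_pos t0]; linarith
  have ap' : |t| ≤ t := by rw [abs_of_pos t0]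
  obtain ⟨P1, P2, -⟩ := pc_bounds t (s/S) t θ0 θ1 t0.le (by linarith) ap'
  obtain ⟨Q1, -, Q2⟩ := pc_bounds _ (s/S) (1/20) θ0 θ1 (by norm_num) (by norm_num) aq
  have Q3 := Q2 (by have : 0 < t * (1 + δ/2) := by positivity
                    linarith)
  have F1 : ff (pc t (s/S)) ≤ t + 3 * t^2 :=
    (ff_seg t (s/S) θ0 θ1).trans (ff_le (by linarith))
  have F2 : ff (pc (-t * (1 + δ/2)) (s/S)) ≤ (-t * (1 + δ/2)) + 3 * (-t * (1 + δ/2))^2 :=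
    (ff_seg _ (s/S) θ0 θ1).trans (ff_le (by linarith))
  obtain ⟨p, hp⟩ : ∃ p, p = pc t (s/S) := ⟨_, rfl⟩
  obtain ⟨q, hq⟩ : ∃ q, q = pc (-t * (1 + δ/2)) (s/S) := ⟨_, rfl⟩
  rw [← hp] at P1 P2 F1 ⊢
  rw [← hq] at Q1 Q3 F2 ⊢
  have F : ff p + ff q ≤ -κ := by
    have e : (-t * (1 + δ/2)) + 3 * (-t * (1 + δ/2))^2 + (t + 3 * t^2) =
      -(t*δ)/2 + 6 * (t*t) + 3 * (t*t*δ) + 3/4*(t*t*(δ*δ)) := by ring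
    rw [hκ]
    linarith
  rw [LL_EE _ _ _ _ _ _ _ hl hr]
  have E1 : Real.exp p ≤ 1 + 1/4 := by
    have h1 : Real.exp p ≤ Real.exp t := Real.exp_le_exp.2 P2
    have h2 := ex_le (x := t) (by linarith)
    have h3 : t^2 ≤ t := by
      have := mul_le_mul_of_nonneg_left (show t ≤ 1 by linarith) t0.le
      linarith [sq t]
    linarith
  have E2 : Real.exp q ≤ 1 := Real.exp_le_one_iff.2 Q3
  have N := EE_near (k := k) (show |p| ≤ 1 from abs_le.2 ⟨P1, by linarith⟩)
    (show |q| ≤ 1 from abs_le.2 ⟨Q1, by linarith⟩) hn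
  have pos := EE_pos p q k l r
  have pos' := EE_pos p q k l' r'
  have l2 := Real.log_two_lt_d9
  have l2' := Real.log_two_gt_d9
  have hn' : (l':ℝ) + r' ≤ l + r + 1 := by
    have : l' + r' ≤ l + r + 1 := by unfold near at hn; omega
    exact_mod_cast this
  obtain ⟨z, hzz⟩ : ∃ z : ℝ, z = (l:ℝ) + r := ⟨_, rfl⟩
  have hz' : (z0:ℝ) ≤ z := by rw [hzz]; exact_mod_cast hz
  have Bb : be δ t lam S l' r' ≤ lam + (z + 1) / S := by
    unfold be
    have c1 : -1 * (l':ℝ) ≤ ((-Real.log 2 - t) - t) * l' :=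
      mul_le_mul_of_nonneg_right (by linarith) (Nat.cast_nonneg _)
    have c2 : -1 * (r':ℝ) ≤ ((-Real.log 2 - (-t * (1 + δ/2))) - (-t * (1 + δ/2))) * r' :=
      mul_le_mul_of_nonneg_right (by linarith) (Nat.cast_nonneg _)
    have c3 : -(z+1) ≤ ((-Real.log 2 - t) - t) * l' +
      ((-Real.log 2 - (-t * (1 + δ/2))) - (-t * (1 + δ/2))) * r' := by linarith
    have c4 := div_le_div_of_nonneg_right c3 S0.le
    rw [neg_div] at c4
    linarith
  have zS : (z + 1) / S ≤ (z + 1) * κ / 12 := by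
    have hz1 : 0 ≤ z + 1 := by rw [hzz]; positivity
    have : 1 / S ≤ κ / 12 := by
      rw [div_le_iff₀ S0]
      rw [div_le_iff₀ κ0] at hS
      linarith
    have := mul_le_mul_of_nonneg_left this hz1
    rw [mul_one_div] at this
    linarith
  have zk := mul_le_mul_of_nonneg_left hz' κ0.le
  have κ1 : κ ≤ 1 := by rw [hκ]; linarith
  -- assemble
  have Bpos : 0 ≤ lam + (z + 1) / S := by
    have hz1 : 0 ≤ z + 1 := by rw [hzz]; positivity
    have : 0 ≤ lam := by rw [hlam]; positivity
    positivity
  have R1 : be δ t lam S l' r' * EE p q k l' r' ≤ (lam + (z+1)/S) * (3 * EE p q k l r) :=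
    (mul_le_mul_of_nonneg_right Bb pos'.le).trans (mul_le_mul_of_nonneg_left N Bpos)
  have zn : 0 ≤ z := by rw [hzz]; positivity
  have R2 := mul_le_mul_of_nonneg_left F zn
  have R3 : 2 * (z * (1 * ff p + 1 * ff q) + 2 * (1 * (Real.exp p - 1) + 1 * (Real.exp q - 1))) <
      -(3 * (lam + (z+1)/S)) := by
    rw [hlam]
    linarith
  have R4 := mul_lt_mul_of_pos_right R3 pos
  rw [← hzz]
  linarith

end Upper
end MBS

namespace MBS

section Assembly

variable {δ : ℝ} {Z : ℕ}

lemma sum_VV (F : ℕ × ℕ × ℕ → ℝ) : ∑ v : VV δ Z, F v.val = ∑ x ∈ Vfin δ Z, F x := by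
  apply Finset.sum_bij (fun v _ => v.val)
  · intro v _; exact v.prop
  · intro a _ b _ h; exact VV.ext h
  · intro b hb; exact ⟨⟨b, hb⟩, Finset.mem_univ _, rfl⟩
  · intro v _; rfl

lemma card_VV : (Fintype.card (VV δ Z) : ℝ) ≤ ((Z:ℝ)+2) * (((Z:ℝ)+2) * 2^(Z+1)) := by
  have h1 : (Fintype.card (VV δ Z) : ℝ) = (Vfin δ Z).card := by
    have := sum_VV (δ := δ) (Z := Z) (fun _ => 1)
    simpa using this
  have h2 : (Vfin δ Z).card ≤ (Z+2) * ((Z+2) * 2^(Z+1)) := by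
    unfold Vfin
    refine (Finset.card_filter_le _ _).trans ?_
    simp [Finset.card_product]
  rw [h1]
  exact_mod_cast h2

lemma sum_half : ∑ v : VV δ Z, (1/2:ℝ)^(v.l + v.r) ≤ ((Z:ℝ)+2) * ((Z:ℝ)+2) := by
  have h1 := sum_VV (δ := δ) (Z := Z) (fun x => (1/2:ℝ)^(x.1 + x.2.1))
  change ∑ v : VV δ Z, (1/2:ℝ)^(v.val.1 + v.val.2.1) ≤ _
  rw [h1]
  have h2 : Vfin δ Z ⊆ ((range (Z+2)) ×ˢ (range (Z+2)) ×ˢ range (2^(Z+1))).filter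
      (fun x => x.2.2 < 2^(x.1 + x.2.1)) := by
    intro x hx
    unfold Vfin at hx
    rw [Finset.mem_filter] at hx ⊢
    exact ⟨hx.1, hx.2.2.1⟩
  refine (Finset.sum_le_sum_of_subset_of_nonneg h2 (fun _ _ _ => by positivity)).trans ?_
  rw [Finset.sum_filter, Finset.sum_product]
  have h3 : ∀ l ∈ range (Z+2), (∑ y ∈ (range (Z+2)) ×ˢ range (2^(Z+1)),
      if y.2 < 2^(l + y.1) then (1/2:ℝ)^(l + y.1) else 0) ≤ (Z:ℝ)+2 := by
    intro l _
    rw [Finset.sum_product]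
    have h4 : ∀ r ∈ range (Z+2), (∑ u ∈ range (2^(Z+1)),
        if u < 2^(l + r) then (1/2:ℝ)^(l + r) else 0) ≤ 1 := by
      intro r _
      rw [← Finset.sum_filter, Finset.sum_const, nsmul_eq_mul]
      have h5 : ((range (2^(Z+1))).filter (fun u => u < 2^(l+r))).card ≤ 2^(l+r) := by
        have : (range (2^(Z+1))).filter (fun u => u < 2^(l+r)) ⊆ range (2^(l+r)) := by
          intro u hu
          rw [Finset.mem_filter] at hu
          exact Finset.mem_range.2 hu.2
        have := Finset.card_le_card this
        rwa [Finset.card_range] at this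
      have h6 : (((range (2^(Z+1))).filter (fun u => u < 2^(l+r))).card : ℝ) ≤ 2^(l+r) := by
        exact_mod_cast h5
      calc _ ≤ (2:ℝ)^(l+r) * (1/2:ℝ)^(l+r) := mul_le_mul_of_nonneg_right h6 (by positivity)
        _ = 1 := by rw [← mul_pow]; norm_num
    refine (Finset.sum_le_sum h4).trans ?_
    simp
  refine (Finset.sum_le_sum h3).trans ?_
  rw [Finset.sum_const, Finset.card_range, nsmul_eq_mul]
  push_cast
  exact le_rfl

lemma U_end (t lam S : ℝ) (t0 : 0 < t) (t1 : t ≤ 1/40) (hS : 0 < S) (v : VV δ Z) :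
    UU (fun v : VV δ Z => al δ t v.l v.r) (fun v => be δ t lam S v.l v.r) S v ≤
      18 * Real.exp (-(lam * S)) * (1/2:ℝ)^(v.l + v.r) := by
  rw [UU_eq t lam S hS, div_self hS.ne']
  have h3 := (mem_Vfin.1 (show (v.l, v.r, v.u) ∈ Vfin δ Z from v.prop)).2.2
  have h4 := mul_le_mul_of_nonneg_left h3 t0.le
  have e3 : Real.exp 1 ≤ 3 := by have := Real.exp_one_lt_d9; linarith
  have e2 : Real.exp (-(Real.log 2) * ((v.l + v.r : ℕ):ℝ)) = (1/2:ℝ)^(v.l + v.r) := by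
    rw [mul_comm, Real.exp_nat_mul, Real.exp_neg, Real.exp_log (by norm_num)]
    norm_num
  have key : pc t 1 * v.l + pc (-t * (1 + δ/2)) 1 * v.r + (Real.log 6 - lam * S) ≤
      1 + Real.log 6 + (-(lam * S)) + (-(Real.log 2) * ((v.l + v.r : ℕ):ℝ)) := by
    unfold pc; push_cast
    linarith
  unfold EE
  refine (Real.exp_le_exp.2 key).trans ?_
  rw [Real.exp_add, Real.exp_add, Real.exp_add, e2, Real.exp_log (by norm_num)]
  apply mul_le_mul_of_nonneg_right _ (by positivity)
  apply mul_le_mul_of_nonneg_right _ (Real.exp_pos _).le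
  linarith

lemma U_start (t lam S : ℝ) (t0 : 0 < t) (t1 : t ≤ 1/40) (hS : 0 < S) (v : VV δ Z) :
    2 ≤ UU (fun v : VV δ Z => al δ t v.l v.r) (fun v => be δ t lam S v.l v.r) 0 v := by
  have h3 := (mem_Vfin.1 (show (v.l, v.r, v.u) ∈ Vfin δ Z from v.prop)).2.2
  have h4 := mul_le_mul_of_nonneg_left h3 t0.le
  have e3 : Real.exp 1 ≤ 3 := by have := Real.exp_one_lt_d9; linarith
  unfold UU
  have key : Real.log 6 - 1 ≤ al δ t v.l v.r - be δ t lam S v.l v.r * 0 := by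
    unfold al; linarith
  refine le_trans ?_ (Real.exp_le_exp.2 key)
  rw [Real.exp_sub, Real.exp_log (by norm_num), le_div_iff₀ (Real.exp_pos _)]
  linarith

lemma target_all (n : ℕ) : Target n := by
  obtain ⟨δ, hδe⟩ : ∃ δ : ℝ, δ = 1 / ((n:ℝ) + 1) := ⟨_, rfl⟩
  have hδ : 0 < δ := by rw [hδe]; positivity
  have hδ1 : δ ≤ 1 := by
    rw [hδe, div_le_one (by positivity)]
    have := Nat.cast_nonneg (α := ℝ) n
    linarith
  obtain ⟨t, ht⟩ : ∃ t : ℝ, t = δ / 40 := ⟨_, rfl⟩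
  have t0 : 0 < t := by rw [ht]; positivity
  have t1 : t ≤ 1/40 := by rw [ht]; linarith
  obtain ⟨κ, hκ⟩ : ∃ κ : ℝ, κ = t * δ / 4 := ⟨_, rfl⟩
  have κ0 : 0 < κ := by rw [hκ]; positivity
  obtain ⟨z1, hz1⟩ := exists_nat_ge (7488 / (δ * κ))
  obtain ⟨z0, hz0⟩ : ∃ z0 : ℕ, z0 = z1 + 4 := ⟨_, rfl⟩
  have hz4 : 4 ≤ z0 := by omega
  have kz : 7488 / δ ≤ κ * z0 := by
    have h1 : 7488 / (δ * κ) ≤ z0 := by rw [hz0]; push_cast; linarith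
    have h2 := mul_le_mul_of_nonneg_left h1 κ0.le
    have : κ * (7488 / (δ * κ)) = 7488 / δ := by field_simp
    linarith
  have d1 : 7488 ≤ 7488 / δ := by
    rw [le_div_iff₀ hδ]; linarith
  obtain ⟨lam, hlam⟩ : ∃ lam : ℝ, lam = z0 * κ / 6 := ⟨_, rfl⟩
  have hlam1 : 1248 / δ ≤ lam := by
    rw [hlam]
    have : 7488 / δ = 6 * (1248 / δ) := by ring
    linarith
  have lam0 : 0 < lam := lt_of_lt_of_le (by positivity) hlam1
  obtain ⟨R, hR⟩ := exists_nat_ge (2 * (4/t+3)/δ + (4/t+5)/δ + (4/t+2+z0)/2)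
  have R0 : (0:ℝ) ≤ R := Nat.cast_nonneg _
  have q1 : 0 ≤ 2 * (4/t+3)/δ := by positivity
  have q2 : 0 ≤ (4/t+5)/δ := by positivity
  have q3 : 0 ≤ (4/t+2+(z0:ℝ))/2 := by positivity
  have tcan : t * (4 / t) = 4 := by field_simp
  have c1 : 4 ≤ t * (δ * R / 2 - 3) := by
    have h1 : 2 * (4/t+3)/δ ≤ R := by linarith
    rw [div_le_iff₀ hδ] at h1
    have : 4/t ≤ δ * R / 2 - 3 := by linarith
    have := mul_le_mul_of_nonneg_left this t0.le
    linarith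
  have c2 : 4 ≤ t * (δ * R - 5) := by
    have h1 : (4/t+5)/δ ≤ R := by linarith
    rw [div_le_iff₀ hδ] at h1
    have : 4/t ≤ δ * R - 5 := by linarith
    have := mul_le_mul_of_nonneg_left this t0.le
    linarith
  have c3 : 4 ≤ t * (2 * R - 2 - z0) := by
    have : 4/t ≤ 2 * R - 2 - z0 := by linarith
    have := mul_le_mul_of_nonneg_left this t0.le
    linarith
  obtain ⟨T, hT⟩ : ∃ T : ℝ, T = 12 / κ := ⟨_, rfl⟩
  have T0 : 0 < T := by rw [hT]; positivity
  have l6 : 0 ≤ Real.log 3456 := Real.log_nonneg (by norm_num)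
  have lR : 0 ≤ Real.log (3 * R + 6) := Real.log_nonneg (by linarith)
  obtain ⟨M, hM⟩ : ∃ M : ℝ, M = 32 * Real.log (3 * R + 6) +
    208 * (T + 1 + Real.log 3456 / lam) / δ := ⟨_, rfl⟩
  obtain ⟨Z, hZM⟩ := exists_nat_ge (Real.exp M)
  have M0 : 0 ≤ 208 * (T + 1 + Real.log 3456 / lam) / δ := by positivity
  have Zpos' : (0:ℝ) < Z := lt_of_lt_of_le (Real.exp_pos _) hZM
  have Zpos : 0 < Z := by exact_mod_cast Zpos'
  have Z1 : (1:ℝ) ≤ Z := by exact_mod_cast Zpos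
  obtain ⟨K, hK⟩ : ∃ K : ℝ, K = Real.log ((Z:ℝ) + 1) := ⟨_, rfl⟩
  have K0 : 0 < K := by rw [hK]; exact Real.log_pos (by linarith)
  have KM : M ≤ K := by
    rw [hK, Real.le_log_iff_exp_le (by linarith)]; linarith
  have c4 : 32 * Real.log (3 * R + 6) ≤ Real.log ((Z:ℝ) + 1) := by rw [← hK]; linarith
  have ZR : 3 * (R:ℝ) + 6 ≤ Z + 1 := by
    rw [← Real.log_le_log_iff (by linarith) (by linarith)]
    linarith
  obtain ⟨S, hS⟩ : ∃ S : ℝ, S = T + Real.log (3456 * ((Z:ℝ)+2)^3) / lam := ⟨_, rfl⟩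
  have big : 1 ≤ 3456 * ((Z:ℝ)+2)^3 := by
    have : 1 ≤ ((Z:ℝ)+2)^3 := one_le_pow₀ (by linarith)
    linarith
  have lbig := Real.log_nonneg big
  have ST : T ≤ S := by
    rw [hS]
    have : 0 ≤ Real.log (3456 * ((Z:ℝ)+2)^3) / lam := by positivity
    linarith
  have S0 : 0 < S := by linarith
  -- the special point
  obtain ⟨L, hL⟩ : ∃ L : ℕ, L = ⌈(1 + δ) * R⌉₊ := ⟨_, rfl⟩
  have hL1 : (1 + δ) * R ≤ L := by rw [hL]; exact Nat.le_ceil _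
  have hL2 : (L:ℝ) ≤ (1 + δ) * R + 1 := by
    rw [hL]; exact (Nat.ceil_lt_add_one (by positivity)).le
  have dR : δ * R ≤ R := by
    have := mul_le_mul_of_nonneg_right hδ1 R0
    linarith
  have dR0 : 0 ≤ δ * R := by positivity
  have am : (L, R, 0) ∈ Vfin δ Z := by
    rw [mem_Vfin]
    refine ⟨?_, by positivity, by linarith⟩
    have : (L:ℝ) + R ≤ Z + 1 := by linarith
    exact_mod_cast this
  have om : (0, 0, 0) ∈ Vfin δ Z := by
    rw [mem_Vfin]
    refine ⟨by omega, by positivity, by simp⟩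
  obtain ⟨ω, hωd⟩ : ∃ ω : Bool → ℝ, ω = fun d => if d then 1 + δ else 1 := ⟨_, rfl⟩
  have ωt : ω true = 1 + δ := by rw [hωd]; simp
  have ωf : ω false = 1 := by rw [hωd]; simp
  refine from_data n (V := VV δ Z) (E := VV δ Z × Bool × Fin (Z+2)) gop gop_symm
    (fun e => ω e.2.1) ?_ ?_ (fun v => ¬ cone δ z0 Z v.l v.r) ?_ (3 * Z + 6) (by omega)
    (fun v => al δ t v.l v.r) (fun v => be δ t lam S v.l v.r) S S0.le ?_ ?_ ?_
    (fun v => hfun δ t z0 Z v.l v.r) (fun v => hfun_nonneg _ _ _ _ _ _)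
    (fun v hv => hfun_out δ t t0 z0 Z _ _ Zpos hv) (13 / K) (by positivity) ?_
    ⟨(L, R, 0), am⟩ ?_ ?_ ?_ ?_
  · rintro ⟨_, d, _⟩
    cases d <;> simp only [ωt, ωf] <;> linarith
  · rintro ⟨_, d, _⟩
    rw [← hδe]
    cases d <;> simp only [ωt, ωf] <;> linarith
  · refine ⟨⟨(0,0,0), om⟩, ?_⟩
    intro h
    have := h.2.2.1
    simp only [VV.l, VV.r] at this
    omega
  · intro s v hs0 hsS hv v' hv'
    have hv := not_not.1 hv
    obtain ⟨lp, rp⟩ := cone_pos hδ hδ1 hz4 hv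
    have hn : near v.l v.r v'.l v'.r := by
      rcases hv' with rfl | ⟨e, rfl⟩
      · left; exact ⟨rfl, rfl⟩
      · exact gop_near e v
    have h1 := upper_main t κ lam S hδ hδ1 ht hκ z0 (by linarith) hlam (by rw [← hT]; exact ST)
      s hs0 hsS v.l v.r v'.l v'.r lp rp hv.2.2.1 hn (Real.log 6 - lam * s)
    have h2 := op_sum hδ hδ1 hz4 (fun _ => 1)
      (EE (pc t (s/S)) (pc (-t * (1 + δ/2)) (s/S)) (Real.log 6 - lam * s)) v hv
    unfold DD
    simp only [UU_eq t lam S S0]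
    refine lt_of_eq_of_lt ?_ h1
    refine Eq.trans ?_ h2
    apply Finset.sum_congr rfl
    intro e _
    ring
  · exact fun v => U_start t lam S t0 t1 S0 v
  · have b1 : ∑ v : VV δ Z, UU (fun v : VV δ Z => al δ t v.l v.r)
        (fun v => be δ t lam S v.l v.r) S v ≤
        18 * Real.exp (-(lam * S)) * (((Z:ℝ)+2) * ((Z:ℝ)+2)) := by
      refine (Finset.sum_le_sum fun v _ => U_end t lam S t0 t1 S0 v).trans ?_
      rw [← Finset.mul_sum]
      exact mul_le_mul_of_nonneg_left sum_half (by positivity)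
    have b2 : Real.exp (-(lam * S)) ≤ (3456 * ((Z:ℝ)+2)^3)⁻¹ := by
      have : Real.log (3456 * ((Z:ℝ)+2)^3) ≤ lam * S := by
        have : lam * S = lam * T + Real.log (3456 * ((Z:ℝ)+2)^3) := by
          rw [hS]; field_simp
        have : 0 < lam * T := by positivity
        linarith
      rw [Real.exp_neg]
      apply inv_anti₀ (by positivity)
      calc 3456 * ((Z:ℝ)+2)^3 = Real.exp (Real.log (3456 * ((Z:ℝ)+2)^3)) :=
            (Real.exp_log (by positivity)).symm
        _ ≤ _ := Real.exp_le_exp.2 this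
    have b3 : ((3 * Z + 6 : ℕ):ℝ) = 3 * ((Z:ℝ)+2) := by push_cast; ring
    rw [b3]
    calc _ ≤ 3 * ((Z:ℝ)+2) * (18 * Real.exp (-(lam * S)) * (((Z:ℝ)+2) * ((Z:ℝ)+2))) :=
          mul_le_mul_of_nonneg_left b1 (by positivity)
      _ = 54 * ((Z:ℝ)+2)^3 * Real.exp (-(lam * S)) := by ring
      _ ≤ 54 * ((Z:ℝ)+2)^3 * (3456 * ((Z:ℝ)+2)^3)⁻¹ :=
          mul_le_mul_of_nonneg_left b2 (by positivity)
      _ = 1/64 := by field_simp; norm_num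
  · intro v hv
    have hv := not_not.1 hv
    obtain ⟨lp, rp⟩ := cone_pos hδ hδ1 hz4 hv
    have h2 := op_sum hδ hδ1 hz4 ω (hfun δ t z0 Z) v hv
    rw [ωt, ωf] at h2
    have h1 := LL_hfun δ t hδ hδ1 ht z0 Z Zpos v.l v.r lp rp
    rw [← hK] at h1
    exact lt_of_eq_of_lt h2 h1
  · exact hfun_near δ t hδ hδ1 t0 z0 Z L R L R Zpos hL1 hL2 (Or.inl ⟨rfl, rfl⟩) c1 c2 c3 c4
  · intro e
    exact hfun_near δ t hδ hδ1 t0 z0 Z L R _ _ Zpos hL1 hL2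
      (gop_near e (⟨(L, R, 0), am⟩ : VV δ Z)) c1 c2 c3 c4
  · rw [div_lt_iff₀ (by positivity)]
    refine lt_of_le_of_lt card_VV ?_
    have h1 : (Z:ℝ) + 2 ≤ 2^(Z+1) := by
      have : Z + 2 ≤ 2^(Z+1) := Nat.lt_two_pow_self (n := Z+1)
      exact_mod_cast this
    calc ((Z:ℝ)+2) * (((Z:ℝ)+2) * 2^(Z+1)) ≤ 2^(Z+1) * (2^(Z+1) * 2^(Z+1)) := by gcongr
      _ < 1/4 * 2^(3*Z+6) := by
        have e1 : (2:ℝ)^(Z+1) * (2^(Z+1) * 2^(Z+1)) = 2^(3*Z+3) := by ring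
        have e2 : (2:ℝ)^(3*Z+6) = 8 * 2^(3*Z+3) := by ring
        rw [e1, e2]
        have : (0:ℝ) < 2^(3*Z+3) := by positivity
        linarith
  · rw [← hδe]
    have g1 : Real.log ((Z:ℝ)+2) ≤ 2 * K := by
      have h := Real.log_le_log (x := (Z:ℝ)+2) (y := ((Z:ℝ)+1)^2) (by linarith) (by
        have := mul_le_mul_of_nonneg_left Z1 Zpos'.le
        have e : ((Z:ℝ)+1)^2 = Z * Z + 2 * Z + 1 := by ring
        rw [e]; linarith)
      rw [Real.log_pow, ← hK] at h
      exact_mod_cast h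
    have g2 : Real.log (3456 * ((Z:ℝ)+2)^3) = Real.log 3456 + 3 * Real.log ((Z:ℝ)+2) := by
      rw [Real.log_mul (by norm_num) (by positivity), Real.log_pow]; norm_num
    have g3 : 208 * (T + 1 + Real.log 3456 / lam) ≤ K * δ := by
      have : 208 * (T + 1 + Real.log 3456 / lam) / δ ≤ K := by linarith
      rwa [div_le_iff₀ hδ] at this
    have g4 : 1248 / lam ≤ δ := by
      rw [div_le_iff₀ lam0]
      rw [div_le_iff₀ hδ] at hlam1
      linarith
    have g5 : Real.log ((Z:ℝ)+2) / lam ≤ 2 * K / lam := div_le_div_of_nonneg_right g1 lam0.le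
    have g6 : 1248 / lam * K ≤ δ * K := mul_le_mul_of_nonneg_right g4 K0.le
    have g7 : S = T + Real.log 3456 / lam + 3 * (Real.log ((Z:ℝ)+2) / lam) := by
      rw [hS, g2]; ring
    have g8 : 2 * K / lam = (1248 / lam * K) / 624 := by ring
    have g9 : 8 * (13 / K) * (S + 1) = (104 * (S + 1)) / K := by ring
    rw [g9, div_le_iff₀ K0]
    rw [g8] at g5
    linarith

end Assembly
end MBS

/-- Theorem C: there are bounded-degree graphs and edge weights in `[1, 1+δ_n]`, `δ_n → 0`,
such that the unperturbed worst-case mixing time is at most `δ_n` times the perturbed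
mixing time from the *best* starting point. -/
theorem mixing_from_best_point_sensitive :
    ∃ (m : ℕ → ℕ) (G : ∀ n, SimpleGraph (Fin (m n)))
      (w : ∀ n, Fin (m n) → Fin (m n) → ℝ) (δ : ℕ → ℝ) (D : ℕ),
      Tendsto m atTop atTop ∧
      (∀ n, (G n).Connected) ∧
      (∀ n v, (G n).degree v ≤ D) ∧
      (∀ n, 0 < δ n) ∧ Tendsto δ atTop (nhds 0) ∧
      (∀ n x y, w n x y = w n y x) ∧
      (∀ n x y, (G n).Adj x y → 1 ≤ w n x y ∧ w n x y ≤ 1 + δ n) ∧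
      (∀ n, (graphMix (G n) (fun _ _ => 1) : ℝ) ≤
        δ n * (sInf {k : ℕ | ∃ x, k = graphMixFrom (G n) (w n) x} : ℕ)) := by
  exact MBS.main_of_target MBS.target_all
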